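/- Let f = x⁵ + y³ + z² ∈ ℂ(x,y,z) and let ℂ(f) be the subfield of ℂ(x,y,z) generated by f over ℂ. Let K be a field that is a finite field extension of ℂ(f), and assume that L := K ⊗_{ℂ(f)} ℂ(x,y,z) is a field. Then there exist elements g, h ∈ L such that L is generated as a field over (the image of) K by g and h if and only if there exists ρ ∈ K with ρ³⁰ = f. -/

import Mathlib

open MvPolynomial TensorProduct

set_option synthInstance.maxHeartbeats 1000000
set_option maxHeartbeats 2000000

noncomputable section

/-- The field ℂ(x,y,z): fraction field of the polynomial ring in 3 variables. -/
abbrev Fxyz : Type := FractionRing (MvPolynomial (Fin 3) ℂ)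

/-- The images of the variables x, y, z in ℂ(x,y,z). -/
def Vx : Fxyz := algebraMap (MvPolynomial (Fin 3) ℂ) Fxyz (X 0)
def Vy : Fxyz := algebraMap (MvPolynomial (Fin 3) ℂ) Fxyz (X 1)
def Vz : Fxyz := algebraMap (MvPolynomial (Fin 3) ℂ) Fxyz (X 2)

/-- The element f of ℂ(x,y,z). -/
def fE8 : Fxyz := Vx ^ 5 + Vy ^ 3 + Vz ^ 2

/-- The subfield ℂ(f) of ℂ(x,y,z) generated by f over ℂ. -/
def Cf : IntermediateField ℂ Fxyz := IntermediateField.adjoin ℂ {fE8}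

/-- The product of the first `p` iterates of `σ` at `a`. -/
def cycNorm {R : Type*} [CommMonoid R] (p : ℕ) (σ : R → R) (a : R) : R :=
  ∏ i ∈ Finset.range p, σ^[i] a

section CycNorm

lemma cycNorm_mul {R G : Type*} [CommRing R] [FunLike G R R] [MonoidHomClass G R R]
    (p : ℕ) (σ : G) (a b : R) : cycNorm p σ (a * b) = cycNorm p σ a * cycNorm p σ b := by
  simp [cycNorm, iterate_map_mul, Finset.prod_mul_distrib]

lemma cycNorm_one {R G : Type*} [CommRing R] [FunLike G R R] [MonoidHomClass G R R]
    (p : ℕ) (σ : G) : cycNorm p σ (1 : R) = 1 := by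
  simp [cycNorm, iterate_map_one]

lemma cycNorm_ne_zero {R : Type*} [CommRing R] [IsDomain R] (p : ℕ) (σ : R ≃+* R) {a : R}
    (ha : a ≠ 0) : cycNorm p σ a ≠ 0 := by
  refine Finset.prod_ne_zero_iff.2 fun i _ => ?_
  have := (σ.injective.iterate i)
  intro h
  exact ha (this (h.trans (iterate_map_zero σ i).symm))

lemma cycNorm_map {R S : Type*} [CommRing R] [CommRing S] (p : ℕ) (φ : R →+* S) (σ : R → R)
    (τ : S → S) (h : ∀ a, φ (σ a) = τ (φ a)) (a : R) :
    φ (cycNorm p σ a) = cycNorm p τ (φ a) := by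
  rw [cycNorm, cycNorm, map_prod]
  refine Finset.prod_congr rfl fun i _ => ?_
  exact (Function.Semiconj.iterate_right (f := φ) (ga := σ) (gb := τ) h i) a

lemma cycNorm_apply_self {R : Type*} [CommRing R] (p : ℕ) (σ : R → R)
    (hσ : ∀ a, σ^[p] a = a) (a : R) : cycNorm p σ (σ a) = cycNorm p σ a := by
  rw [cycNorm, cycNorm]
  have h1 : ∀ i, σ^[i] (σ a) = σ^[i + 1] a := fun i => (Function.iterate_succ_apply _ _ _).symm
  rcases p with _ | p
  · simp
  simp_rw [h1]
  rw [Finset.prod_range_succ, Finset.prod_range_succ', hσ]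
  simp

lemma cycNorm_iterate {R : Type*} [CommRing R] (p : ℕ) (σ : R → R)
    (hσ : ∀ a, σ^[p] a = a) (i : ℕ) (a : R) : cycNorm p σ (σ^[i] a) = cycNorm p σ a := by
  induction i with
  | zero => rfl
  | succ i ih => rw [Function.iterate_succ_apply', cycNorm_apply_self p σ hσ, ih]

lemma map_cycNorm {R G : Type*} [CommRing R] [FunLike G R R] [RingHomClass G R R] (p : ℕ) (σ : G)
    (hσ : ∀ a, σ^[p] a = a) (a : R) : σ (cycNorm p σ a) = cycNorm p σ a := by
  have := cycNorm_map p (RingHomClass.toRingHom σ) σ σ (fun _ => rfl) a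
  exact this.trans (cycNorm_apply_self p σ hσ a)

lemma cycNorm_eq_pow {R : Type*} [CommRing R] (p : ℕ) (σ : R → R) {a : R} (h : σ a = a) :
    cycNorm p σ a = a ^ p := by
  have : ∀ i, σ^[i] a = a := fun i => Function.iterate_fixed h i
  simp [cycNorm, this]

lemma dvd_cycNorm {R : Type*} [CommRing R] {p : ℕ} (hp : 0 < p) (σ : R → R) (a : R) :
    a ∣ cycNorm p σ a :=
  Finset.dvd_prod_of_mem (fun i => σ^[i] a) (Finset.mem_range.2 hp)

variable {A : Type*} [CommRing A]

lemma Prime.iterate_ringEquiv {π : A} (hπ : Prime π) (σ : A ≃+* A) (i : ℕ) :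
    Prime (σ^[i] π) := by
  induction i with
  | zero => exact hπ
  | succ i ih =>
    rw [Function.iterate_succ_apply']
    exact (MulEquiv.prime_iff σ.toMulEquiv).2 ih

lemma associated_iterate (σ : A ≃+* A) {a b : A} (h : Associated a b) (i : ℕ) :
    Associated (σ^[i] a) (σ^[i] b) := by
  induction i with
  | zero => exact h
  | succ i ih =>
    rw [Function.iterate_succ_apply', Function.iterate_succ_apply']
    exact ih.map σ

/-- If some intermediate iterate of an automorphism of prime order fixes `π` up to a unit, then so
does the automorphism. -/
lemma associated_of_iterate {p : ℕ} (hp : p.Prime) (σ : A ≃+* A) (hσ : ∀ a, σ^[p] a = a) {π : A}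
    {k : ℕ} (hk0 : 0 < k) (hkp : k < p) (h : Associated (σ^[k] π) π) : Associated (σ π) π := by
  have key : ∀ m, Associated (σ^[k * m] π) π := by
    intro m
    induction m with
    | zero => exact Associated.refl _
    | succ m ih =>
      rw [Nat.mul_succ, Function.iterate_add_apply]
      exact (associated_iterate σ h (k * m)).trans ih
  have hcop : Nat.Coprime k p := (Nat.coprime_of_lt_prime hk0.ne' hkp hp).symm
  obtain ⟨m, hm⟩ := Nat.exists_mul_mod_eq_one_of_coprime hcop hp.one_lt
  have h1 : σ^[k * m] π = σ π := by
    rw [← Nat.mod_add_div (k * m) p, hm.2, Function.iterate_add_apply]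
    have : ∀ j, σ^[p * j] π = π := by
      intro j
      rw [Function.iterate_mul]
      exact Function.iterate_fixed (hσ π) j
    rw [this]
    rfl
  rw [← h1]
  exact key m

variable [IsDomain A] [UniqueFactorizationMonoid A]

lemma multiplicity_cycNorm (p : ℕ) (σ : A ≃+* A) {π a : A}
    (hπ : Prime π) (hs : Associated (σ π) π) (ha : a ≠ 0) :
    multiplicity π (cycNorm p σ a) = p * multiplicity π a := by
  have hfin : ∀ {b : A}, b ≠ 0 → FiniteMultiplicity π b := fun hb =>
    FiniteMultiplicity.of_prime_left hπ hb
  have hi : ∀ i, multiplicity π (σ^[i] a) = multiplicity π a := by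
    intro i
    induction i with
    | zero => rfl
    | succ i ih =>
      rw [Function.iterate_succ_apply', ← ih]
      generalize σ^[i] a = b
      have h1 : multiplicity (σ π) (σ b) = multiplicity π b :=
        multiplicity_map_eq σ.toMulEquiv
      rw [← h1]
      exact multiplicity_eq_of_associated_left hs
  have : ∀ n, multiplicity π (∏ i ∈ Finset.range n, σ^[i] a) = n * multiplicity π a := by
    intro n
    induction n with
    | zero =>
      simp only [Finset.range_zero, Finset.prod_empty, zero_mul]
      exact multiplicity_of_one_right hπ.not_isUnit
    | succ n ih =>
      have hne : ∏ i ∈ Finset.range (n+1), σ^[i] a ≠ 0 := cycNorm_ne_zero (n+1) σ ha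
      rw [Finset.prod_range_succ] at hne ⊢
      rw [multiplicity_mul hπ (hfin hne), ih, hi]
      ring
  exact this p

/-- An invariant element of a factorial ring whose multiplicity at every invariant prime is
divisible by `p` is, up to a unit, a norm. -/
lemma exists_eq_unit_mul_cycNorm {p : ℕ} (hp : p.Prime) (σ : A ≃+* A) (hσ : ∀ a, σ^[p] a = a)
    (g : A) (hg0 : g ≠ 0) (hg : σ g = g)
    (h : ∀ π, Prime π → Associated (σ π) π → p ∣ multiplicity π g) :
    ∃ u ψ : A, IsUnit u ∧ g = u * cycNorm p σ ψ := by
  induction g using (wellFounded_dvdNotUnit (α := A)).induction with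
  | _ g ih =>
  by_cases hu : IsUnit g
  · exact ⟨g, 1, hu, by rw [cycNorm_one, mul_one]⟩
  obtain ⟨π, hπi, hπg⟩ := WfDvdMonoid.exists_irreducible_factor hu hg0
  have hπ : Prime π := hπi.prime
  have hdvd : cycNorm p σ π ∣ g := by
    by_cases hs : Associated (σ π) π
    · have hm := h π hπ hs
      have hfin : FiniteMultiplicity π g := FiniteMultiplicity.of_prime_left hπ hg0
      have h1 : p ≤ multiplicity π g := by
        refine Nat.le_of_dvd ?_ hm
        exact hfin.le_multiplicity_of_pow_dvd (by simpa using hπg)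
      have h2 : π ^ p ∣ g := (pow_dvd_pow _ h1).trans (pow_multiplicity_dvd π g)
      have hass : ∀ i, Associated (σ^[i] π) π := by
        intro i
        induction i with
        | zero => exact Associated.refl _
        | succ i ih =>
          rw [Function.iterate_succ_apply']
          exact (ih.map σ).trans hs
      have h3 : Associated (cycNorm p σ π) (π ^ p) := by
        have : π ^ p = ∏ i ∈ Finset.range p, π := by simp
        rw [this]
        exact Associated.prod _ _ _ fun i _ => hass i
      exact h3.dvd.trans h2
    · refine Finset.prod_dvd_of_isRelPrime ?_ ?_
      · intro i hi j hj hij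
        have hi' := Finset.mem_range.1 (Finset.mem_coe.1 hi)
        have hj' := Finset.mem_range.1 (Finset.mem_coe.1 hj)
        have key : ∀ i j, i < j → j < p → ¬ Associated (σ^[i] π) (σ^[j] π) := by
          intro i j hij hj hass
          have := associated_iterate σ hass (p - i)
          rw [← Function.iterate_add_apply, ← Function.iterate_add_apply,
            Nat.sub_add_cancel (by omega), hσ, show p - i + j = (j - i) + p by omega,
            Function.iterate_add_apply, hσ] at this
          exact hs (associated_of_iterate hp σ hσ (by omega) (by omega) this.symm)
        have hne : ¬ Associated (σ^[i] π) (σ^[j] π) := by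
          rcases lt_or_gt_of_ne hij with hlt | hlt
          · exact key i j hlt hj'
          · exact fun hh => key j i hlt hi' hh.symm
        have hpi := (hπ.iterate_ringEquiv σ i)
        have hpj := (hπ.iterate_ringEquiv σ j)
        refine (hpi.irreducible.isRelPrime_iff_not_dvd).2 fun hd => ?_
        exact hne (hpi.associated_of_dvd hpj hd)
      · intro i _
        have hgi : σ^[i] g = g := Function.iterate_fixed hg i
        rw [← hgi]
        obtain ⟨c, rfl⟩ := hπg
        rw [iterate_map_mul]
        exact dvd_mul_right _ _
  obtain ⟨g', rfl⟩ := hdvd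
  have hN0 : cycNorm p σ π ≠ 0 := left_ne_zero_of_mul hg0
  have hg'0 : g' ≠ 0 := right_ne_zero_of_mul hg0
  have hg' : σ g' = g' := by
    rw [map_mul, map_cycNorm p σ hσ] at hg
    exact mul_left_cancel₀ hN0 hg
  have hNu : ¬ IsUnit (cycNorm p σ π) := fun hh =>
    hπ.not_isUnit (isUnit_of_dvd_unit (dvd_cycNorm hp.pos σ π) hh)
  obtain ⟨u, ψ, hu', he⟩ := ih g' ⟨hg'0, _, hNu, mul_comm _ _⟩ hg'0 hg' (by
    intro π' hπ' hs'
    have := h π' hπ' hs'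
    rw [multiplicity_mul hπ' (FiniteMultiplicity.of_prime_left hπ' hg0),
      multiplicity_cycNorm p σ hπ' hs' hπ.ne_zero] at this
    exact (Nat.dvd_add_right (dvd_mul_right _ _)).1 this)
  exact ⟨u, π * ψ, hu', by rw [cycNorm_mul, he]; ring⟩

/-- In a factorial ring, a unit which is a quotient of norms is the norm of a unit. -/
lemma isUnit_eq_cycNorm_unit {p : ℕ} (hp : p.Prime) (σ : A ≃+* A) (hσ : ∀ a, σ^[p] a = a)
    (a : A) : ∀ (b u : A), a ≠ 0 → b ≠ 0 → IsUnit u → cycNorm p σ a = u * cycNorm p σ b →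
    ∃ w, IsUnit w ∧ u = cycNorm p σ w := by
  induction a using (wellFounded_dvdNotUnit (α := A)).induction with
  | _ a ih =>
  intro b u ha hb hu h
  by_cases hau : IsUnit a
  · have hNa : IsUnit (cycNorm p σ a) := by
      obtain ⟨c, hc⟩ := hau.exists_right_inv
      refine IsUnit.of_mul_eq_one (cycNorm p σ c) ?_
      rw [← cycNorm_mul, hc, cycNorm_one]
    have hbu : IsUnit b := by
      rw [h] at hNa
      exact isUnit_of_dvd_unit (dvd_cycNorm hp.pos σ b) (isUnit_of_mul_isUnit_right hNa)
    obtain ⟨c, hc⟩ := hbu.exists_right_inv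
    refine ⟨a * c, hau.mul (IsUnit.of_mul_eq_one _ ((mul_comm _ _).trans hc)), ?_⟩
    rw [cycNorm_mul, h, mul_assoc, ← cycNorm_mul, hc, cycNorm_one, mul_one]
  obtain ⟨π, hπi, hπa⟩ := WfDvdMonoid.exists_irreducible_factor hau ha
  have hπ : Prime π := hπi.prime
  have h1 : π ∣ cycNorm p σ b := by
    have : π ∣ u * cycNorm p σ b := h ▸ hπa.trans (dvd_cycNorm hp.pos σ a)
    exact (hu.dvd_mul_left).1 this
  obtain ⟨i, hi, hdi⟩ := (Prime.dvd_finsetProd_iff hπ _).1 h1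
  have hi' := Finset.mem_range.1 hi
  have h2 : σ^[p - i] π ∣ b := by
    obtain ⟨c, hc⟩ := hdi
    refine ⟨σ^[p - i] c, ?_⟩
    rw [← iterate_map_mul, ← hc, ← Function.iterate_add_apply, Nat.sub_add_cancel hi'.le, hσ]
  obtain ⟨a', rfl⟩ := hπa
  obtain ⟨b', rfl⟩ := h2
  refine ih a' ⟨right_ne_zero_of_mul ha, π, hπ.not_isUnit, mul_comm _ _⟩ b' u
    (right_ne_zero_of_mul ha) (right_ne_zero_of_mul hb) hu ?_
  rw [cycNorm_mul, cycNorm_mul, cycNorm_iterate p σ hσ] at h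
  refine mul_left_cancel₀ (cycNorm_ne_zero p σ hπ.ne_zero) ?_
  rw [h]; ring

end CycNorm

open scoped WithZero in
/-- The valuation of a factorial domain attached to a prime element. -/
def primeValuation {A : Type*} [CommRing A] [IsDomain A] [UniqueFactorizationMonoid A]
    {π : A} (hπ : Prime π) : Valuation A ℤᵐ⁰ := by
  classical
  exact
  { toFun := fun a => if a = 0 then 0 else WithZero.exp (-(multiplicity π a : ℤ))
    map_zero' := by simp
    map_one' := by simp [multiplicity_of_one_right hπ.not_isUnit]
    map_mul' := by
      intro a b
      by_cases ha : a = 0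
      · simp [ha]
      by_cases hb : b = 0
      · simp [hb]
      have hab : a * b ≠ 0 := mul_ne_zero ha hb
      simp only [ha, hb, hab, if_false]
      rw [multiplicity_mul hπ (FiniteMultiplicity.of_prime_left hπ hab), ← WithZero.exp_add]
      congr 1
      push_cast
      ring
    map_add_le_max' := by
      intro a b
      by_cases ha : a = 0
      · simp [ha]
      by_cases hb : b = 0
      · simp [hb]
      by_cases hab : a + b = 0
      · simp [hab]
      simp only [ha, hb, hab, if_false]
      rw [le_max_iff, WithZero.exp_le_exp, WithZero.exp_le_exp]
      have hfin : ∀ {b : A}, b ≠ 0 → FiniteMultiplicity π b := fun hb =>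
        FiniteMultiplicity.of_prime_left hπ hb
      have hmin : min (multiplicity π a) (multiplicity π b) ≤ multiplicity π (a + b) := by
        refine (hfin hab).le_multiplicity_of_pow_dvd (dvd_add ?_ ?_)
        · exact (pow_dvd_pow _ (min_le_left _ _)).trans (pow_multiplicity_dvd π a)
        · exact (pow_dvd_pow _ (min_le_right _ _)).trans (pow_multiplicity_dvd π b)
      rcases min_le_iff.1 hmin with h | h
      · left; omega
      · right; omega }

lemma primeValuation_apply {A : Type*} [CommRing A] [IsDomain A] [UniqueFactorizationMonoid A]
    {π : A} (hπ : Prime π) {a : A} (ha : a ≠ 0) :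
    primeValuation hπ a = WithZero.exp (-(multiplicity π a : ℤ)) := by
  classical
  exact if_neg ha

open scoped WithZero in
/-- An invariant element of the fraction field of a factorial ring on which every invariant
valuation trivial on units takes a `p`-th power as its value is a unit times a norm. -/
theorem exists_eq_unit_mul_cycNorm_of_valuation {A M : Type*} [CommRing A] [IsDomain A]
    [UniqueFactorizationMonoid A] [Field M] [Algebra A M] [IsFractionRing A M]
    {p : ℕ} (hp : p.Prime) (σ : M ≃+* M) (hσ : ∀ a, σ^[p] a = a) (τ : A ≃+* A)
    (hτ : ∀ a, algebraMap A M (τ a) = σ (algebraMap A M a))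
    (g : M) (hg0 : g ≠ 0) (hg : σ g = g)
    (h : ∀ v : Valuation M ℤᵐ⁰, (∀ a, v (σ a) = v a) →
      (∀ u : A, IsUnit u → v (algebraMap A M u) = 1) → ∃ γ, v g = γ ^ p) :
    ∃ (u : A) (ψ : M), IsUnit u ∧ g = algebraMap A M u * cycNorm p σ ψ := by
  have hinj : Function.Injective (algebraMap A M) := IsFractionRing.injective A M
  have hτp : ∀ a, τ^[p] a = a := by
    intro a
    apply hinj
    have := (Function.Semiconj.iterate_right (f := algebraMap A M) (ga := τ) (gb := σ) hτ p) a
    rw [this, hσ]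
  obtain ⟨a, b, hb, hab⟩ := IsFractionRing.div_surjective (A := A) g
  have hb0 : b ≠ 0 := nonZeroDivisors.ne_zero hb
  obtain ⟨b', hb'⟩ := dvd_cycNorm hp.pos τ b
  have hNb0 : cycNorm p τ b ≠ 0 := cycNorm_ne_zero p τ hb0
  have hbM : algebraMap A M b ≠ 0 := fun h0 => hb0 (hinj (h0.trans (map_zero _).symm))
  have hNbM : algebraMap A M (cycNorm p τ b) ≠ 0 := fun h0 =>
    hNb0 (hinj (h0.trans (map_zero _).symm))
  have hgN : algebraMap A M (a * b') = g * algebraMap A M (cycNorm p τ b) := by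
    rw [hb', ← hab, map_mul, map_mul]
    field_simp
  have hg'0 : a * b' ≠ 0 := by
    intro h0
    rw [h0, map_zero] at hgN
    exact mul_ne_zero hg0 hNbM hgN.symm
  have hinv : τ (a * b') = a * b' := by
    apply hinj
    rw [hτ, hgN, map_mul, hg, ← hτ, map_cycNorm p τ hτp]
  obtain ⟨u, ψ, hu, he⟩ := exists_eq_unit_mul_cycNorm hp τ hτp (a * b') hg'0 hinv (by
    intro π hπ hs
    have hS : nonZeroDivisors A ≤ (primeValuation hπ).supp.primeCompl := by
      intro s hs
      have hs0 : s ≠ 0 := nonZeroDivisors.ne_zero hs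
      change ¬ (s ∈ (primeValuation hπ).supp)
      rw [Valuation.mem_supp_iff, primeValuation_apply hπ hs0]
      exact WithZero.exp_ne_zero
    let v := (primeValuation hπ).extendToLocalization hS M
    have hv : ∀ c : A, v (algebraMap A M c) = primeValuation hπ c := fun c =>
      Valuation.extendToLocalization_apply_map_apply _ hS M c
    have hvτ : ∀ c : A, primeValuation hπ (τ c) = primeValuation hπ c := by
      intro c
      by_cases hc : c = 0
      · simp [hc]
      have hc' : τ c ≠ 0 := fun h0 => hc (τ.injective (h0.trans (map_zero τ).symm))
      rw [primeValuation_apply hπ hc, primeValuation_apply hπ hc']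
      have h1 : multiplicity (τ π) (τ c) = multiplicity π c := multiplicity_map_eq τ.toMulEquiv
      rw [← h1, multiplicity_eq_of_associated_left hs]
    obtain ⟨γ, hγ⟩ := h v (by
      intro m
      obtain ⟨c, d, hd, rfl⟩ := IsFractionRing.div_surjective (A := A) m
      rw [map_div₀, ← hτ, ← hτ, map_div₀, map_div₀, hv, hv, hv, hv, hvτ, hvτ]) (by
      intro c hc
      rw [hv, primeValuation_apply hπ hc.ne_zero]
      rw [multiplicity_eq_zero.2 fun hd => hπ.not_isUnit (isUnit_of_dvd_unit hd hc)]
      simp)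
    have h2 : v (algebraMap A M (a * b')) = γ ^ p * v (algebraMap A M (cycNorm p τ b)) := by
      rw [hgN, map_mul, hγ]
    rw [hv, hv, primeValuation_apply hπ hg'0, primeValuation_apply hπ hNb0,
      multiplicity_cycNorm p τ hπ hs hb0] at h2
    have hγ0 : γ ≠ 0 := by
      rintro rfl
      rw [zero_pow hp.ne_zero, zero_mul] at h2
      exact WithZero.exp_ne_zero h2
    rw [← WithZero.exp_log hγ0, ← WithZero.exp_nsmul, ← WithZero.exp_add] at h2
    have h3 := WithZero.exp_injective h2
    have h4 : ((multiplicity π (a * b') : ℕ) : ℤ)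
        = p * (multiplicity π b - WithZero.log γ) := by
      have : -(multiplicity π (a * b') : ℤ) = p * WithZero.log γ + -(p * multiplicity π b : ℕ) := by
        simpa using h3
      push_cast at this
      linarith
    exact Int.natCast_dvd_natCast.1 ⟨_, h4⟩)
  refine ⟨u, algebraMap A M ψ / algebraMap A M b, hu, ?_⟩
  rw [div_eq_mul_inv, cycNorm_mul, ← cycNorm_map p (algebraMap A M) τ σ hτ]
  have h5 : cycNorm p σ (algebraMap A M b)⁻¹ = (algebraMap A M (cycNorm p τ b))⁻¹ := by
    refine eq_inv_of_mul_eq_one_left ?_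
    rw [cycNorm_map p (algebraMap A M) τ σ hτ, ← cycNorm_mul, inv_mul_cancel₀ hbM, cycNorm_one]
  rw [h5, ← mul_assoc, ← map_mul, ← he, hgN, mul_assoc, mul_inv_cancel₀ hNbM, mul_one]

lemma Polynomial.exists_eq_C_mul_map_of_dvd_map {k E : Type*} [Field k] [IsAlgClosed k] [Field E]
    [Algebra k E] {P : Polynomial E} {D : Polynomial k} (hD : D ≠ 0)
    (h : P ∣ D.map (algebraMap k E)) :
    ∃ (e : E) (P₀ : Polynomial k), P = Polynomial.C e * P₀.map (algebraMap k E) := by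
  have hD' : D.map (algebraMap k E) ≠ 0 := (Polynomial.map_ne_zero_iff (algebraMap k E).injective).2 hD
  have hs : (D.map (algebraMap k E)).Splits := (IsAlgClosed.splits D).map _
  have hP : P.Splits := hs.of_dvd hD' h
  have hr : ∀ x ∈ P.roots, ∃ y, algebraMap k E y = x := by
    intro x hx
    have h1 := Multiset.mem_of_le (Polynomial.roots.le_of_dvd hD' h) hx
    rw [(IsAlgClosed.splits D).roots_map] at h1
    obtain ⟨y, -, hy⟩ := Multiset.mem_map.1 h1
    exact ⟨y, hy⟩
  obtain ⟨s, hs'⟩ : ∃ s : Multiset k, s.map (algebraMap k E) = P.roots := by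
    refine ⟨P.roots.map (Function.invFun (algebraMap k E)), ?_⟩
    rw [Multiset.map_map]
    exact (Multiset.map_congr rfl fun x hx => Function.invFun_eq (hr x hx)).trans
      (Multiset.map_id' _)
  refine ⟨P.leadingCoeff, (s.map fun r => Polynomial.X - Polynomial.C r).prod, ?_⟩
  conv_lhs => rw [hP.eq_prod_roots]
  rw [← hs', Polynomial.map_multiset_prod]
  simp [Multiset.map_map]

/-- The Kronecker substitution `X₀ ↦ X`, `X₁ ↦ X ^ N`. -/
def kroneckerSubst (E : Type*) [CommSemiring E] (N : ℕ) :
    MvPolynomial (Fin 2) E →ₐ[E] Polynomial E :=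
  aeval ![Polynomial.X, Polynomial.X ^ N]

lemma coeff_kroneckerSubst {E : Type*} [CommSemiring E] {N : ℕ} {a : MvPolynomial (Fin 2) E}
    (ha : ∀ m ∈ a.support, m 0 < N) {m : Fin 2 →₀ ℕ} (hm : m 0 < N) :
    (kroneckerSubst E N a).coeff (m 0 + N * m 1) = a.coeff m := by
  have h1 : kroneckerSubst E N a
      = ∑ n ∈ a.support, Polynomial.C (a.coeff n) * Polynomial.X ^ (n 0 + N * n 1) := by
    rw [kroneckerSubst, aeval_def, eval₂_eq']
    refine Finset.sum_congr rfl fun n _ => ?_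
    simp [Fin.prod_univ_two, pow_add, pow_mul]
  rw [h1, Polynomial.finsetSum_coeff]
  simp only [Polynomial.coeff_C_mul_X_pow]
  rw [Finset.sum_eq_single m]
  · simp
  · intro n hn hnm
    refine if_neg fun he => hnm ?_
    have h0 := ha n hn
    have e0 : n 0 = m 0 := by
      have := congrArg (· % N) he
      simpa [Nat.add_mul_mod_self_left, Nat.mod_eq_of_lt h0, Nat.mod_eq_of_lt hm] using this.symm
    have e1 : n 1 = m 1 := by
      rw [e0] at he
      exact (Nat.eq_of_mul_eq_mul_left (by omega) (Nat.add_left_cancel he)).symm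
    ext i
    fin_cases i
    · exact e0
    · exact e1
  · intro hm'
    simp [notMem_support_iff.1 hm']

lemma apply_zero_le_totalDegree {R : Type*} [CommSemiring R] {q : MvPolynomial (Fin 2) R}
    {m : Fin 2 →₀ ℕ} (hm : m ∈ q.support) : m 0 ≤ q.totalDegree := by
  refine le_trans ?_ (le_totalDegree hm)
  rw [Finsupp.sum_fintype _ _ (fun _ => rfl), Fin.sum_univ_two]
  omega

lemma kroneckerSubst_map {k E : Type*} [CommSemiring k] [CommSemiring E] (f : k →+* E) (N : ℕ)
    (d : MvPolynomial (Fin 2) k) :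
    kroneckerSubst E N (map f d) = (kroneckerSubst k N d).map f := by
  induction d using MvPolynomial.induction_on with
  | C a => simp [kroneckerSubst]
  | add p q hp hq => simp [hp, hq]
  | mul_X p i hp =>
    rw [map_mul, map_mul, map_mul, Polynomial.map_mul, hp]
    congr 1
    fin_cases i <;> simp [kroneckerSubst]

/-- Over an algebraically closed field, factors of a polynomial after extension of scalars are
already defined over the base field, up to a scalar. -/
theorem MvPolynomial.exists_eq_C_mul_map_of_dvd_map {k E : Type*} [Field k] [IsAlgClosed k]
    [Field E] [Algebra k E] {a : MvPolynomial (Fin 2) E} {d : MvPolynomial (Fin 2) k} (hd : d ≠ 0)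
    (h : a ∣ map (algebraMap k E) d) :
    ∃ (e : E) (a₀ : MvPolynomial (Fin 2) k), a = C e * map (algebraMap k E) a₀ := by
  classical
  set N := a.totalDegree + d.totalDegree + 1 with hN
  have had : ∀ m ∈ a.support, m 0 < N := fun m hm => by have := apply_zero_le_totalDegree hm; omega
  have hdd : ∀ m ∈ d.support, m 0 < N := fun m hm => by have := apply_zero_le_totalDegree hm; omega
  have hd0 : kroneckerSubst k N d ≠ 0 := by
    obtain ⟨m, hm⟩ := ne_zero_iff.1 hd
    intro h0
    have := coeff_kroneckerSubst hdd (hdd m (mem_support_iff.2 hm))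
    rw [h0, Polynomial.coeff_zero] at this
    exact hm this.symm
  have hdvd : kroneckerSubst E N a ∣ (kroneckerSubst k N d).map (algebraMap k E) := by
    rw [← kroneckerSubst_map]
    exact map_dvd _ h
  obtain ⟨e, P₀, he⟩ := Polynomial.exists_eq_C_mul_map_of_dvd_map hd0 hdvd
  refine ⟨e, ∑ m ∈ a.support, monomial m (P₀.coeff (m 0 + N * m 1)), ?_⟩
  ext m
  rw [coeff_C_mul, coeff_map, coeff_sum]
  simp only [coeff_monomial]
  by_cases hm : m ∈ a.support
  · rw [Finset.sum_ite_eq' , if_pos hm, ← coeff_kroneckerSubst had (had m hm), he,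
      Polynomial.coeff_C_mul, Polynomial.coeff_map]
  · rw [Finset.sum_ite_eq', if_neg hm, map_zero, mul_zero]
    exact notMem_support_iff.1 hm

/-- An automorphism of finite order restricts to every stable subring. -/
lemma exists_ringEquiv_restrict {A M : Type*} [CommRing A] [CommRing M] (ι : A →+* M)
    (hι : Function.Injective ι) {p : ℕ} (hp : 0 < p) (σ : M ≃+* M) (hσ : ∀ a, σ^[p] a = a)
    (h : ∀ a, ∃ a', ι a' = σ (ι a)) : ∃ τ : A ≃+* A, ∀ a, ι (τ a) = σ (ι a) := by
  choose t ht using h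
  let f : A →+* A :=
    { toFun := t
      map_one' := hι (by rw [ht, map_one, map_one])
      map_zero' := hι (by rw [ht, map_zero, map_zero])
      map_mul' := fun a b => hι (by rw [ht, map_mul, map_mul, map_mul, ht, ht])
      map_add' := fun a b => hι (by rw [ht, map_add, map_add, map_add, ht, ht]) }
  have hf : Function.Bijective f := by
    refine ⟨fun a b hab => ?_, fun a => ⟨t^[p - 1] a, ?_⟩⟩
    · apply hι
      apply σ.injective
      rw [← ht, ← ht]
      exact congrArg ι hab
    · change t (t^[p - 1] a) = a
      rw [← Function.iterate_succ_apply' t, Nat.succ_eq_add_one, Nat.sub_add_cancel hp]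
      apply hι
      have := (Function.Semiconj.iterate_right (f := ι) (ga := t) (gb := σ) ht p) a
      rw [this, hσ]
  exact ⟨RingEquiv.ofBijective f hf, ht⟩

section Descent

variable {k E M : Type*} [Field k] [IsAlgClosed k] [Field E] [Field M] [Algebra k E] [Algebra E M]
  [Algebra k M] [IsScalarTower k E M]

open scoped WithZero in
/-- The value condition on invariant valuations forces `g` to be a norm up to an element
of the ground field. -/
theorem exists_eq_algebraMap_mul_cycNorm {p : ℕ} (hp : p.Prime) (σ : M ≃+* M)
    (hσ : ∀ a, σ^[p] a = a) (hE : ∀ e : E, ∃ e' : E, algebraMap E M e' = σ (algebraMap E M e))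
    {i : Fin 2 → M} (hi : AlgebraicIndependent E i)
    (htop : IntermediateField.adjoin E (Set.range i) = ⊤) (hfix : ∀ j, σ (i j) = i j)
    {g : M} (hg0 : g ≠ 0) (hg : σ g = g)
    (hv : ∀ v : Valuation M ℤᵐ⁰, (∀ a, v (σ a) = v a) →
      (∀ e : E, e ≠ 0 → v (algebraMap E M e) = 1) → ∃ γ, v g = γ ^ p) :
    ∃ (e : E) (ψ : M), g = algebraMap E M e * cycNorm p σ ψ := by
  let : Algebra (MvPolynomial (Fin 2) E) M := (aeval i).toRingHom.toAlgebra
  have hmap : ∀ a : MvPolynomial (Fin 2) E, algebraMap (MvPolynomial (Fin 2) E) M a = aeval i a :=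
    fun _ => rfl
  have hinj : Function.Injective (algebraMap (MvPolynomial (Fin 2) E) M) := hi
  have : FaithfulSMul (MvPolynomial (Fin 2) E) M := (faithfulSMul_iff_algebraMap_injective _ _).2 hinj
  have : IsFractionRing (MvPolynomial (Fin 2) E) M := by
    refine IsFractionRing.of_field _ _ fun z => ?_
    have hz : z ∈ IntermediateField.adjoin E (Set.range i) := htop ▸ IntermediateField.mem_top
    exact (IntermediateField.mem_adjoin_range_iff E i z).1 hz
  obtain ⟨τ, hτ⟩ := exists_ringEquiv_restrict (algebraMap (MvPolynomial (Fin 2) E) M) hinj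
    hp.pos σ hσ (by
      intro a
      induction a using MvPolynomial.induction_on with
      | C e =>
        obtain ⟨e', he'⟩ := hE e
        exact ⟨C e', by simp [hmap, he']⟩
      | add a b ha hb =>
        obtain ⟨a', ha'⟩ := ha
        obtain ⟨b', hb'⟩ := hb
        exact ⟨a' + b', by rw [map_add, map_add, map_add, ha', hb']⟩
      | mul_X a j ha =>
        obtain ⟨a', ha'⟩ := ha
        exact ⟨a' * X j, by rw [map_mul, map_mul, map_mul, ha', hmap (X j), aeval_X, hfix]⟩)
  obtain ⟨u, ψ, hu, he⟩ := exists_eq_unit_mul_cycNorm_of_valuation hp σ hσ τ hτ g hg0 hg (by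
    intro v hv1 hv2
    refine hv v hv1 fun e he0 => ?_
    have := hv2 (C e) ((isUnit_iff_ne_zero.2 he0).map C)
    rwa [hmap, aeval_C] at this)
  obtain ⟨e, -, rfl⟩ := (MvPolynomial.isUnit_iff_eq_C_of_isReduced).1 hu
  exact ⟨e, ψ, by rw [he, hmap, aeval_C]⟩

/-- A norm relation over `E` descends to the field generated over `k` by elements which are
algebraically independent over `E`. -/
theorem descend_cycNorm {p : ℕ} (hp : p.Prime) (σ : M ≃+* M)
    (hσ : ∀ a, σ^[p] a = a) (hE : ∀ e : E, ∃ e' : E, algebraMap E M e' = σ (algebraMap E M e))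
    {i : Fin 2 → M} (hi : AlgebraicIndependent E i)
    (htop : IntermediateField.adjoin E (Set.range i) = ⊤)
    (hF : ∀ a ∈ IntermediateField.adjoin k (Set.range i),
      σ a ∈ IntermediateField.adjoin k (Set.range i))
    {g : M} (hgF : g ∈ IntermediateField.adjoin k (Set.range i)) (hg0 : g ≠ 0)
    {e : E} {ψ : M} (hgN : g = algebraMap E M e * cycNorm p σ ψ) :
    ∃ (c : k), ∃ φ ∈ IntermediateField.adjoin k (Set.range i),
      g = algebraMap k M c * cycNorm p σ φ := by
  set F := IntermediateField.adjoin k (Set.range i) with hFdef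
  let S : Submonoid (MvPolynomial (Fin 2) E) :=
    (nonZeroDivisors (MvPolynomial (Fin 2) k)).map (map (algebraMap k E))
  have hmapinj : Function.Injective (map (σ := Fin 2) (algebraMap k E)) :=
    map_injective _ (algebraMap k E).injective
  have hS0 : ∀ d ∈ S, d ≠ 0 := by
    rintro _ ⟨d, hd, rfl⟩ h0
    exact nonZeroDivisors.ne_zero hd (hmapinj (h0.trans (map_zero _).symm))
  have hSle : S ≤ nonZeroDivisors _ := le_nonZeroDivisors_of_noZeroDivisors fun h => hS0 0 h rfl
  have : IsDomain (Localization S) := IsLocalization.isDomain_localization hSle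
  have hai : ∀ d : MvPolynomial (Fin 2) k, aeval i (map (algebraMap k E) d) = aeval i d := fun d =>
    aeval_map_algebraMap E i d
  have hnz : ∀ {d : MvPolynomial (Fin 2) E}, d ≠ 0 → aeval i d ≠ 0 := fun hd h0 =>
    hd (hi (h0.trans (map_zero _).symm))
  have hunit : ∀ d : S, IsUnit ((aeval i : MvPolynomial (Fin 2) E →ₐ[E] M) (d : MvPolynomial (Fin 2) E)) :=
    fun d => isUnit_iff_ne_zero.2 (hnz (hS0 _ d.2))
  let ι : Localization S →+* M :=
    IsLocalization.lift (g := (aeval i : MvPolynomial (Fin 2) E →ₐ[E] M).toRingHom) hunit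
  have hι : ∀ a, ι (algebraMap _ _ a) = aeval i a := fun a => IsLocalization.lift_eq _ a
  have hιinj : Function.Injective ι := by
    rw [injective_iff_map_eq_zero]
    intro x hx
    obtain ⟨a, d, rfl⟩ := IsLocalization.exists_mk'_eq S x
    have h1 : ι (IsLocalization.mk' _ a d) * ι (algebraMap _ _ (d : MvPolynomial (Fin 2) E)) = aeval i a := by
      rw [← map_mul, IsLocalization.mk'_spec, hι]
    rw [hx, zero_mul] at h1
    have : a = 0 := by
      by_contra h0
      exact hnz h0 h1.symm
    rw [this, IsLocalization.mk'_zero]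
  have hFι : ∀ f ∈ F, f ∈ ι.range := by
    intro f hf
    obtain ⟨a, d, rfl⟩ := (IntermediateField.mem_adjoin_range_iff k i f).1 hf
    by_cases hd : d = 0
    · rw [hd, map_zero, div_zero]; exact zero_mem _
    refine ⟨IsLocalization.mk' _ (map (algebraMap k E) a)
      (⟨map (algebraMap k E) d, d, mem_nonZeroDivisors_of_ne_zero hd, rfl⟩ : S), ?_⟩
    have hd' : aeval i d ≠ 0 := by
      rw [← hai]
      exact hnz fun h0 => hd (hmapinj (h0.trans (map_zero _).symm))
    rw [eq_div_iff hd', ← hai d, ← hι, ← map_mul]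
    erw [IsLocalization.mk'_spec]
    rw [hι, hai]
  have hEι : ∀ e : E, algebraMap E M e ∈ ι.range := fun e => ⟨algebraMap _ _ (C e), by
    rw [hι, aeval_C]⟩
  have hiF : ∀ j, i j ∈ F := fun j => IntermediateField.subset_adjoin _ _ ⟨j, rfl⟩
  have hσpoly : ∀ a : MvPolynomial (Fin 2) E, σ (aeval i a) ∈ ι.range := by
    intro a
    induction a using MvPolynomial.induction_on with
    | C e =>
      obtain ⟨e', he'⟩ := hE e
      rw [aeval_C, ← he']
      exact hEι e'
    | add a b ha hb => rw [map_add, map_add]; exact add_mem ha hb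
    | mul_X a j ha =>
      rw [map_mul, map_mul, aeval_X]
      exact mul_mem ha (hFι _ (hF _ (hiF j)))
  have hpolyF : ∀ d : MvPolynomial (Fin 2) k, aeval i d ∈ F := fun d =>
    (IntermediateField.mem_adjoin_range_iff k i _).2 ⟨d, 1, by simp⟩
  have hmk : ∀ (a : MvPolynomial (Fin 2) E) (d : S),
      ι (IsLocalization.mk' _ a d) = aeval i a / aeval i (d : MvPolynomial (Fin 2) E) := by
    intro a d
    rw [eq_div_iff (hnz (hS0 _ d.2)), ← hι, ← map_mul, IsLocalization.mk'_spec, hι]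
  obtain ⟨τ, hτ⟩ := exists_ringEquiv_restrict ι hιinj hp.pos σ hσ (by
    intro x
    obtain ⟨a, d, rfl⟩ := IsLocalization.exists_mk'_eq S x
    rw [hmk, map_div₀, div_eq_mul_inv]
    refine mul_mem (s := ι.range) (hσpoly a) ?_
    obtain ⟨_, d, hd, rfl⟩ := d
    apply hFι
    refine inv_mem ?_
    change σ (aeval i (map (algebraMap k E) d)) ∈ F
    rw [hai]
    exact hF _ (hpolyF d))
  have hτp : ∀ a, τ^[p] a = a := by
    intro a
    apply hιinj
    have := (Function.Semiconj.iterate_right (f := ι) (ga := τ) (gb := σ) hτ p) a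
    rw [this, hσ]
  -- clear denominators in `ψ`
  have hψ0 : ψ ≠ 0 := by
    rintro rfl
    have : cycNorm p σ (0 : M) = 0 := by
      rw [cycNorm_eq_pow p σ (map_zero σ), zero_pow hp.ne_zero]
    rw [this, mul_zero] at hgN
    exact hg0 hgN
  have he0 : e ≠ 0 := by
    rintro rfl
    rw [map_zero, zero_mul] at hgN
    exact hg0 hgN
  obtain ⟨a, b, hab⟩ := (IntermediateField.mem_adjoin_range_iff E i ψ).1
    (htop ▸ IntermediateField.mem_top)
  have hb0 : aeval i b ≠ 0 := fun h0 => hψ0 (by rw [hab, h0, div_zero])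
  have ha0 : aeval i a ≠ 0 := fun h0 => hψ0 (by rw [hab, h0, zero_div])
  have heM : algebraMap E M e ≠ 0 := fun h0 => he0 ((algebraMap E M).injective (h0.trans (map_zero _).symm))
  obtain ⟨u, hu⟩ : g * (algebraMap E M e)⁻¹ ∈ ι.range :=
    mul_mem (hFι g hgF) (by rw [← map_inv₀]; exact hEι _)
  obtain ⟨u', hu'⟩ : g⁻¹ * (algebraMap E M e) ∈ ι.range :=
    mul_mem (hFι _ (inv_mem hgF)) (hEι _)
  have huu : u * u' = 1 := by
    apply hιinj
    rw [map_mul, hu, hu', map_one]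
    field_simp
  have hNψ : cycNorm p σ ψ * cycNorm p σ (aeval i b) = cycNorm p σ (aeval i a) := by
    rw [← cycNorm_mul, hab, div_mul_cancel₀ _ hb0]
  obtain ⟨w, hw, huw⟩ := isUnit_eq_cycNorm_unit hp τ hτp
    (algebraMap _ (Localization S) a) (algebraMap _ (Localization S) b) u
    (fun h0 => ha0 (by rw [← hι, h0, map_zero])) (fun h0 => hb0 (by rw [← hι, h0, map_zero]))
    (IsUnit.of_mul_eq_one _ huu) (by
      apply hιinj
      rw [map_mul, cycNorm_map p ι τ σ hτ, cycNorm_map p ι τ σ hτ, hι, hι, hu, ← hNψ, hgN]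
      field_simp)
  -- units are products of elements of `E` and `F`
  obtain ⟨w', hww'⟩ := hw.exists_right_inv
  obtain ⟨a₁, ⟨_, d₁, hd₁, rfl⟩, rfl⟩ := IsLocalization.exists_mk'_eq S w
  obtain ⟨a₂, ⟨_, d₂, hd₂, rfl⟩, rfl⟩ := IsLocalization.exists_mk'_eq S w'
  have hd₁' : aeval i d₁ ≠ 0 := by
    rw [← hai]
    exact hnz fun h0 => nonZeroDivisors.ne_zero hd₁ (hmapinj (h0.trans (map_zero _).symm))
  have hd₂' : aeval i d₂ ≠ 0 := by
    rw [← hai]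
    exact hnz fun h0 => nonZeroDivisors.ne_zero hd₂ (hmapinj (h0.trans (map_zero _).symm))
  have hprod : a₁ * a₂ = map (algebraMap k E) (d₁ * d₂) := by
    apply hi
    have := congrArg ι hww'
    rw [map_mul, hmk, hmk, map_one] at this
    change aeval i a₁ / aeval i (map (algebraMap k E) d₁) *
      (aeval i a₂ / aeval i (map (algebraMap k E) d₂)) = 1 at this
    rw [hai, hai] at this
    rw [hai, map_mul, map_mul]
    field_simp at this
    exact this
  obtain ⟨ε, a₀, rfl⟩ := MvPolynomial.exists_eq_C_mul_map_of_dvd_map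
    (mul_ne_zero (nonZeroDivisors.ne_zero hd₁) (nonZeroDivisors.ne_zero hd₂)) ⟨a₂, hprod.symm⟩
  set φ : M := aeval i a₀ / aeval i d₁ with hφ
  have hφF : φ ∈ F := div_mem (hpolyF _) (hpolyF _)
  have hwφ : ι (IsLocalization.mk' _ (C ε * map (algebraMap k E) a₀)
      (⟨map (algebraMap k E) d₁, d₁, hd₁, rfl⟩ : S)) = algebraMap E M ε * φ := by
    rw [hmk, map_mul, aeval_C, hai]
    change _ / aeval i (map (algebraMap k E) d₁) = _
    rw [hai, mul_div_assoc]
  have hgφ : g = algebraMap E M e * cycNorm p σ (algebraMap E M ε) * cycNorm p σ φ := by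
    have h1 := congrArg ι huw
    rw [cycNorm_map p ι τ σ hτ, hwφ, hu, cycNorm_mul] at h1
    rw [mul_assoc, ← h1]
    field_simp
  obtain ⟨ε', hε'⟩ : ∃ ε' : E, algebraMap E M ε' = cycNorm p σ (algebraMap E M ε) := by
    obtain ⟨τE, hτE⟩ := exists_ringEquiv_restrict (algebraMap E M) (algebraMap E M).injective
      hp.pos σ hσ hE
    exact ⟨_, cycNorm_map p (algebraMap E M) τE σ hτE ε⟩
  rw [← hε', ← map_mul] at hgφ
  -- an element of `E ∩ F` lies in `k`
  have hNF : cycNorm p σ φ ∈ F := by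
    refine prod_mem fun j hj => ?_
    clear hj
    induction j with
    | zero => exact hφF
    | succ j ih => rw [Function.iterate_succ_apply']; exact hF _ ih
  have hN0 : cycNorm p σ φ ≠ 0 := fun h0 => hg0 (by rw [hgφ, h0, mul_zero])
  have hcF : algebraMap E M (e * ε') ∈ F := by
    have : algebraMap E M (e * ε') = g / cycNorm p σ φ := by rw [eq_div_iff hN0, ← hgφ]
    rw [this]
    exact div_mem hgF hNF
  obtain ⟨r, q, hrq⟩ := (IntermediateField.mem_adjoin_range_iff k i _).1 hcF
  have hc0 : algebraMap E M (e * ε') ≠ 0 := fun h0 => hg0 (by rw [hgφ, h0, zero_mul])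
  have hq0 : aeval i q ≠ 0 := fun h0 => hc0 (by rw [hrq, h0, div_zero])
  have hqne : q ≠ 0 := by rintro rfl; exact hq0 (map_zero _)
  have hrq' : C (e * ε') * map (algebraMap k E) q = map (algebraMap k E) r := by
    apply hi
    rw [map_mul, aeval_C, hai, hai, hrq, div_mul_cancel₀ _ hq0]
  obtain ⟨m, hm⟩ := ne_zero_iff.1 hqne
  have hcoef := congrArg (coeff m) hrq'
  rw [coeff_C_mul, coeff_map, coeff_map] at hcoef
  have hmE : algebraMap k E (coeff m q) ≠ 0 := fun h0 =>
    hm ((algebraMap k E).injective (h0.trans (map_zero _).symm))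
  refine ⟨coeff m r / coeff m q, φ, hφF, ?_⟩
  rw [hgφ, IsScalarTower.algebraMap_apply k E M, map_div₀, ← hcoef, mul_div_cancel_right₀ _ hmE]

end Descent

section Residue

variable {R M : Type*} [CommRing R] [Field M] (ev : R →+* M)
  {p : ℕ} {ζ h : R} {w : M} (σ : M ≃+* M)

/-- The substitution `W ↦ ζ W` in polynomials. -/
def twistHom (ζ : R) : Polynomial R →+* Polynomial R :=
  Polynomial.compRingHom (Polynomial.C ζ * Polynomial.X)

lemma coeff_twistHom (ζ : R) (P : Polynomial R) (n : ℕ) :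
    (twistHom ζ P).coeff n = P.coeff n * ζ ^ n := by
  exact Polynomial.comp_C_mul_X_coeff

lemma coeff_twistHom_iterate (ζ : R) (P : Polynomial R) (n j : ℕ) :
    ((twistHom ζ)^[j] P).coeff n = P.coeff n * ζ ^ (n * j) := by
  induction j with
  | zero => simp
  | succ j ih => rw [Function.iterate_succ_apply', coeff_twistHom, ih]; ring

lemma eval₂_twistHom (hfix : ∀ r, σ (ev r) = ev r) (hσw : σ w = ev ζ * w) (P : Polynomial R) :
    (twistHom ζ P).eval₂ ev w = σ (P.eval₂ ev w) := by
  induction P using Polynomial.induction_on' with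
  | add a b ha hb => rw [map_add, Polynomial.eval₂_add, Polynomial.eval₂_add, map_add, ha, hb]
  | monomial n a =>
    rw [← Polynomial.C_mul_X_pow_eq_monomial]
    simp [twistHom, hfix, hσw, mul_pow, Polynomial.eval₂_mul, Polynomial.eval₂_pow]

variable [IsDomain R]

lemma exists_cycNorm_eval₂ (hp : p.Prime) (hζ : IsPrimitiveRoot ζ p) (hw : w ^ p = ev h)
    (hfix : ∀ r, σ (ev r) = ev r) (hσw : σ w = ev ζ * w) (P : Polynomial R) :
    ∃ n, cycNorm p σ (P.eval₂ ev w) = ev n ∧ h ∣ n - P.coeff 0 ^ p := by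
  have hiter : ∀ P, (twistHom ζ)^[p] P = P := by
    intro P
    ext n
    rw [coeff_twistHom_iterate, mul_comm n p, pow_mul, hζ.pow_eq_one, one_pow, mul_one]
  have hinv := map_cycNorm p (twistHom ζ) hiter P
  set Q := cycNorm p (twistHom ζ) P with hQ
  have hcoef : ∀ n, ¬ p ∣ n → Q.coeff n = 0 := by
    intro n hn
    have h1 := congrArg (fun q => Polynomial.coeff q n) hinv
    simp only [coeff_twistHom] at h1
    have h2 : Q.coeff n * (ζ ^ n - 1) = 0 := by rw [mul_sub, h1, mul_one, sub_self]
    rcases mul_eq_zero.1 h2 with h3 | h3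
    · exact h3
    · exact absurd (hζ.dvd_of_pow_eq_one n (sub_eq_zero.1 h3)) hn
  have hexp : Polynomial.expand R p (Polynomial.contract p Q) = Q := by
    ext n
    rw [Polynomial.coeff_expand hp.pos]
    split_ifs with hd
    · rw [Polynomial.coeff_contract hp.ne_zero, Nat.div_mul_cancel hd]
    · exact (hcoef n hd).symm
  refine ⟨(Polynomial.contract p Q).eval h, ?_, ?_⟩
  · have h1 := cycNorm_map p (Polynomial.eval₂RingHom ev w) (twistHom ζ) σ
      (eval₂_twistHom ev σ hfix hσw) P
    rw [← hQ] at h1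
    rw [Polynomial.coe_eval₂RingHom] at h1
    rw [← h1, ← hexp, Polynomial.expand_eq_comp_X_pow, Polynomial.eval₂_comp, Polynomial.eval₂_pow,
      Polynomial.eval₂_X, hw, Polynomial.eval₂_at_apply, ← Polynomial.expand_eq_comp_X_pow, hexp]
  · have h0 : Q.coeff 0 = P.coeff 0 ^ p := by
      have h1 := cycNorm_map p (Polynomial.constantCoeff (R := R)) (twistHom ζ) id (by
        intro P
        simp [Polynomial.constantCoeff_apply, coeff_twistHom]) P
      rw [cycNorm_eq_pow p id rfl] at h1
      exact h1
    have h2 : (Polynomial.contract p Q).eval 0 = P.coeff 0 ^ p := by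
      rw [← Polynomial.coeff_zero_eq_eval_zero, Polynomial.coeff_contract hp.ne_zero, zero_mul, h0]
    rw [← h2]
    simpa using Polynomial.sub_dvd_eval_sub h 0 (Polynomial.contract p Q)

lemma exists_eval₂_eq_pow_mul (hev : Function.Injective ev) (hp : p.Prime)
    (hζ : IsPrimitiveRoot ζ p) (hw : w ^ p = ev h) (hh : Prime h)
    (hfix : ∀ r, σ (ev r) = ev r) (hσw : σ w = ev ζ * w) (j : ℕ) :
    ∀ (P : Polynomial R) (n : R), cycNorm p σ (P.eval₂ ev w) = ev n → h ^ j ∣ n →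
      ∃ P₁ : Polynomial R, P.eval₂ ev w = w ^ j * P₁.eval₂ ev w := by
  induction j with
  | zero => intro P n _ _; exact ⟨P, by simp⟩
  | succ j ih =>
    intro P n hn hd
    obtain ⟨n', hn', hd'⟩ := exists_cycNorm_eval₂ ev σ hp hζ hw hfix hσw P
    obtain rfl : n = n' := hev (hn.symm.trans hn')
    have hhn : h ∣ n := (dvd_pow_self h j.succ_ne_zero).trans hd
    have h0 : h ∣ P.coeff 0 :=
      hh.dvd_of_dvd_pow ((dvd_sub_right hhn).1 hd')
    obtain ⟨e, he⟩ := h0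
    set P₁ := Polynomial.C e * Polynomial.X ^ (p - 1) + P.divX with hP₁
    have hP : P.eval₂ ev w = w * P₁.eval₂ ev w := by
      conv_lhs => rw [← Polynomial.divX_mul_X_add P, he]
      have hwp : w * w ^ (p - 1) = ev h := by
        rw [← pow_succ', Nat.sub_add_cancel hp.one_le, hw]
      simp only [Polynomial.eval₂_add, Polynomial.eval₂_mul, Polynomial.eval₂_X,
        Polynomial.eval₂_C, hP₁, Polynomial.eval₂_pow, map_mul]
      rw [← hwp]
      ring
    obtain ⟨n₁, hn₁, -⟩ := exists_cycNorm_eval₂ ev σ hp hζ hw hfix hσw P₁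
    have hNw : ∃ m, cycNorm p σ w = ev (ζ ^ m * h) := by
      have hi : ∀ i, ∃ m, σ^[i] w = ev (ζ ^ m) * w := by
        intro i
        induction i with
        | zero => exact ⟨0, by simp⟩
        | succ i ih =>
          obtain ⟨m, hm⟩ := ih
          exact ⟨m + 1, by rw [Function.iterate_succ_apply', hm, map_mul, hfix, hσw, pow_succ,
            map_mul, mul_assoc]⟩
      choose m hm using hi
      refine ⟨∑ i ∈ Finset.range p, m i, ?_⟩
      rw [cycNorm, Finset.prod_congr rfl fun i _ => hm i, Finset.prod_mul_distrib,
        Finset.prod_const, Finset.card_range, hw, map_mul, ← Finset.prod_pow_eq_pow_sum, map_prod]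
    obtain ⟨m, hm⟩ := hNw
    have hnn : n = ζ ^ m * h * n₁ := by
      apply hev
      rw [← hn, hP, cycNorm_mul, hm, hn₁, ← map_mul]
    have hζu : IsUnit (ζ ^ m) := (hζ.isUnit hp.ne_zero).pow m
    have hdn : h ^ j ∣ n₁ := by
      rw [hnn, pow_succ', mul_assoc, hζu.dvd_mul_left] at hd
      exact (mul_dvd_mul_iff_left hh.ne_zero).1 hd
    obtain ⟨P₂, hP₂⟩ := ih P₁ n₁ hn₁ hdn
    exact ⟨P₂, by rw [hP, hP₂, pow_succ']; ring⟩

/-- A norm from a cyclic extension totally ramified along `h` is a `p`-th power modulo `h`. -/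
theorem exists_pow_modEq_of_cycNorm [UniqueFactorizationMonoid R] (hev : Function.Injective ev)
    (hp : p.Prime) (hζ : IsPrimitiveRoot ζ p) (hw : w ^ p = ev h) (hh : Prime h)
    (hfix : ∀ r, σ (ev r) = ev r) (hσw : σ w = ev ζ * w) {φ : M}
    (hφ : ∃ P Q : Polynomial R, φ = P.eval₂ ev w / Q.eval₂ ev w) {G : R}
    (hG : cycNorm p σ φ = ev G) : ∃ a d : R, ¬ h ∣ d ∧ h ∣ G * d ^ p - a ^ p := by
  obtain ⟨P, d, hd0, hPd⟩ : ∃ (P : Polynomial R) (d : R), d ≠ 0 ∧ φ * ev d = P.eval₂ ev w := by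
    obtain ⟨P, Q, rfl⟩ := hφ
    by_cases hQ : Q.eval₂ ev w = 0
    · exact ⟨0, 1, one_ne_zero, by simp [hQ]⟩
    obtain ⟨n, hn, -⟩ := exists_cycNorm_eval₂ ev σ hp hζ hw hfix hσw Q
    have hi : ∀ j, ∃ Q' : Polynomial R, σ^[j] (Q.eval₂ ev w) = Q'.eval₂ ev w := by
      intro j
      refine ⟨(twistHom ζ)^[j] Q, ?_⟩
      induction j with
      | zero => rfl
      | succ j ih =>
        rw [Function.iterate_succ_apply', Function.iterate_succ_apply', ih]
        exact (eval₂_twistHom ev σ hfix hσw _).symm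
    choose Q' hQ' using hi
    refine ⟨P * ∏ j ∈ Finset.range (p - 1), Q' (j + 1), n, ?_, ?_⟩
    · rintro rfl
      rw [map_zero] at hn
      exact cycNorm_ne_zero p σ hQ hn
    · rw [← hn, cycNorm, ← Nat.sub_add_cancel hp.one_le, Finset.prod_range_succ',
        Polynomial.eval₂_mul, Polynomial.eval₂_finsetProd,
        Finset.prod_congr rfl fun j _ => hQ' (j + 1), Nat.add_sub_cancel, Function.iterate_zero_apply]
      field_simp
  have hfin : FiniteMultiplicity h d := FiniteMultiplicity.of_prime_left hh hd0
  obtain ⟨d₀, hd₀, hnd⟩ := hfin.exists_eq_pow_mul_and_not_dvd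
  set m := multiplicity h d
  have hN : cycNorm p σ (P.eval₂ ev w) = ev (G * d ^ p) := by
    rw [← hPd, cycNorm_mul, hG, cycNorm_eq_pow p σ (hfix d), map_mul, map_pow]
  obtain ⟨P₁, hP₁⟩ := exists_eval₂_eq_pow_mul ev σ hev hp hζ hw hh hfix hσw (p * m) P _ hN (by
    rw [hd₀, mul_pow, mul_comm p m, pow_mul]
    exact Dvd.intro (G * d₀ ^ p) (by ring))
  have hevh : ev h ≠ 0 := fun h0 => hh.ne_zero (hev (h0.trans (map_zero _).symm))
  have hφ' : φ * ev d₀ = P₁.eval₂ ev w := by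
    rw [pow_mul, hw] at hP₁
    rw [hP₁, hd₀, map_mul, map_pow] at hPd
    refine mul_left_cancel₀ (pow_ne_zero m hevh) ?_
    rw [← hPd]; ring
  obtain ⟨n, hn, hdn⟩ := exists_cycNorm_eval₂ ev σ hp hζ hw hfix hσw P₁
  refine ⟨P₁.coeff 0, d₀, hnd, ?_⟩
  have : n = G * d₀ ^ p := by
    apply hev
    rw [← hn, ← hφ', cycNorm_mul, hG, cycNorm_eq_pow p σ (hfix d₀), map_mul, map_pow]
  rwa [← this]

end Residue

section PolynomialEquations

open Polynomial (natDegree)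

variable {𝕜 : Type} [Field 𝕜] [Algebra (Polynomial ℂ) 𝕜] [IsFractionRing (Polynomial ℂ) 𝕜]

local notation "ι" => algebraMap (Polynomial ℂ) 𝕜

lemma not_pow_eq_of_not_dvd_natDegree {m : ℕ} (hm : 0 < m) {κ : Polynomial ℂ} (hκ : ¬ m ∣ κ.natDegree) (b : 𝕜) : b ^ m ≠ ι κ := by
  intro hb
  obtain ⟨b, rfl⟩ := IsIntegrallyClosed.exists_algebraMap_eq_of_isIntegral_pow (R := Polynomial ℂ)
    hm (hb ▸ isIntegral_algebraMap)
  rw [← map_pow] at hb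
  have := IsFractionRing.injective (Polynomial ℂ) 𝕜 hb
  exact hκ ⟨b.natDegree, by rw [← this, Polynomial.natDegree_pow]⟩

lemma irreducible_map_X_pow_sub_C {m : ℕ} (hm : m.Prime) {κ : Polynomial ℂ} (hκ : ¬ m ∣ κ.natDegree) :
    Irreducible ((Polynomial.X ^ m - Polynomial.C κ : Polynomial (Polynomial ℂ)).map ι) := by
  have := X_pow_sub_C_irreducible_of_prime hm (not_pow_eq_of_not_dvd_natDegree (𝕜 := 𝕜) hm.pos hκ)
  simpa using this

lemma prime_X_pow_sub_C {m : ℕ} (hm : m.Prime) {κ : Polynomial ℂ} (hκ : ¬ m ∣ κ.natDegree) :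
    Prime (Polynomial.X ^ m - Polynomial.C κ : Polynomial (Polynomial ℂ)) := by
  refine Irreducible.prime ?_
  rw [Polynomial.Monic.irreducible_iff_irreducible_map_fraction_map (K := FractionRing (Polynomial ℂ))
    (Polynomial.monic_X_pow_sub_C κ hm.ne_zero)]
  exact irreducible_map_X_pow_sub_C hm hκ

lemma exists_pow_modEq_fraction {p : ℕ} {h G a d : Polynomial (Polynomial ℂ)} (hmonic : h.Monic)
    (hirr : Irreducible (h.map ι)) (hd : ¬ h ∣ d) (hdvd : h ∣ G * d ^ p - a ^ p) :
    ∃ r : Polynomial 𝕜, r.degree < (h.map ι).degree ∧ h.map ι ∣ G.map ι - r ^ p := by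
  have hm' : (h.map ι).Monic := hmonic.map _
  have hd' : ¬ h.map ι ∣ d.map ι := fun hh =>
    hd (Polynomial.map_dvd_map ι (IsFractionRing.injective _ _) hmonic |>.1 hh)
  obtain ⟨s, u, hsu⟩ := (hirr.coprime_iff_not_dvd).2 hd'
  have h1 : h.map ι ∣ G.map ι * (d.map ι) ^ p - (a.map ι) ^ p := by
    have := Polynomial.map_dvd ι hdvd
    simpa using this
  refine ⟨(a.map ι * u) %ₘ h.map ι, Polynomial.degree_modByMonic_lt _ hm', ?_⟩
  set q := AdjoinRoot.mk (h.map ι) with hq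
  rw [← AdjoinRoot.mk_eq_zero] at h1 ⊢
  have h2 : q u * q (d.map ι) = 1 := by
    rw [← map_mul, ← map_one q, ← hsu, map_add, map_mul q s, AdjoinRoot.mk_self, mul_zero, zero_add]
  have h3 : q ((a.map ι * u) %ₘ h.map ι) = q (a.map ι) * q u := by
    rw [← map_mul]
    exact (AdjoinRoot.mk_eq_mk.2 ⟨_, by rw [sub_eq_iff_eq_add']; exact (Polynomial.modByMonic_add_div _ _).symm⟩).symm
  rw [map_sub, map_mul, map_pow, map_pow] at h1
  rw [map_sub, map_pow, h3, mul_pow, ← sub_eq_zero.1 h1, mul_assoc, ← mul_pow, mul_comm (q _) (q u),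
    h2, one_pow, mul_one, sub_self]

/-- A square root extension by a squarefree polynomial of odd degree has no elements of small
norm. -/
lemma eq_zero_of_mul_sq_eq {κ a n : Polynomial ℂ} (hsq : Squarefree κ) (hodd : Odd κ.natDegree)
    (hn : n.natDegree < κ.natDegree) {b : 𝕜} (h : ι κ * b ^ 2 = ι (a ^ 2 - n)) : b = 0 := by
  have hinj := IsFractionRing.injective (Polynomial ℂ) 𝕜
  obtain ⟨x, y, hxy, hb⟩ := IsFractionRing.exists_reduced_fraction (A := Polynomial ℂ) b
  have hy0 : (y : Polynomial ℂ) ≠ 0 := nonZeroDivisors.ne_zero y.2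
  have hy0' : ι (y : Polynomial ℂ) ≠ 0 := fun h0 => hy0 (hinj (h0.trans (map_zero _).symm))
  have hbx : b * ι (y : Polynomial ℂ) = ι x := by rw [← hb]; exact IsLocalization.mk'_spec _ _ _
  have h1 : κ * x ^ 2 = (a ^ 2 - n) * (y : Polynomial ℂ) ^ 2 := by
    apply hinj
    rw [map_mul, map_mul, map_pow, map_pow, ← h, ← hbx]
    ring
  have h2 : (y : Polynomial ℂ) * y ∣ κ := by
    have h3 : IsRelPrime ((y : Polynomial ℂ) ^ 2) (x ^ 2) := (hxy.symm.pow)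
    rw [← sq]
    exact h3.dvd_of_dvd_mul_right (Dvd.intro_left _ h1.symm)
  obtain ⟨y', hy'⟩ := (hsq _ h2).exists_left_inv
  obtain ⟨b', rfl⟩ : ∃ b', ι b' = b := ⟨x * y', by
    rw [map_mul, ← hbx, mul_assoc, ← map_mul, mul_comm _ y', hy', map_one, mul_one]⟩
  rw [← map_pow, ← map_mul] at h
  have h4 : a ^ 2 = κ * b' ^ 2 + n := by rw [hinj h]; ring
  by_contra hb0
  have hb' : b' ≠ 0 := by rintro rfl; exact hb0 (map_zero _)
  have hκ0 : κ ≠ 0 := by rintro rfl; simp at hn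
  have h5 : (κ * b' ^ 2).natDegree = κ.natDegree + 2 * b'.natDegree := by
    rw [Polynomial.natDegree_mul hκ0 (pow_ne_zero 2 hb'), Polynomial.natDegree_pow]
  have h6 := congrArg natDegree h4
  rw [Polynomial.natDegree_add_eq_left_of_natDegree_lt (by omega), h5, Polynomial.natDegree_pow] at h6
  obtain ⟨l, hl⟩ := hodd
  omega

lemma eq_zero_of_X_sq_sub_C_dvd {F : Type*} [Field F] {κ u v : F}
    (h : (Polynomial.X ^ 2 - Polynomial.C κ : Polynomial F) ∣
      Polynomial.C u + Polynomial.C v * Polynomial.X) : u = 0 ∧ v = 0 := by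
  have h0 : Polynomial.C u + Polynomial.C v * Polynomial.X = 0 := by
    refine Polynomial.eq_zero_of_dvd_of_degree_lt h ?_
    rw [Polynomial.degree_X_pow_sub_C two_pos, add_comm]
    exact (Polynomial.degree_linear_le).trans_lt (by norm_num)
  constructor
  · simpa using congrArg (fun q => Polynomial.coeff q 0) h0
  · simpa using congrArg (fun q => Polynomial.coeff q 1) h0

lemma eq_zero_of_X_pow_three_sub_C_dvd {F : Type*} [Field F] {κ u v w : F}
    (h : (Polynomial.X ^ 3 - Polynomial.C κ : Polynomial F) ∣
      Polynomial.C u + Polynomial.C v * Polynomial.X + Polynomial.C w * Polynomial.X ^ 2) :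
    u = 0 ∧ v = 0 ∧ w = 0 := by
  have h0 : Polynomial.C u + Polynomial.C v * Polynomial.X + Polynomial.C w * Polynomial.X ^ 2
      = 0 := by
    refine Polynomial.eq_zero_of_dvd_of_degree_lt h ?_
    rw [Polynomial.degree_X_pow_sub_C three_pos]
    have : Polynomial.C u + Polynomial.C v * Polynomial.X + Polynomial.C w * Polynomial.X ^ 2
      = Polynomial.C w * Polynomial.X ^ 2 + Polynomial.C v * Polynomial.X + Polynomial.C u := by ring
    rw [this]
    exact (Polynomial.degree_quadratic_le).trans_lt (by norm_num)
  refine ⟨?_, ?_, ?_⟩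
  · simpa using congrArg (fun q => Polynomial.coeff q 0) h0
  · simpa [Polynomial.coeff_X] using congrArg (fun q => Polynomial.coeff q 1) h0
  · simpa [Polynomial.coeff_X] using congrArg (fun q => Polynomial.coeff q 2) h0

lemma eq_C_add_C_mul_X {F : Type*} [Field F] {κ : F} {r : Polynomial F}
    (h : r.degree < (Polynomial.X ^ 2 - Polynomial.C κ : Polynomial F).degree) :
    ∃ a b, r = Polynomial.C a + Polynomial.C b * Polynomial.X := by
  rw [Polynomial.degree_X_pow_sub_C two_pos] at h
  have h' : r.natDegree < 2 := by
    rcases eq_or_ne r 0 with rfl | hr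
    · simp
    · exact (Polynomial.natDegree_lt_iff_degree_lt hr).2 h
  refine ⟨r.coeff 0, r.coeff 1, ?_⟩
  conv_lhs => rw [r.as_sum_range' 2 h']
  simp [Finset.sum_range_succ, ← Polynomial.C_mul_X_pow_eq_monomial]

lemma eq_C_add_C_mul_X_add_C_mul_X_sq {F : Type*} [Field F] {κ : F} {r : Polynomial F}
    (h : r.degree < (Polynomial.X ^ 3 - Polynomial.C κ : Polynomial F).degree) :
    ∃ a b e, r = Polynomial.C a + Polynomial.C b * Polynomial.X
      + Polynomial.C e * Polynomial.X ^ 2 := by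
  rw [Polynomial.degree_X_pow_sub_C three_pos] at h
  have h' : r.natDegree < 3 := by
    rcases eq_or_ne r 0 with rfl | hr
    · simp
    · exact (Polynomial.natDegree_lt_iff_degree_lt hr).2 h
  refine ⟨r.coeff 0, r.coeff 1, r.coeff 2, ?_⟩
  conv_lhs => rw [r.as_sum_range' 3 h']
  simp [Finset.sum_range_succ, ← Polynomial.C_mul_X_pow_eq_monomial]

end PolynomialEquations

section PowerResidues

open Polynomial (natDegree)

lemma exists_algebraMap_eq_of_aeval_eq_zero {𝕜 : Type} [Field 𝕜] [Algebra (Polynomial ℂ) 𝕜]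
    [IsFractionRing (Polynomial ℂ) 𝕜] (P : Polynomial (Polynomial ℂ)) (hP : P.Monic) {a : 𝕜}
    (ha : Polynomial.aeval a P = 0) : ∃ a', algebraMap (Polynomial ℂ) 𝕜 a' = a :=
  IsIntegrallyClosed.isIntegral_iff.1 ⟨P, hP, by rwa [Polynomial.aeval_def] at ha⟩

lemma exists_natDegree_eq_of_pow_eq {𝕜 : Type} [Field 𝕜] [Algebra (Polynomial ℂ) 𝕜]
    [IsFractionRing (Polynomial ℂ) 𝕜] {p : ℕ} (hp : 0 < p) {q : Polynomial ℂ} {c' : ℂ} (hc' : c' ≠ 0)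
    {n : 𝕜} (hn : n ^ p = algebraMap (Polynomial ℂ) 𝕜 (Polynomial.C c' ^ 2 * q ^ p)) :
    ∃ n' : Polynomial ℂ, algebraMap (Polynomial ℂ) 𝕜 n' = n ∧ n'.natDegree = q.natDegree := by
  obtain ⟨n, rfl⟩ := IsIntegrallyClosed.exists_algebraMap_eq_of_isIntegral_pow
    (R := Polynomial ℂ) hp (hn ▸ isIntegral_algebraMap)
  rw [← map_pow] at hn
  have h := congrArg natDegree (IsFractionRing.injective (Polynomial ℂ) 𝕜 hn)
  rw [← map_pow, Polynomial.natDegree_C_mul (pow_ne_zero 2 hc'), Polynomial.natDegree_pow,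
    Polynomial.natDegree_pow] at h
  exact ⟨n, rfl, Nat.eq_of_mul_eq_mul_left hp h⟩

lemma not_dvd_mul_pow_three_sub {κ g₀ g₁ q : Polynomial ℂ} (hsq : Squarefree κ)
    (hodd : Odd κ.natDegree) (hq : q.natDegree < κ.natDegree) (hg₁ : g₁ ≠ 0)
    (hrel : g₀ ^ 2 - κ * g₁ ^ 2 = q ^ 3) {c' : ℂ} (hc' : c' ≠ 0) {a d : Polynomial (Polynomial ℂ)}
    (hd : ¬ (Polynomial.X ^ 2 - Polynomial.C κ) ∣ d) :
    ¬ (Polynomial.X ^ 2 - Polynomial.C κ) ∣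
      Polynomial.C (Polynomial.C c') * (Polynomial.C g₀ + Polynomial.C g₁ * Polynomial.X) * d ^ 3
        - a ^ 3 := by
  intro hdvd
  let 𝕜 := FractionRing (Polynomial ℂ)
  set ι := algebraMap (Polynomial ℂ) 𝕜 with hι
  have hinj : Function.Injective ι := IsFractionRing.injective (Polynomial ℂ) 𝕜
  have hirr := irreducible_map_X_pow_sub_C (𝕜 := 𝕜) Nat.prime_two
    (fun h => (Nat.not_even_iff_odd.2 hodd) (even_iff_two_dvd.2 h))
  obtain ⟨r, hr, hrd⟩ := exists_pow_modEq_fraction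
    (Polynomial.monic_X_pow_sub_C κ two_ne_zero) hirr hd hdvd
  have hmap : (Polynomial.X ^ 2 - Polynomial.C κ).map ι = Polynomial.X ^ 2 - Polynomial.C (ι κ) := by
    simp
  rw [hmap] at hr hrd
  obtain ⟨a, b, rfl⟩ := eq_C_add_C_mul_X hr
  obtain ⟨h0, h1⟩ := eq_zero_of_X_sq_sub_C_dvd (κ := ι κ)
    (u := ι (Polynomial.C c') * ι g₀ - (a ^ 3 + 3 * a * b ^ 2 * ι κ))
    (v := ι (Polynomial.C c') * ι g₁ - (3 * a ^ 2 * b + b ^ 3 * ι κ)) (by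
      refine (dvd_iff_dvd_of_dvd_sub ?_).1 hrd
      refine ⟨-(3 * Polynomial.C a * Polynomial.C b ^ 2 + Polynomial.C b ^ 3 * Polynomial.X), ?_⟩
      simp only [Polynomial.map_mul, Polynomial.map_add, Polynomial.map_C, Polynomial.map_X, map_sub,
        map_add, map_mul, map_pow, map_ofNat, ← hι]
      ring)
  obtain ⟨n, hn, hnd⟩ := exists_natDegree_eq_of_pow_eq (𝕜 := 𝕜) (n := a ^ 2 - ι κ * b ^ 2)
    three_pos hc' (q := q) (by
      rw [← hrel]
      simp only [← hι, map_sub, map_mul, map_pow]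
      linear_combination -(ι (Polynomial.C c') * ι g₀ + (a ^ 3 + 3 * a * b ^ 2 * ι κ)) * h0
        + ι κ * (ι (Polynomial.C c') * ι g₁ + (3 * a ^ 2 * b + b ^ 3 * ι κ)) * h1)
  rw [← hι] at hn
  obtain ⟨a', ha'⟩ := exists_algebraMap_eq_of_aeval_eq_zero (𝕜 := 𝕜) (a := 2 * a)
    (Polynomial.X ^ 3 - Polynomial.C (3 * n) * Polynomial.X - Polynomial.C (2 * Polynomial.C c' * g₀))
    (by monicity!) (by
      simp only [map_sub, map_mul, map_pow, Polynomial.aeval_X, Polynomial.aeval_C, map_ofNat]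
      simp only [← hι, hn]
      linear_combination (-2) * h0)
  rw [← hι] at ha'
  have hb : b = 0 := by
    refine eq_zero_of_mul_sq_eq (a := Polynomial.C (1/2) * a') hsq hodd (hnd ▸ hq) ?_
    have h2 : ι (Polynomial.C (1/2)) * 2 = 1 := by
      rw [← map_ofNat ι 2, ← map_mul, ← map_one ι, ← Polynomial.C_ofNat, ← Polynomial.C_mul]
      norm_num
    simp only [← hι, map_sub, map_mul, map_pow, ha', hn]
    linear_combination (-a^2) * (ι (Polynomial.C (1/2)) * 2 + 1) * h2
  rw [hb] at h1
  have h3 : ι (Polynomial.C c' * g₁) = ι 0 := by rw [map_mul, map_zero]; linear_combination h1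
  exact mul_ne_zero (Polynomial.C_ne_zero.2 hc') hg₁ (hinj h3)

lemma not_dvd_mul_pow_five_sub {κ g₀ g₁ q : Polynomial ℂ} (hsq : Squarefree κ)
    (hodd : Odd κ.natDegree) (hq : q.natDegree < κ.natDegree) (hg₁ : g₁ ≠ 0)
    (hrel : g₀ ^ 2 - κ * g₁ ^ 2 = q ^ 5) {c' : ℂ} (hc' : c' ≠ 0) {a d : Polynomial (Polynomial ℂ)}
    (hd : ¬ (Polynomial.X ^ 2 - Polynomial.C κ) ∣ d) :
    ¬ (Polynomial.X ^ 2 - Polynomial.C κ) ∣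
      Polynomial.C (Polynomial.C c') * (Polynomial.C g₀ + Polynomial.C g₁ * Polynomial.X) * d ^ 5
        - a ^ 5 := by
  intro hdvd
  let 𝕜 := FractionRing (Polynomial ℂ)
  set ι := algebraMap (Polynomial ℂ) 𝕜 with hι
  have hinj : Function.Injective ι := IsFractionRing.injective (Polynomial ℂ) 𝕜
  have hirr := irreducible_map_X_pow_sub_C (𝕜 := 𝕜) Nat.prime_two
    (fun h => (Nat.not_even_iff_odd.2 hodd) (even_iff_two_dvd.2 h))
  obtain ⟨r, hr, hrd⟩ := exists_pow_modEq_fraction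
    (Polynomial.monic_X_pow_sub_C κ two_ne_zero) hirr hd hdvd
  have hmap : (Polynomial.X ^ 2 - Polynomial.C κ).map ι = Polynomial.X ^ 2 - Polynomial.C (ι κ) := by
    simp
  rw [hmap] at hr hrd
  obtain ⟨a, b, rfl⟩ := eq_C_add_C_mul_X hr
  obtain ⟨h0, h1⟩ := eq_zero_of_X_sq_sub_C_dvd (κ := ι κ)
    (u := ι (Polynomial.C c') * ι g₀ - (a ^ 5 + 10 * a ^ 3 * b ^ 2 * ι κ + 5 * a * b ^ 4 * ι κ ^ 2))
    (v := ι (Polynomial.C c') * ι g₁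
      - (5 * a ^ 4 * b + 10 * a ^ 2 * b ^ 3 * ι κ + b ^ 5 * ι κ ^ 2)) (by
      refine (dvd_iff_dvd_of_dvd_sub ?_).1 hrd
      refine ⟨-(Polynomial.C b ^ 5 * Polynomial.X * (Polynomial.X ^ 2 + Polynomial.C (ι κ))
        + 5 * Polynomial.C a * Polynomial.C b ^ 4 * (Polynomial.X ^ 2 + Polynomial.C (ι κ))
        + 10 * Polynomial.C a ^ 2 * Polynomial.C b ^ 3 * Polynomial.X
        + 10 * Polynomial.C a ^ 3 * Polynomial.C b ^ 2), ?_⟩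
      simp only [Polynomial.map_mul, Polynomial.map_add, Polynomial.map_C, Polynomial.map_X, map_sub,
        map_add, map_mul, map_pow, map_ofNat, ← hι]
      ring)
  obtain ⟨n, hn, hnd⟩ := exists_natDegree_eq_of_pow_eq (𝕜 := 𝕜) (n := a ^ 2 - ι κ * b ^ 2)
    (p := 5) (by norm_num) hc' (q := q) (by
      rw [← hrel]
      simp only [← hι, map_sub, map_mul, map_pow]
      linear_combination -(ι (Polynomial.C c') * ι g₀
          + (a ^ 5 + 10 * a ^ 3 * b ^ 2 * ι κ + 5 * a * b ^ 4 * ι κ ^ 2)) * h0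
        + ι κ * (ι (Polynomial.C c') * ι g₁
          + (5 * a ^ 4 * b + 10 * a ^ 2 * b ^ 3 * ι κ + b ^ 5 * ι κ ^ 2)) * h1)
  rw [← hι] at hn
  obtain ⟨a', ha'⟩ := exists_algebraMap_eq_of_aeval_eq_zero (𝕜 := 𝕜) (a := 2 * a)
    (Polynomial.X ^ 5 - Polynomial.C (5 * n) * Polynomial.X ^ 3
      + Polynomial.C (5 * n ^ 2) * Polynomial.X - Polynomial.C (2 * Polynomial.C c' * g₀))
    (by monicity!) (by
      simp only [map_sub, map_add, map_mul, map_pow, Polynomial.aeval_X, Polynomial.aeval_C,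
        map_ofNat]
      simp only [← hι, hn]
      linear_combination (-2) * h0)
  rw [← hι] at ha'
  have hb : b = 0 := by
    refine eq_zero_of_mul_sq_eq (a := Polynomial.C (1/2) * a') hsq hodd (hnd ▸ hq) ?_
    have h2 : ι (Polynomial.C (1/2)) * 2 = 1 := by
      rw [← map_ofNat ι 2, ← map_mul, ← map_one ι, ← Polynomial.C_ofNat, ← Polynomial.C_mul]
      norm_num
    simp only [← hι, map_sub, map_mul, map_pow, ha', hn]
    linear_combination (-a^2) * (ι (Polynomial.C (1/2)) * 2 + 1) * h2
  rw [hb] at h1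
  have h3 : ι (Polynomial.C c' * g₁) = ι 0 := by rw [map_mul, map_zero]; linear_combination h1
  exact mul_ne_zero (Polynomial.C_ne_zero.2 hc') hg₁ (hinj h3)

lemma not_dvd_mul_pow_two_sub {k q : Polynomial ℂ} (hsep : k.Separable)
    (hdeg : ¬ 3 ∣ k.natDegree) {c' : ℂ} (hc' : c' ≠ 0) {a d : Polynomial (Polynomial ℂ)}
    (hd : ¬ (Polynomial.X ^ 3 - Polynomial.C k) ∣ d) :
    ¬ (Polynomial.X ^ 3 - Polynomial.C k) ∣
      Polynomial.C (Polynomial.C c') * (Polynomial.X - Polynomial.C q) * d ^ 2 - a ^ 2 := by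
  intro hdvd
  let 𝕜 := FractionRing (Polynomial ℂ)
  set ι := algebraMap (Polynomial ℂ) 𝕜 with hι
  have hinj : Function.Injective ι := IsFractionRing.injective (Polynomial ℂ) 𝕜
  have hirr := irreducible_map_X_pow_sub_C (𝕜 := 𝕜) Nat.prime_three hdeg
  obtain ⟨r, hr, hrd⟩ := exists_pow_modEq_fraction
    (Polynomial.monic_X_pow_sub_C k three_ne_zero) hirr hd hdvd
  have hmap : (Polynomial.X ^ 3 - Polynomial.C k).map ι = Polynomial.X ^ 3 - Polynomial.C (ι k) := by
    simp
  rw [hmap] at hr hrd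
  obtain ⟨a, b, e, rfl⟩ := eq_C_add_C_mul_X_add_C_mul_X_sq hr
  obtain ⟨h0, h1, h2⟩ := eq_zero_of_X_pow_three_sub_C_dvd (κ := ι k)
    (u := -ι (Polynomial.C c') * ι q - (a ^ 2 + 2 * b * e * ι k))
    (v := ι (Polynomial.C c') - (2 * a * b + e ^ 2 * ι k)) (w := - (b ^ 2 + 2 * a * e)) (by
      refine (dvd_iff_dvd_of_dvd_sub ?_).1 hrd
      refine ⟨-(2 * Polynomial.C b * Polynomial.C e + Polynomial.C e ^ 2 * Polynomial.X), ?_⟩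
      simp only [Polynomial.map_mul, Polynomial.map_sub, Polynomial.map_C, Polynomial.map_X, map_sub,
        map_add, map_mul, map_pow, map_ofNat, map_neg, ← hι]
      ring)
  have hc0 : ι (Polynomial.C c') ≠ 0 := fun h =>
    Polynomial.C_ne_zero.2 hc' (hinj (h.trans (map_zero ι).symm))
  have he : e ≠ 0 := by
    rintro rfl
    have : b = 0 := by
      have : b ^ 2 = 0 := by linear_combination -h2
      exact pow_eq_zero_iff two_ne_zero |>.1 this
    subst this
    exact hc0 (by linear_combination h1)
  obtain ⟨β, hβ⟩ : ∃ β, b = β * e := ⟨b / e, (div_mul_cancel₀ b he).symm⟩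
  obtain ⟨η, hη⟩ : ∃ η, e * η = 1 := ⟨e⁻¹, mul_inv_cancel₀ he⟩
  subst hβ
  have ha : 2 * a = -β ^ 2 * e := by
    refine mul_right_cancel₀ he ?_
    linear_combination -h2
  have e1 : ι k - β ^ 3 = ι (Polynomial.C c') * η ^ 2 := by
    linear_combination (-η ^ 2) * h1 + (-(ι k - β ^ 3) * (e * η + 1)) * hη
      - (η ^ 2 * β * e) * ha
  have e2 : β ^ 4 - 4 * ι q * β ^ 3 + 8 * ι k * β + 4 * ι q * ι k = 0 := by
    refine (mul_eq_zero_iff_left (pow_ne_zero 2 he)).1 ?_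
    linear_combination -4 * h0 - (2 * a - β ^ 2 * e) * ha + 4 * ι q * (-h1 - β * e * ha)
  obtain ⟨β, rfl⟩ := exists_algebraMap_eq_of_aeval_eq_zero (𝕜 := 𝕜) (a := β)
    (Polynomial.X ^ 4 - Polynomial.C (4 * q) * Polynomial.X ^ 3
      + Polynomial.C (8 * k) * Polynomial.X + Polynomial.C (4 * q * k))
    (by monicity!) (by
      simp only [map_sub, map_add, map_mul, map_pow, Polynomial.aeval_X, Polynomial.aeval_C,
        map_ofNat]
      exact e2)
  obtain ⟨η, rfl⟩ := exists_algebraMap_eq_of_aeval_eq_zero (𝕜 := 𝕜) (a := η)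
    (Polynomial.X ^ 2 - Polynomial.C (Polynomial.C c'⁻¹ * (k - β ^ 3)))
    (by monicity!) (by
      simp only [map_sub, map_mul, map_pow, Polynomial.aeval_X, Polynomial.aeval_C]
      have h3 : ι (Polynomial.C c'⁻¹) * ι (Polynomial.C c') = 1 := by
        rw [← map_mul, ← map_one ι, ← Polynomial.C_mul, inv_mul_cancel₀ hc', Polynomial.C_1]
      simp only [← hι] at e1 ⊢
      linear_combination (-ι (Polynomial.C c'⁻¹)) * e1 - η ^ 2 * h3)
  rw [← hι] at hη e1 e2
  have f1 : k - β ^ 3 = Polynomial.C c' * η ^ 2 := by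
    apply hinj; simpa using e1
  have f2 : β ^ 4 - 4 * q * β ^ 3 + 8 * k * β + 4 * q * k = 0 := by
    apply hinj
    simp only [map_sub, map_add, map_mul, map_pow, map_ofNat, map_zero]
    exact e2
  have hη0 : η ≠ 0 := by
    rintro rfl
    simp at hη
  by_cases hdη : η.degree = 0
  · obtain ⟨w, hw, rfl⟩ := Polynomial.natDegree_eq_zero.1 (Polynomial.natDegree_eq_of_degree_eq_some hdη)
    have : k = β ^ 3 + Polynomial.C (c' * w ^ 2) := by
      rw [map_mul, map_pow]; linear_combination f1
    rw [this, Polynomial.natDegree_add_C, Polynomial.natDegree_pow] at hdeg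
    exact hdeg (dvd_mul_right _ _)
  · obtain ⟨u, hu⟩ := IsAlgClosed.exists_root η hdη
    have hu' : η.eval u = 0 := hu
    have g1 := congrArg (Polynomial.eval u) f1
    have g2 := congrArg (Polynomial.eval u) f2
    have g3 := congrArg (fun P => Polynomial.eval u (Polynomial.derivative P)) f1
    simp [hu', Polynomial.derivative_pow] at g1 g2 g3
    have g4 : β.eval u = 0 := by
      have : 9 * β.eval u ^ 4 = 0 := by
        linear_combination g2 - (8 * β.eval u + 4 * q.eval u) * g1
      simpa using this
    obtain ⟨s, t, hst⟩ := hsep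
    have g5 := congrArg (Polynomial.eval u) hst
    have g6 : k.eval u = 0 := by rw [sub_eq_zero.1 g1, g4]; simp
    have g7 : (Polynomial.derivative k).eval u = 0 := by rw [sub_eq_zero.1 g3, g4]; simp
    simp [g6, g7] at g5

end PowerResidues

section ValuationLemmas

variable {M Γ₀ : Type*} [Field M] [LinearOrderedCommGroupWithZero Γ₀] (v : Valuation M Γ₀)

lemma Valuation.mul_lt_one_of_lt_of_le {a b : M} (ha : v a < 1) (hb : v b ≤ 1) : v (a * b) < 1 := by
  rw [map_mul]; exact _root_.mul_lt_one_of_lt_of_le ha hb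

lemma Valuation.lt_one_of_unit_mul {a b : M} (ha : v a = 1) (hb : v (a * b) < 1) : v b < 1 := by
  rwa [map_mul, ha, one_mul] at hb

lemma Valuation.lt_one_of_pow {n : ℕ} {a : M} (ha : v (a ^ n) < 1) : v a < 1 := by
  by_contra h
  rw [map_pow] at ha
  exact absurd ha (not_lt.2 (one_le_pow₀ (not_lt.1 h)))

lemma Valuation.le_one_of_pow {n : ℕ} (hn : n ≠ 0) {a : M} (ha : v (a ^ n) ≤ 1) : v a ≤ 1 := by
  by_contra h
  rw [map_pow] at ha
  exact absurd ha (not_le.2 (one_lt_pow₀ (not_le.1 h) hn))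

/-- Far away from the origin, `Z ^ 2 - Y ^ 3` bounded makes `Z / Y` a uniformizing quotient. -/
lemma Valuation.pow_eq_of_one_lt {Y Z : M} (hY : 1 < v Y) (h : v (Z ^ 2 - Y ^ 3) ≤ 1) :
    1 < v Z / v Y ∧ (v Z / v Y) ^ 2 = v Y ∧ (v Z / v Y) ^ 3 = v Z := by
  have h0 : v Y ≠ 0 := (zero_lt_one.trans hY).ne'
  have h3 : v (Y ^ 3) = v Y ^ 3 := map_pow _ _ _
  have h1 : 1 < v Y ^ 3 := one_lt_pow₀ hY (by norm_num)
  have h2 : v Z ^ 2 = v Y ^ 3 := by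
    rw [← map_pow v Z, ← h3, show Z ^ 2 = Y ^ 3 + (Z ^ 2 - Y ^ 3) by ring]
    exact v.map_add_eq_of_lt_left (by rw [h3]; exact h.trans_lt h1)
  have hm : (v Z / v Y) ^ 2 = v Y := by
    rw [div_pow, h2, div_eq_iff (pow_ne_zero 2 h0), pow_succ']
  refine ⟨?_, hm, ?_⟩
  · by_contra hlt
    exact absurd (hm ▸ pow_le_one₀ zero_le (not_lt.1 hlt)) (not_le.2 hY)
  · rw [pow_succ, hm, mul_div_cancel₀ _ h0]

lemma Valuation.exists_sq_eq_sub {Y Z Q C : M} (h2 : v 2 = 1) (h3 : v 3 = 1)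
    (h : Z ^ 2 - C ^ 2 = Y ^ 3 - Q ^ 3) (hZ : v (Z + C) = v (Z - C)) (hQ : v Q ≤ 1) (hC : v C ≤ 1)
    (hne : ¬ (v Q < 1 ∧ v C < 1)) : ∃ γ, v (Y - Q) = γ ^ 2 := by
  rcases lt_or_ge 1 (v Y) with hY | hY
  · obtain ⟨-, hm, -⟩ := v.pow_eq_of_one_lt hY (Z := Z) (by
      rw [show Z ^ 2 - Y ^ 3 = C ^ 2 - Q ^ 3 by linear_combination h]
      exact v.integer.sub_mem (v.integer.pow_mem hC 2) (v.integer.pow_mem hQ 3))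
    exact ⟨_, by rw [hm]; exact v.map_sub_eq_of_lt_left (hQ.trans_lt hY)⟩
  have hT : v (Y ^ 2 + Y * Q + Q ^ 2) ≤ 1 :=
    v.integer.add_mem (v.integer.add_mem (v.integer.pow_mem hY 2) (v.integer.mul_mem hY hQ)) (v.integer.pow_mem hQ 2)
  have hYQ : v (Y - Q) ≤ 1 := v.integer.sub_mem hY hQ
  have hprod : v (Y - Q) * v (Y ^ 2 + Y * Q + Q ^ 2) = v (Z - C) ^ 2 := by
    rw [sq (v (Z - C)), ← map_mul]
    nth_rewrite 2 [← hZ]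
    rw [← map_mul]
    congr 1
    linear_combination -h
  rcases hT.eq_or_lt with hT | hT
  · exact ⟨_, by rw [← hprod, hT, mul_one]⟩
  rcases hYQ.eq_or_lt with hYQ | hYQ
  · exact ⟨1, by rw [hYQ, one_pow]⟩
  exfalso
  apply hne
  constructor
  · refine v.lt_one_of_pow (n := 2) (v.lt_one_of_unit_mul h3 ?_)
    rw [show 3 * Q ^ 2 = (Y ^ 2 + Y * Q + Q ^ 2) - (Y - Q) * (Y + 2 * Q) by ring]
    exact v.map_sub_lt hT (v.mul_lt_one_of_lt_of_le hYQ
      (v.integer.add_mem hY (v.integer.mul_mem h2.le hQ)))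
  · have h4 : v (Z - C) < 1 := v.lt_one_of_pow (n := 2) (by
      rw [map_pow, ← hprod]; exact _root_.mul_lt_one_of_lt_of_le hYQ hT.le)
    refine v.lt_one_of_unit_mul h2 ?_
    rw [show 2 * C = (Z + C) - (Z - C) by ring]
    exact v.map_sub_lt (hZ ▸ h4) h4

lemma Valuation.exists_cube_eq_sub {Y Z Q C ω : M} (h2 : v 2 = 1) (hω : v (1 - ω) = 1)
    (hω3 : ω ^ 2 + ω + 1 = 0)
    (h : Z ^ 2 - C ^ 2 = Y ^ 3 - Q ^ 3) (hY1 : v (ω * Y - Q) = v (Y - Q))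
    (hY2 : v (ω ^ 2 * Y - Q) = v (Y - Q)) (hQ : v Q ≤ 1) (hC : v C ≤ 1)
    (hne : ¬ (v Q < 1 ∧ v C < 1)) : ∃ γ, v (Z - C) = γ ^ 3 := by
  have hvω : v ω = 1 := by
    have : v (ω ^ 3) = 1 := by
      rw [show ω ^ 3 = 1 by linear_combination (ω - 1) * hω3, map_one]
    rwa [map_pow, pow_eq_one_iff_of_nonneg zero_le (by norm_num)] at this
  rcases lt_or_ge 1 (v Y) with hY | hY
  · obtain ⟨h1, hm, hm3⟩ := v.pow_eq_of_one_lt hY (Z := Z) (by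
      rw [show Z ^ 2 - Y ^ 3 = C ^ 2 - Q ^ 3 by linear_combination h]
      exact v.integer.sub_mem (v.integer.pow_mem hC 2) (v.integer.pow_mem hQ 3))
    refine ⟨v Z / v Y, ?_⟩
    rw [hm3]
    exact v.map_sub_eq_of_lt_left (hC.trans_lt (hm3 ▸ one_lt_pow₀ h1 (by norm_num)))
  have hZ : v Z ≤ 1 := by
    refine v.le_one_of_pow (n := 2) two_ne_zero ?_
    rw [show Z ^ 2 = Y ^ 3 - Q ^ 3 + C ^ 2 by linear_combination h]
    exact v.integer.add_mem (v.integer.sub_mem (v.integer.pow_mem hY 3) (v.integer.pow_mem hQ 3)) (v.integer.pow_mem hC 2)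
  have hprod : v (Z - C) * v (Z + C) = v (Y - Q) ^ 3 := by
    calc v (Z - C) * v (Z + C) = v ((Y - Q) * (ω * Y - Q) * (ω ^ 2 * Y - Q)) := by
          rw [← map_mul]
          congr 1
          linear_combination h + (-Y * Q ^ 2 + ω * Y ^ 2 * Q - (ω - 1) * Y ^ 3) * hω3
      _ = v (Y - Q) ^ 3 := by rw [map_mul, map_mul, hY1, hY2, pow_succ, sq]
  have hp : v (Z + C) ≤ 1 := v.integer.add_mem hZ hC
  have hm : v (Z - C) ≤ 1 := v.integer.sub_mem hZ hC
  rcases hp.eq_or_lt with hp | hp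
  · exact ⟨_, by rw [← hprod, hp, mul_one]⟩
  rcases hm.eq_or_lt with hm | hm
  · exact ⟨1, by rw [hm, one_pow]⟩
  exfalso
  apply hne
  constructor
  · have h4 : v (Y - Q) < 1 := v.lt_one_of_pow (n := 3) (by
      rw [map_pow, ← hprod]; exact _root_.mul_lt_one_of_lt_of_le hm hp.le)
    refine v.lt_one_of_unit_mul hω ?_
    rw [show (1 - ω) * Q = (Y - Q) * ω - (ω * Y - Q) by ring]
    exact v.map_sub_lt (v.mul_lt_one_of_lt_of_le h4 hvω.le) (hY1 ▸ h4)
  · refine v.lt_one_of_unit_mul h2 ?_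
    rw [show 2 * C = (Z + C) - (Z - C) by ring]
    exact v.map_sub_lt hp hm

lemma Valuation.exists_fifth_eq_of_one_lt {U Z a b d r : M} (hU : 1 < v U) (ha : v a ≤ 1)
    (hb : v b ≤ 1) (hd : v d ≤ 1) (hZ : Z ^ 2 = (U + a) ^ 3 + d) (hr : v r ≤ v U ^ 2) :
    ∃ γ, v (Z * (U + b) + r) = γ ^ 5 := by
  have hUa : v (U + a) = v U := v.map_add_eq_of_lt_left (ha.trans_lt hU)
  have hUb : v (U + b) = v U := v.map_add_eq_of_lt_left (hb.trans_lt hU)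
  obtain ⟨h1, hm, hm3⟩ := v.pow_eq_of_one_lt (Y := U + a) (Z := Z) (hUa ▸ hU) (by
    rw [show Z ^ 2 - (U + a) ^ 3 = d by linear_combination hZ]; exact hd)
  refine ⟨v Z / v (U + a), ?_⟩
  have h5 : v (Z * (U + b)) = (v Z / v (U + a)) ^ 5 := by
    rw [map_mul, hUb, ← hUa, pow_add _ 3 2, hm, hm3]
  rw [← h5]
  refine v.map_add_eq_of_lt_left (hr.trans_lt ?_)
  have h4 : v U ^ 2 = (v Z / v (U + a)) ^ 4 := by rw [← hUa, pow_mul _ 2 2, hm]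
  rw [h5, h4]
  exact pow_lt_pow_right₀ h1 (by norm_num)

end ValuationLemmas

/-- The coefficients of a polynomial section `(q, c)` of the elliptic surface
`z ^ 2 = y ^ 3 + A - B * x ^ 5`, with `q = x ^ 2 + x + q₀` and `c = x ^ 3 + c₂ * x ^ 2 + c₁ * x + c₀`,
together with the coefficients of a function whose divisor is supported on the conjugates of
that section under the multiplication of `x` by fifth roots of unity. -/
structure RatSection (k : Type*) [Field k] where
  (q₀ c₀ c₁ c₂ β γ δ : k)
  coeff_four : c₂ ^ 2 + 2 * c₁ = 3 + 3 * q₀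
  coeff_three : 2 * c₀ + 2 * c₁ * c₂ = 1 + 6 * q₀
  coeff_two : c₁ ^ 2 + 2 * c₂ * c₀ = 3 * q₀ + 3 * q₀ ^ 2
  coeff_one : 2 * c₁ * c₀ = 3 * q₀ ^ 2
  A_ne_zero : c₀ ^ 2 - q₀ ^ 3 ≠ 0
  B_ne_zero : 3 - 2 * c₂ ≠ 0
  c₀_ne_zero : c₀ ≠ 0
  β_ne_zero : β ≠ 0
  norm_four : γ ^ 2 = 3 * q₀ + 2 * β
  norm_three : 2 * γ * δ = 3 * q₀ ^ 2 + 6 * q₀ * β + β ^ 2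
  norm_two : δ ^ 2 - 2 * γ * c₀ * β = c₀ ^ 2 + 6 * q₀ ^ 2 * β + 3 * q₀ * β ^ 2
  norm_one : 2 * δ * c₀ * β + 2 * c₀ ^ 2 * β + 3 * q₀ ^ 2 * β ^ 2 = 0
  cross_two : 3 - 2 * c₂ = 5 + 2 * γ
  cross_one : 2 * (3 - 2 * c₂) * β = 5 + 2 * δ
  cross_zero : 2 * c₀ * β + (3 - 2 * c₂) * β ^ 2 = 1

namespace RatSection

variable {k M : Type*} [Field k] [Field M]

def A (D : RatSection k) : k := D.c₀ ^ 2 - D.q₀ ^ 3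
def B (D : RatSection k) : k := 3 - 2 * D.c₂
def q (D : RatSection k) (x : k) : k := x ^ 2 + x + D.q₀
def c (D : RatSection k) (x : k) : k := x ^ 3 + D.c₂ * x ^ 2 + D.c₁ * x + D.c₀

/-- The function with divisor supported on the conjugates of the section. -/
def g (D : RatSection k) (x y z : k) : k :=
  z * (y - D.q₀ + D.β) + (D.γ * (y - D.q₀) ^ 2 + D.δ * (y - D.q₀) - D.c₀ * D.β - x ^ 5)

lemma map_eq_of_eq (f : k →+* M) {a b : k} (h : a = b) : f a = f b := congrArg f h

/-- Extension of the base field of a section. -/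
def map (D : RatSection k) (f : k →+* M) : RatSection M where
  q₀ := f D.q₀
  c₀ := f D.c₀
  c₁ := f D.c₁
  c₂ := f D.c₂
  β := f D.β
  γ := f D.γ
  δ := f D.δ
  coeff_four := by simpa [map_ofNat f] using map_eq_of_eq f D.coeff_four
  coeff_three := by simpa [map_ofNat f] using map_eq_of_eq f D.coeff_three
  coeff_two := by simpa [map_ofNat f] using map_eq_of_eq f D.coeff_two
  coeff_one := by simpa [map_ofNat f] using map_eq_of_eq f D.coeff_one
  A_ne_zero := by simpa [map_ofNat f] using (map_ne_zero f).2 D.A_ne_zero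
  B_ne_zero := by simpa [map_ofNat f] using (map_ne_zero f).2 D.B_ne_zero
  c₀_ne_zero := by simpa [map_ofNat f] using (map_ne_zero f).2 D.c₀_ne_zero
  β_ne_zero := by simpa [map_ofNat f] using (map_ne_zero f).2 D.β_ne_zero
  norm_four := by simpa [map_ofNat f] using map_eq_of_eq f D.norm_four
  norm_three := by simpa [map_ofNat f] using map_eq_of_eq f D.norm_three
  norm_two := by simpa [map_ofNat f] using map_eq_of_eq f D.norm_two
  norm_one := by simpa [map_ofNat f] using map_eq_of_eq f D.norm_one
  cross_two := by simpa [map_ofNat f] using map_eq_of_eq f D.cross_two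
  cross_one := by simpa [map_ofNat f] using map_eq_of_eq f D.cross_one
  cross_zero := by simpa [map_ofNat f] using map_eq_of_eq f D.cross_zero

lemma map_A (D : RatSection k) (f : k →+* M) : (D.map f).A = f D.A := by simp [A, map]
lemma map_B (D : RatSection k) (f : k →+* M) : (D.map f).B = f D.B := by simp [B, map, map_ofNat f]

lemma c_sq (D : RatSection k) (x : k) : D.c x ^ 2 = D.q x ^ 3 + D.A - D.B * x ^ 5 := by
  simp only [c, q, A, B]
  linear_combination x ^ 4 * D.coeff_four + x ^ 3 * D.coeff_three + x ^ 2 * D.coeff_two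
    + x * D.coeff_one

lemma norm_at_zero (D : RatSection k) (u : k) :
    (D.γ * u ^ 2 + D.δ * u - D.c₀ * D.β) ^ 2 - ((u + D.q₀) ^ 3 + D.A) * (u + D.β) ^ 2
      = - u ^ 5 := by
  simp only [A]
  linear_combination u ^ 4 * D.norm_four + u ^ 3 * D.norm_three + u ^ 2 * D.norm_two
    - u * D.norm_one

lemma g_mul_g_neg (D : RatSection k) {x y z : k} (h : z ^ 2 = y ^ 3 + D.A - D.B * x ^ 5) :
    D.g x y z * D.g x y (-z) = -((y - D.q₀) ^ 5 - x ^ 10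
      - (1 + 5 * (y - D.q₀) + 5 * (y - D.q₀) ^ 2) * x ^ 5) := by
  have h0 := D.norm_at_zero (y - D.q₀)
  simp only [g, A, B] at *
  linear_combination h0 - (y - D.q₀ + D.β) ^ 2 * h + x ^ 5 * ((y - D.q₀) ^ 2 * D.cross_two
    + (y - D.q₀) * D.cross_one + D.cross_zero)

lemma prod_conj (D : RatSection k) {ζ : k} (hζ : ζ ^ 4 + ζ ^ 3 + ζ ^ 2 + ζ + 1 = 0) (x y : k) :
    (y - D.q x) * (y - D.q (ζ * x)) * (y - D.q (ζ ^ 2 * x)) * (y - D.q (ζ ^ 3 * x))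
      * (y - D.q (ζ ^ 4 * x)) = (y - D.q₀) ^ 5 - x ^ 10
      - (1 + 5 * (y - D.q₀) + 5 * (y - D.q₀) ^ 2) * x ^ 5 := by
  obtain ⟨u, rfl⟩ : ∃ u, y = u + D.q₀ := ⟨y - D.q₀, by ring⟩
  have e1 : (u - ζ * x - ζ ^ 2 * x ^ 2) * (u - ζ ^ 4 * x - ζ ^ 8 * x ^ 2)
      = u^2 + x^2 - x^3 + x^4 + u*x - x^3*ζ^2 - x^3*ζ^3 + u*x*ζ^2 + u*x*ζ^3 - u*x^2*ζ^2 -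
      u*x^2*ζ^3 := by
    linear_combination (-x^2 + x^3 - x^4 - u*x + x^2*ζ - x^3*ζ + x^3*ζ^2 - x^3*ζ^4 + x^3*ζ^5 + x^4*ζ - x^4*ζ^5 +
      x^4*ζ^6 + u*x^2*ζ^3 - u*x^2*ζ^4) * hζ
  have e2 : (u - ζ ^ 2 * x - ζ ^ 4 * x ^ 2) * (u - ζ ^ 3 * x - ζ ^ 6 * x ^ 2)
      = u^2 + x^2 + x^4 + u*x^2 + x^3*ζ^2 + x^3*ζ^3 - u*x*ζ^2 - u*x*ζ^3 + u*x^2*ζ^2 + u*x^2*ζ^3 := by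
    linear_combination (-x^2 - x^4 - u*x^2 + x^2*ζ - x^3*ζ^2 + x^3*ζ^4 + x^4*ζ - x^4*ζ^5 + x^4*ζ^6 + u*x^2*ζ -
      u*x^2*ζ^2) * hζ
  calc _ = (u - x - x ^ 2) * ((u - ζ * x - ζ ^ 2 * x ^ 2) * (u - ζ ^ 4 * x - ζ ^ 8 * x ^ 2))
        * ((u - ζ ^ 2 * x - ζ ^ 4 * x ^ 2) * (u - ζ ^ 3 * x - ζ ^ 6 * x ^ 2)) := by
          simp only [q]; ring
    _ = _ := by
      rw [e1, e2]
      linear_combination (-x^7 - x^8 + 2*u*x^5 + u*x^6 - 2*u*x^7 - u^2*x^3 - u^2*x^4 + 3*u^2*x^5 - u^2*x^6 +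
      u^3*x^2 - 2*u^3*x^3 + u^3*x^4 + x^7*ζ + x^7*ζ^2 + x^8*ζ + x^8*ζ^2 - 2*u*x^5*ζ -
      2*u*x^5*ζ^2 - u*x^6*ζ - u*x^6*ζ^2 + 2*u*x^7*ζ + 2*u*x^7*ζ^2 + u^2*x^3*ζ + u^2*x^3*ζ^2 +
      u^2*x^4*ζ + u^2*x^4*ζ^2 - 3*u^2*x^5*ζ - 3*u^2*x^5*ζ^2 + u^2*x^6*ζ + u^2*x^6*ζ^2 -
      u^3*x^2*ζ - u^3*x^2*ζ^2 + 2*u^3*x^3*ζ + 2*u^3*x^3*ζ^2 - u^3*x^4*ζ - u^3*x^4*ζ^2) * hζ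

end RatSection

namespace RatSection

variable {k M Γ₀ : Type*} [Field k] [Field M] [LinearOrderedCommGroupWithZero Γ₀] (v : Valuation M Γ₀)

/-- A valuation which is trivial on the coefficients of a section. -/
structure Trivial (D : RatSection M) : Prop where
  two : v 2 = 1
  three : v 3 = 1
  five : v 5 = 1
  q₀ : v D.q₀ ≤ 1
  c₀ : v D.c₀ = 1
  c₁ : v D.c₁ ≤ 1
  c₂ : v D.c₂ ≤ 1
  β : v D.β = 1
  γ : v D.γ ≤ 1
  δ : v D.δ ≤ 1
  A : v D.A = 1
  B : v D.B = 1

lemma trivial_map [CharZero k] (D : RatSection k) (f : k →+* M)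
    (hv : ∀ a : k, a ≠ 0 → v (f a) = 1) : Trivial v (D.map f) := by
  have hle : ∀ a : k, v (f a) ≤ 1 := fun a => by
    rcases eq_or_ne a 0 with rfl | ha
    · simp
    · exact (hv a ha).le
  exact ⟨by simpa [map_ofNat f] using hv 2 two_ne_zero, by simpa [map_ofNat f] using hv 3 three_ne_zero,
    by simpa [map_ofNat f] using hv 5 (by norm_num), hle _, hv _ D.c₀_ne_zero, hle _, hle _,
    hv _ D.β_ne_zero, hle _, hle _, by rw [map_A]; exact hv _ D.A_ne_zero,
    by rw [map_B]; exact hv _ D.B_ne_zero⟩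

variable {v} {D : RatSection M}

lemma Trivial.q_le (h : D.Trivial v) {x : M} (hx : v x ≤ 1) : v (D.q x) ≤ 1 :=
  v.integer.add_mem (v.integer.add_mem (v.integer.pow_mem hx 2) hx) h.q₀

lemma Trivial.c_le (h : D.Trivial v) {x : M} (hx : v x ≤ 1) : v (D.c x) ≤ 1 :=
  v.integer.add_mem (v.integer.add_mem (v.integer.add_mem (v.integer.pow_mem hx 3)
    (v.integer.mul_mem h.c₂ (v.integer.pow_mem hx 2))) (v.integer.mul_mem h.c₁ hx)) h.c₀.le

lemma Trivial.not_lt (h : D.Trivial v) {x : M} (hx : v x ≤ 1) :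
    ¬ (v (D.q x) < 1 ∧ v (D.c x) < 1) := by
  rintro ⟨hq, hc⟩
  have hx1 : v x < 1 := by
    refine v.lt_one_of_pow (n := 4) (v.lt_one_of_unit_mul (a := -(5 * D.B)) ?_ ?_)
    · rw [Valuation.map_neg, map_mul, h.five, h.B, one_mul]
    rw [show -(5 * D.B) * x ^ 4 = D.c x * (2 * (3 * x ^ 2 + 2 * D.c₂ * x + D.c₁))
        - D.q x * (3 * D.q x * (2 * x + 1)) by
      simp only [RatSection.B, RatSection.q, RatSection.c]
      linear_combination (-4 * x ^ 3) * D.coeff_four - 3 * x ^ 2 * D.coeff_three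
        - 2 * x * D.coeff_two - D.coeff_one]
    refine v.map_sub_lt (v.mul_lt_one_of_lt_of_le hc ?_) (v.mul_lt_one_of_lt_of_le hq ?_)
    · exact v.integer.mul_mem h.two.le (v.integer.add_mem (v.integer.add_mem (v.integer.mul_mem
        h.three.le (v.integer.pow_mem hx 2)) (v.integer.mul_mem (v.integer.mul_mem h.two.le h.c₂) hx))
        h.c₁)
    · exact v.integer.mul_mem (v.integer.mul_mem h.three.le (h.q_le hx))
        (v.integer.add_mem (v.integer.mul_mem h.two.le hx) v.integer.one_mem)
  have hA : v D.A < 1 := by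
    rw [show D.A = D.c x * D.c x - D.q x * D.q x ^ 2 + x * (D.B * x ^ 4) by
      linear_combination -D.c_sq x]
    exact v.map_add_lt (v.map_sub_lt (v.mul_lt_one_of_lt_of_le hc hc.le)
      (v.mul_lt_one_of_lt_of_le hq (v.integer.pow_mem hq.le 2)))
      (v.mul_lt_one_of_lt_of_le hx1 (v.integer.mul_mem h.B.le (v.integer.pow_mem hx 4)))
  exact hA.ne h.A

lemma map_quadratic_le {a b c U : M} (hU : 1 < v U) (ha : v a ≤ 1) (hb : v b ≤ 1) (hc : v c ≤ 1) :
    v (a * U ^ 2 + b * U + c) ≤ v U ^ 2 := by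
  refine v.map_add_le (v.map_add_le ?_ ?_) (hc.trans (one_le_pow₀ hU.le))
  · rw [map_mul, map_pow]
    exact mul_le_of_le_one_left' ha
  · rw [map_mul]
    exact (mul_le_of_le_one_left' hb).trans (le_self_pow₀ hU.le two_ne_zero)

lemma inv_lt_one_of_one_lt {x : M} (hx : 1 < v x) : v x⁻¹ < 1 := by
  rw [map_inv₀]; exact inv_lt_one_of_one_lt₀ hx

lemma Trivial.q_div (h : D.Trivial v) {x : M} (hx : 1 < v x) : v (D.q x / x ^ 2) = 1 := by
  have hi := inv_lt_one_of_one_lt hx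
  have hx0 : x ≠ 0 := by rintro rfl; simp at hx
  rw [show D.q x / x ^ 2 = 1 + x⁻¹ * (1 + x⁻¹ * D.q₀) by
    simp only [q]; field_simp; ring]
  exact v.map_one_add_of_lt (v.mul_lt_one_of_lt_of_le hi
    (v.integer.add_mem v.integer.one_mem (v.integer.mul_mem hi.le h.q₀)))

lemma Trivial.c_div (h : D.Trivial v) {x : M} (hx : 1 < v x) : v (D.c x / x ^ 3) ≤ 1 := by
  have hi := inv_lt_one_of_one_lt hx
  have hx0 : x ≠ 0 := by rintro rfl; simp at hx
  rw [show D.c x / x ^ 3 = 1 + x⁻¹ * (D.c₂ + x⁻¹ * (D.c₁ + x⁻¹ * D.c₀)) by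
    simp only [c]; field_simp; ring]
  exact v.integer.add_mem v.integer.one_mem (v.integer.mul_mem hi.le (v.integer.add_mem h.c₂
    (v.integer.mul_mem hi.le (v.integer.add_mem h.c₁ (v.integer.mul_mem hi.le h.c₀.le)))))

lemma scaled_eq {x y z : M} (hD : z ^ 2 = y ^ 3 + D.A - D.B * x ^ 5) :
    (z / x ^ 3) ^ 2 - (D.c x / x ^ 3) ^ 2 = (y / x ^ 2) ^ 3 - (D.q x / x ^ 2) ^ 3 := by
  have h := D.c_sq x
  simp only [div_pow, ← pow_mul, ← sub_div]
  congr 1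
  linear_combination hD - h

lemma Trivial.exists_sq_eq (h : D.Trivial v) {x y z : M} (hD : z ^ 2 = y ^ 3 + D.A - D.B * x ^ 5)
    (hz : v (z + D.c x) = v (z - D.c x)) : ∃ γ, v (y - D.q x) = γ ^ 2 := by
  rcases le_or_gt (v x) 1 with hx | hx
  · exact v.exists_sq_eq_sub h.two h.three (by linear_combination hD - D.c_sq x) hz (h.q_le hx)
      (h.c_le hx) (h.not_lt hx)
  · have hx0 : x ≠ 0 := by rintro rfl; simp at hx
    obtain ⟨γ, hγ⟩ := v.exists_sq_eq_sub h.two h.three (scaled_eq hD)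
      (by rw [← add_div, ← sub_div, map_div₀, map_div₀, hz]) (h.q_div hx).le (h.c_div hx)
      (fun hh => hh.1.ne (h.q_div hx))
    refine ⟨γ * v x, ?_⟩
    rw [← sub_div, map_div₀, map_pow, div_eq_iff (pow_ne_zero 2 ((v.ne_zero_iff).2 hx0))] at hγ
    rw [hγ, mul_pow]

lemma Trivial.exists_cube_eq (h : D.Trivial v) {x y z ω : M} (hω : v (1 - ω) = 1)
    (hω3 : ω ^ 2 + ω + 1 = 0) (hD : z ^ 2 = y ^ 3 + D.A - D.B * x ^ 5)
    (hy1 : v (ω * y - D.q x) = v (y - D.q x)) (hy2 : v (ω ^ 2 * y - D.q x) = v (y - D.q x)) :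
    ∃ γ, v (z - D.c x) = γ ^ 3 := by
  rcases le_or_gt (v x) 1 with hx | hx
  · exact v.exists_cube_eq_sub h.two hω hω3 (by linear_combination hD - D.c_sq x) hy1 hy2 (h.q_le hx)
      (h.c_le hx) (h.not_lt hx)
  · have hx0 : x ≠ 0 := by rintro rfl; simp at hx
    obtain ⟨γ, hγ⟩ := v.exists_cube_eq_sub h.two hω hω3 (scaled_eq hD)
      (by rw [← mul_div_assoc, ← sub_div, ← sub_div, map_div₀, map_div₀, hy1])
      (by rw [← mul_div_assoc, ← sub_div, ← sub_div, map_div₀, map_div₀, hy2])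
      (h.q_div hx).le (h.c_div hx)
      (fun hh => hh.1.ne (h.q_div hx))
    refine ⟨γ * v x, ?_⟩
    rw [← sub_div, map_div₀, map_pow, div_eq_iff (pow_ne_zero 3 ((v.ne_zero_iff).2 hx0))] at hγ
    rw [hγ, mul_pow]

lemma Trivial.exists_fifth_eq (h : D.Trivial v) {x y z ζ : M} (hζ1 : v (1 - ζ) = 1)
    (hζ : ζ ^ 4 + ζ ^ 3 + ζ ^ 2 + ζ + 1 = 0) (hD : z ^ 2 = y ^ 3 + D.A - D.B * x ^ 5)
    (hy1 : v (y - D.q (ζ * x)) = v (y - D.q x)) (hy2 : v (y - D.q (ζ ^ 2 * x)) = v (y - D.q x))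
    (hy3 : v (y - D.q (ζ ^ 3 * x)) = v (y - D.q x)) (hy4 : v (y - D.q (ζ ^ 4 * x)) = v (y - D.q x)) :
    ∃ γ, v (D.g x y z) = γ ^ 5 := by
  have hprod : v (D.g x y z) * v (D.g x y (-z)) = v (y - D.q x) ^ 5 := by
    rw [← map_mul, D.g_mul_g_neg hD, Valuation.map_neg, ← D.prod_conj hζ]
    rw [map_mul, map_mul, map_mul, map_mul, hy1, hy2, hy3, hy4]
    generalize v (y - D.q x) = w
    simp only [pow_succ, pow_zero, one_mul]
  have hvζ : v ζ = 1 := by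
    have : v (ζ ^ 5) = 1 := by
      rw [show ζ ^ 5 = 1 by linear_combination (ζ - 1) * hζ, map_one]
    rwa [map_pow, pow_eq_one_iff_of_nonneg zero_le (by norm_num)] at this
  obtain ⟨u, rfl⟩ : ∃ u, y = u + D.q₀ := ⟨y - D.q₀, by ring⟩
  have hg : ∀ z, D.g x (u + D.q₀) z
      = z * (u + D.β) + (D.γ * u ^ 2 + D.δ * u - D.c₀ * D.β - x ^ 5) := by
    intro z; simp only [g]; ring
  rcases le_or_gt (v x) 1 with hx | hx
  · have hd : v (D.A - D.B * x ^ 5) ≤ 1 :=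
      v.integer.sub_mem h.A.le (v.integer.mul_mem h.B.le (v.integer.pow_mem hx 5))
    rcases le_or_gt (v u) 1 with hu | hu
    · have hz : v z ≤ 1 := by
        refine v.le_one_of_pow two_ne_zero (n := 2) ?_
        rw [hD, add_sub_assoc]
        exact v.integer.add_mem (v.integer.pow_mem (v.integer.add_mem hu h.q₀) 3) hd
      have hr : v (D.γ * u ^ 2 + D.δ * u - D.c₀ * D.β - x ^ 5) ≤ 1 :=
        v.integer.sub_mem (v.integer.sub_mem (v.integer.add_mem (v.integer.mul_mem h.γ
          (v.integer.pow_mem hu 2)) (v.integer.mul_mem h.δ hu)) (v.integer.mul_mem h.c₀.le h.β.le))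
          (v.integer.pow_mem hx 5)
      have hgp : v (D.g x (u + D.q₀) z) ≤ 1 := by
        rw [hg]
        exact v.integer.add_mem (v.integer.mul_mem hz (v.integer.add_mem hu h.β.le)) hr
      have hgm : v (D.g x (u + D.q₀) (-z)) ≤ 1 := by
        rw [hg]
        exact v.integer.add_mem (v.integer.mul_mem (v.integer.neg_mem hz)
          (v.integer.add_mem hu h.β.le)) hr
      rcases hgm.eq_or_lt with hgm | hgm
      · exact ⟨_, by rw [← hprod, hgm, mul_one]⟩
      rcases hgp.eq_or_lt with hgp | hgp
      · exact ⟨1, by rw [hgp, one_pow]⟩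
      exfalso
      have hw : v (u + D.q₀ - D.q x) < 1 := v.lt_one_of_pow (n := 5) (by
        rw [map_pow, ← hprod]; exact _root_.mul_lt_one_of_lt_of_le hgp hgm.le)
      have hx1 : v x < 1 := by
        have e1 : v ((1 + (1 + ζ) * x) * x) < 1 := by
          refine v.lt_one_of_unit_mul hζ1 ?_
          rw [show (1 - ζ) * ((1 + (1 + ζ) * x) * x)
            = (u + D.q₀ - D.q (ζ * x)) - (u + D.q₀ - D.q x) by simp only [q]; ring]
          exact v.map_sub_lt (hy1 ▸ hw) hw
        have e2 : v ((1 + ζ * (1 + ζ) * x) * x) < 1 := by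
          refine v.lt_one_of_unit_mul (a := (1 - ζ) * ζ) (by rw [map_mul, hζ1, hvζ, one_mul]) ?_
          rw [show (1 - ζ) * ζ * ((1 + ζ * (1 + ζ) * x) * x)
            = (u + D.q₀ - D.q (ζ ^ 2 * x)) - (u + D.q₀ - D.q (ζ * x)) by simp only [q]; ring]
          exact v.map_sub_lt (hy2 ▸ hw) (hy1 ▸ hw)
        have hζ2 : v (1 + ζ) ≤ 1 := v.integer.add_mem v.integer.one_mem hvζ.le
        have hunit : v ((1 - ζ) * (1 + ζ)) = 1 := by
          refine le_antisymm (v.integer.mul_mem hζ1.le hζ2) ?_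
          by_contra hlt
          have h5 : v ((1 - ζ) * (1 + ζ) * (-ζ ^ 3 - ζ)) < 1 :=
            v.mul_lt_one_of_lt_of_le (not_le.1 hlt) (v.integer.sub_mem (v.integer.neg_mem
              (v.integer.pow_mem hvζ.le 3)) hvζ.le)
          rw [show (1 - ζ) * (1 + ζ) * (-ζ ^ 3 - ζ) = 1 - ζ by
            linear_combination (ζ - 1) * hζ] at h5
          exact h5.ne hζ1
        refine v.lt_one_of_pow (n := 2) (v.lt_one_of_unit_mul hunit ?_)
        rw [show (1 - ζ) * (1 + ζ) * x ^ 2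
          = (1 + (1 + ζ) * x) * x - (1 + ζ * (1 + ζ) * x) * x by ring]
        exact v.map_sub_lt e1 e2
      have hu1 : v u < 1 := by
        rw [show u = (u + D.q₀ - D.q x) + x * (x + 1) by simp only [q]; ring]
        exact v.map_add_lt hw (v.mul_lt_one_of_lt_of_le hx1 (v.integer.add_mem hx v.integer.one_mem))
      have hz1 : v z < 1 := by
        refine v.lt_one_of_unit_mul (a := 2 * (u + D.β)) ?_ ?_
        · rw [map_mul, h.two, one_mul, v.map_add_eq_of_lt_right (h.β.symm ▸ hu1), h.β]
        · rw [show 2 * (u + D.β) * z = D.g x (u + D.q₀) z - D.g x (u + D.q₀) (-z) by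
            rw [hg, hg]; ring]
          exact v.map_sub_lt hgp hgm
      have hc : v (D.c₀ ^ 2) < 1 := by
        rw [show D.c₀ ^ 2 = z * z - u * (u ^ 2 + 3 * u * D.q₀ + 3 * D.q₀ ^ 2) + x * (D.B * x ^ 4) by
          simp only [RatSection.A] at hD; linear_combination -hD]
        exact v.map_add_lt (v.map_sub_lt (v.mul_lt_one_of_lt_of_le hz1 hz)
          (v.mul_lt_one_of_lt_of_le hu1 (v.integer.add_mem (v.integer.add_mem
            (v.integer.pow_mem hu 2) (v.integer.mul_mem (v.integer.mul_mem h.three.le hu) h.q₀))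
            (v.integer.mul_mem h.three.le (v.integer.pow_mem h.q₀ 2)))))
          (v.mul_lt_one_of_lt_of_le hx1 (v.integer.mul_mem h.B.le (v.integer.pow_mem hx 4)))
      rw [map_pow, h.c₀, one_pow] at hc
      exact lt_irrefl _ hc
    · rw [hg]
      refine v.exists_fifth_eq_of_one_lt hu h.q₀ h.β.le hd (by rw [hD, add_sub_assoc]) ?_
      rw [sub_sub, sub_eq_add_neg]
      exact map_quadratic_le hu h.γ h.δ (v.integer.neg_mem (v.integer.add_mem
        (v.integer.mul_mem h.c₀.le h.β.le) (v.integer.pow_mem hx 5)))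
  · have hx0 : x ≠ 0 := by rintro rfl; simp at hx
    have hvx0 : v x ≠ 0 := (v.ne_zero_iff).2 hx0
    have hi := inv_lt_one_of_one_lt hx
    obtain ⟨i, hix⟩ : ∃ i, i = x⁻¹ := ⟨_, rfl⟩
    obtain ⟨U, rfl⟩ : ∃ U, u = U * x ^ 2 := ⟨u / x ^ 2, by field_simp⟩
    obtain ⟨Z, rfl⟩ : ∃ Z, z = Z * x ^ 3 := ⟨z / x ^ 3, by field_simp⟩
    rw [← hix] at hi
    have hxi : x * i = 1 := by rw [hix, mul_inv_cancel₀ hx0]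
    have hD' : Z ^ 2 = (U + i ^ 2 * D.q₀) ^ 3 + (i ^ 6 * D.A - i * D.B) := by
      refine mul_right_cancel₀ (pow_ne_zero 6 hx0) ?_
      rw [hix]
      field_simp
      linear_combination hD
    have hg' : ∀ Z, D.g x (U * x ^ 2 + D.q₀) (Z * x ^ 3) = (Z * (U + i ^ 2 * D.β)
        + (i * D.γ * U ^ 2 + i ^ 3 * D.δ * U + -(i ^ 5 * (D.c₀ * D.β) + 1))) * x ^ 5 := by
      intro Z
      rw [hg, hix]
      field_simp
      ring
    have hi3 : v (i ^ 3 * D.δ) ≤ 1 := v.integer.mul_mem (v.integer.pow_mem hi.le 3) h.δ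
    have hi1 : v (i * D.γ) ≤ 1 := v.integer.mul_mem hi.le h.γ
    have hi5 : v (i ^ 5 * (D.c₀ * D.β)) ≤ 1 :=
      v.integer.mul_mem (v.integer.pow_mem hi.le 5) (v.integer.mul_mem h.c₀.le h.β.le)
    have hib : v (i ^ 2 * D.β) ≤ 1 := v.integer.mul_mem (v.integer.pow_mem hi.le 2) h.β.le
    have hia : v (i ^ 2 * D.q₀) ≤ 1 := v.integer.mul_mem (v.integer.pow_mem hi.le 2) h.q₀
    have hid : v (i ^ 6 * D.A - i * D.B) ≤ 1 := v.integer.sub_mem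
      (v.integer.mul_mem (v.integer.pow_mem hi.le 6) h.A.le) (v.integer.mul_mem hi.le h.B.le)
    rcases le_or_gt (v U) 1 with hU | hU
    · have hZ : v Z ≤ 1 := by
        refine v.le_one_of_pow two_ne_zero (n := 2) ?_
        rw [hD']
        exact v.integer.add_mem (v.integer.pow_mem (v.integer.add_mem hU hia) 3) hid
      have hr : v (i * D.γ * U ^ 2 + i ^ 3 * D.δ * U + -(i ^ 5 * (D.c₀ * D.β) + 1)) ≤ 1 :=
        v.integer.add_mem (v.integer.add_mem (v.integer.mul_mem hi1 (v.integer.pow_mem hU 2))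
          (v.integer.mul_mem hi3 hU)) (v.integer.neg_mem (v.integer.add_mem hi5 v.integer.one_mem))
      have hgp : v (Z * (U + i ^ 2 * D.β)
          + (i * D.γ * U ^ 2 + i ^ 3 * D.δ * U + -(i ^ 5 * (D.c₀ * D.β) + 1))) ≤ 1 :=
        v.integer.add_mem (v.integer.mul_mem hZ (v.integer.add_mem hU hib)) hr
      have hgm : v (-Z * (U + i ^ 2 * D.β)
          + (i * D.γ * U ^ 2 + i ^ 3 * D.δ * U + -(i ^ 5 * (D.c₀ * D.β) + 1))) ≤ 1 :=
        v.integer.add_mem (v.integer.mul_mem (v.integer.neg_mem hZ) (v.integer.add_mem hU hib)) hr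
      rcases hgp.eq_or_lt with hgp | hgp
      · exact ⟨v x, by rw [hg', map_mul, hgp, one_mul, map_pow]⟩
      rcases hgm.eq_or_lt with hgm | hgm
      · refine ⟨v (U * x ^ 2 + D.q₀ - D.q x) / v x, ?_⟩
        rw [div_pow, ← hprod, eq_div_iff (pow_ne_zero 5 hvx0), ← neg_mul, hg' (-Z), map_mul v _ (x ^ 5),
          hgm, one_mul, map_pow]
      exfalso
      have h1 : v (1 + i * -(D.γ * U ^ 2 + i ^ 2 * D.δ * U - i ^ 4 * (D.c₀ * D.β))) < 1 := by
        refine v.lt_one_of_unit_mul (a := 2) h.two ?_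
        rw [show 2 * (1 + i * -(D.γ * U ^ 2 + i ^ 2 * D.δ * U - i ^ 4 * (D.c₀ * D.β)))
          = -(Z * (U + i ^ 2 * D.β)
          + (i * D.γ * U ^ 2 + i ^ 3 * D.δ * U + -(i ^ 5 * (D.c₀ * D.β) + 1)))
            - (-Z * (U + i ^ 2 * D.β)
          + (i * D.γ * U ^ 2 + i ^ 3 * D.δ * U + -(i ^ 5 * (D.c₀ * D.β) + 1))) by ring]
        exact v.map_sub_lt (by rwa [Valuation.map_neg]) hgm
      refine h1.ne (v.map_one_add_of_lt (v.mul_lt_one_of_lt_of_le hi ?_))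
      exact v.integer.neg_mem (v.integer.sub_mem (v.integer.add_mem (v.integer.mul_mem h.γ
        (v.integer.pow_mem hU 2)) (v.integer.mul_mem (v.integer.mul_mem (v.integer.pow_mem hi.le 2)
        h.δ) hU)) (v.integer.mul_mem (v.integer.pow_mem hi.le 4)
        (v.integer.mul_mem h.c₀.le h.β.le)))
    · obtain ⟨γ, hγ⟩ := v.exists_fifth_eq_of_one_lt hU hia hib hid hD' (map_quadratic_le hU hi1 hi3
        (v.integer.neg_mem (v.integer.add_mem hi5 v.integer.one_mem)))
      exact ⟨γ * v x, by rw [hg', map_mul, hγ, mul_pow, map_pow]⟩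

end RatSection

/-- The section defined over the field of fifteenth roots of unity. -/
def ratSectionOfRoot {k : Type*} [Field k] [CharZero k] (ξ : k)
    (hξ : ξ ^ 8 - ξ ^ 7 + ξ ^ 5 - ξ ^ 4 + ξ ^ 3 - ξ + 1 = 0) : RatSection k where
  q₀ := (2/3) + (1/3)*ξ + (1/3)*ξ^2 - ξ^4 + (1/3)*ξ^5 + (2/3)*ξ^6 - (1/3)*ξ^7
  c₀ := (1/2) + ξ^2 - 2*ξ^4 + ξ^5 + ξ^6 - ξ^7
  c₁ := 1 + ξ - ξ^4 + ξ^6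
  c₂ := 1 + ξ - ξ^2 + ξ^3 - ξ^4 + ξ^6 - ξ^7
  β := 2 - ξ^2 + ξ^3 - ξ^7
  γ := -2 - ξ + ξ^2 - ξ^3 + ξ^4 - ξ^6 + ξ^7
  δ := -(5/2) - ξ^2 - ξ^3 + 4*ξ^4 - 2*ξ^5 - 2*ξ^6 + 3*ξ^7
  A_ne_zero := by
    refine left_ne_zero_of_mul_eq_one (b := -(497004/5) + (1076208/5)*ξ - (1215264/5)*ξ^2 + (804192/5)*ξ^3 - (254064/5)*ξ^4 -
      (411072/5)*ξ^5 + (665136/5)*ξ^6 - 78624*ξ^7) ?_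
    linear_combination ((41408/9) + (582212/15)*ξ - (3542848/45)*ξ^2 + (6158396/45)*ξ^3 - (2267156/15)*ξ^4 -
      (804832/45)*ξ^5 + (14180504/45)*ξ^6 - (20352736/45)*ξ^7 + (2623216/15)*ξ^8 +
      (2013228/5)*ξ^9 - (19291648/45)*ξ^10 - (3079312/45)*ξ^11 + (6365492/45)*ξ^12 +
      (2404628/15)*ξ^13 - (589968/5)*ξ^14 - (1246192/9)*ξ^15 + (1340944/9)*ξ^16 -
      (40624/3)*ξ^17 - (1769744/45)*ξ^18 + (292304/15)*ξ^19 - 2912*ξ^20) * hξ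
  B_ne_zero := by
    refine left_ne_zero_of_mul_eq_one (b := -(3/5) + (6/5)*ξ + (2/5)*ξ^2 - (6/5)*ξ^3 + (2/5)*ξ^4 - (4/5)*ξ^5 + (2/5)*ξ^6 + 2*ξ^7) ?_
    linear_combination (-(8/5) + (4/5)*ξ - (12/5)*ξ^2 + (4/5)*ξ^3 - (8/5)*ξ^4 + (4/5)*ξ^5 + 4*ξ^6) * hξ
  c₀_ne_zero := by
    refine left_ne_zero_of_mul_eq_one (b := -14 + 32*ξ - 36*ξ^2 + 24*ξ^3 - 8*ξ^4 - 12*ξ^5 + 20*ξ^6 - 12*ξ^7) ?_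
    linear_combination (-8 + 8*ξ - 24*ξ^2 + 28*ξ^3 - 20*ξ^5 + 12*ξ^6) * hξ
  β_ne_zero := by
    refine left_ne_zero_of_mul_eq_one (b := 1 + ξ^2 - ξ^3 + ξ^7) ?_
    linear_combination (1 + ξ + 2*ξ^2 - ξ^4 - ξ^5 - ξ^6) * hξ
  coeff_four := by
    linear_combination (-2 + ξ - ξ^2 + ξ^3 - ξ^5 + ξ^6) * hξ
  coeff_three := by
    linear_combination (-2 + 2*ξ^3 - 2*ξ^5) * hξ
  coeff_two := by
    linear_combination (-(4/3) - (2/3)*ξ - (4/3)*ξ^2 + (7/3)*ξ^3 - (2/3)*ξ^4 - ξ^5 + (5/3)*ξ^6) * hξ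
  coeff_one := by
    linear_combination (-(1/3) - (2/3)*ξ - (1/3)*ξ^2 + (4/3)*ξ^3 + (1/3)*ξ^4 - ξ^5 - (1/3)*ξ^6) * hξ
  norm_four := by
    linear_combination (-2 + ξ - ξ^2 + ξ^3 - ξ^5 + ξ^6) * hξ
  norm_three := by
    linear_combination (-(10/3) - (11/3)*ξ - (7/3)*ξ^2 + (16/3)*ξ^3 - (2/3)*ξ^4 - 2*ξ^5 + (8/3)*ξ^6) * hξ
  norm_two := by
    linear_combination (-(10/3) - (32/3)*ξ - (8/3)*ξ^2 + 6*ξ^3 - (10/3)*ξ^4 + (8/3)*ξ^5 + (23/3)*ξ^6 -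
      (5/3)*ξ^7 - ξ^8 + 2*ξ^9 + (4/3)*ξ^10 - (2/3)*ξ^11 - ξ^12 - (1/3)*ξ^13) * hξ
  norm_one := by
    linear_combination ((4/3) + (20/3)*ξ + 2*ξ^2 - (2/3)*ξ^3 + (10/3)*ξ^4 - (31/3)*ξ^5 - (13/3)*ξ^6 + 10*ξ^7 -
      (7/3)*ξ^8 - 6*ξ^9 - 6*ξ^10 + 2*ξ^11 + 10*ξ^12 - (4/3)*ξ^13 - 3*ξ^14 - (2/3)*ξ^15 -
      (1/3)*ξ^16 + (8/3)*ξ^17 - (1/3)*ξ^18 - ξ^19 + (1/3)*ξ^20) * hξ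
  cross_two := by
    linear_combination (0) * hξ
  cross_one := by
    linear_combination (4 - 4*ξ + 4*ξ^2 - 4*ξ^6) * hξ
  cross_zero := by
    linear_combination (5 - 3*ξ + 4*ξ^2 + 4*ξ^3 - 5*ξ^4 + ξ^5 - 5*ξ^6 - 2*ξ^7 + 4*ξ^8 - 4*ξ^9 + 2*ξ^13) * hξ

lemma map_ratSectionOfRoot {k M : Type*} [Field k] [CharZero k] [Field M] [CharZero M] (f : k →+* M)
    (ξ : k) (hξ : ξ ^ 8 - ξ ^ 7 + ξ ^ 5 - ξ ^ 4 + ξ ^ 3 - ξ + 1 = 0)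
    (hξ' : (f ξ) ^ 8 - (f ξ) ^ 7 + (f ξ) ^ 5 - (f ξ) ^ 4 + (f ξ) ^ 3 - f ξ + 1 = 0) :
    (ratSectionOfRoot ξ hξ).map f = ratSectionOfRoot (f ξ) hξ' := by
  simp [RatSection.map, ratSectionOfRoot, map_ofNat f]

section Fibration

variable {k : Type*} [Field k]

/-- Denominator of the slope of the line through a section and its conjugate. -/
def secLine (ξ x : k) : k := x - ξ ^ 3 - ξ ^ 6

/-- Numerator of the slope of the line through a section and its conjugate. -/
def secSlope (ξ x : k) : k :=
  -ξ ^ 3 * x ^ 2 + (1 + ξ - ξ ^ 2 + ξ ^ 3 - ξ ^ 4 + ξ ^ 6 - ξ ^ 7) * x - ξ ^ 4 - ξ ^ 5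

/-- The difference of the first coordinates divided by `secLine`. -/
def secDiff (ξ x : k) : k := (1 + ξ ^ 2 + ξ ^ 7) * x

/-- The sum of the second coordinates divided by `secLine`. -/
def secSum (ξ x : k) : k :=
  (1 + ξ ^ 3) * x ^ 2 + (1 - ξ + ξ ^ 3 - 2 * ξ ^ 4 + ξ ^ 5 + ξ ^ 6 - ξ ^ 7) * x
    + (1 + 2 * ξ - 2 * ξ ^ 3 + 2 * ξ ^ 5 + ξ ^ 6)

lemma conic_of_secant {q₁ q₂ c₁ c₂ l m n d y z τ : k} (hc : c₁ ^ 2 - q₁ ^ 3 = c₂ ^ 2 - q₂ ^ 3)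
    (hz : z ^ 2 - y ^ 3 = c₁ ^ 2 - q₁ ^ 3) (hm : m * (q₁ - q₂) = l * (c₁ - c₂))
    (hn : c₁ + c₂ = l * n) (hd : q₁ - q₂ = l * d) (hq : q₁ - q₂ ≠ 0)
    (hy : (y - q₁) * (y - q₂) ≠ 0)
    (hτ : τ * (l * (z - c₁) - m * (y - q₁)) = (y - q₁) * (y - q₂)) :
    (2 * y + 2 * τ * m - q₁ - q₂ - τ ^ 2 * l ^ 2) ^ 2
      = l ^ 2 * (d ^ 2 + τ ^ 4 * l ^ 2 - 4 * τ ^ 3 * m + 6 * τ ^ 2 * (q₁ + q₂) - 4 * τ * n) := by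
  have hrem : l ^ 2 * (q₂ ^ 2 + q₂ * q₁ + q₁ ^ 2) - m ^ 2 * (q₂ - q₁) - 2 * l * c₁ * m = 0 := by
    refine (mul_eq_zero.1 ?_).resolve_left hq
    linear_combination -l ^ 2 * hc + (m * (q₁ - q₂) - l * (c₁ - c₂) + 2 * l * (c₁ - c₂) - 2 * l * c₁) * hm
  have hcon : 2 * τ * (l * c₁ + m * (y - q₁)) + (y - q₁) * (y - q₂)
      - τ ^ 2 * (l ^ 2 * (y + q₁ + q₂) - m ^ 2) = 0 := by
    refine (mul_eq_zero.1 ?_).resolve_left hy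
    linear_combination (-(τ * (l * (z - c₁) - m * (y - q₁)) + (y - q₁) * (y - q₂)
      + 2 * τ * (m * (y - q₁) + l * c₁))) * hτ + τ ^ 2 * l ^ 2 * hz + τ ^ 2 * (y - q₁) * hrem
  linear_combination 4 * hcon + 4 * τ * hm - 4 * τ * l * hn + (q₁ - q₂ + l * d) * hd

lemma pow_five_conj {ξ : k} (hξ : ξ ^ 8 - ξ ^ 7 + ξ ^ 5 - ξ ^ 4 + ξ ^ 3 - ξ + 1 = 0) (x : k) (n : ℕ) :
    ((ξ ^ 3) ^ n * x) ^ 5 = x ^ 5 := by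
  have h15 : ξ ^ 15 = 1 := by
    linear_combination (ξ ^ 7 + ξ ^ 6 + ξ ^ 5 - ξ ^ 2 - ξ - 1) * hξ
  calc ((ξ ^ 3) ^ n * x) ^ 5 = (ξ ^ 15) ^ n * x ^ 5 := by ring
    _ = x ^ 5 := by rw [h15, one_pow, one_mul]

variable [CharZero k] (ξ : k) (hξ : ξ ^ 8 - ξ ^ 7 + ξ ^ 5 - ξ ^ 4 + ξ ^ 3 - ξ + 1 = 0)

lemma q_sub_q (x : k) : (ratSectionOfRoot ξ hξ).q x - (ratSectionOfRoot ξ hξ).q (ξ ^ 6 * x)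
    = secLine ξ x * secDiff ξ x := by
  simp only [RatSection.q, ratSectionOfRoot, secLine, secDiff]
  linear_combination (x + x*ξ + x*ξ^2 + x*ξ^3 + x*ξ^4 + x*ξ^5 - x^2*ξ^2 - x^2*ξ^3 - x^2*ξ^4) * hξ

lemma c_add_c (x : k) : (ratSectionOfRoot ξ hξ).c x + (ratSectionOfRoot ξ hξ).c (ξ ^ 6 * x)
    = secLine ξ x * secSum ξ x := by
  simp only [RatSection.c, ratSectionOfRoot, secLine, secSum]
  linear_combination (1 + ξ + 3*ξ^2 + 3*ξ^3 + ξ^4 - x*ξ - x*ξ^2 + 2*x*ξ^3 + x*ξ^4 - x*ξ^5 + 2*x^2*ξ +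
      x^2*ξ^2 + 2*x^2*ξ^3 + x^2*ξ^4 + x^2*ξ^5 - x^2*ξ^11 - x^3*ξ^3 - x^3*ξ^4 - x^3*ξ^5 +
      x^3*ξ^8 + x^3*ξ^9 + x^3*ξ^10) * hξ

lemma slope_mul (x : k) :
    secSlope ξ x * ((ratSectionOfRoot ξ hξ).q x - (ratSectionOfRoot ξ hξ).q (ξ ^ 6 * x))
      = secLine ξ x * ((ratSectionOfRoot ξ hξ).c x - (ratSectionOfRoot ξ hξ).c (ξ ^ 6 * x)) := by
  simp only [RatSection.c, RatSection.q, ratSectionOfRoot, secLine, secSlope]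
  linear_combination (-x^4 + x*ξ^3 + x*ξ^4 - x*ξ^9 - x*ξ^10 - x^2*ξ^2 + x^2*ξ^3 + x^2*ξ^4 - x^2*ξ^9 -
      x^2*ξ^10 - x^2*ξ^11 + x^2*ξ^14 + x^2*ξ^17 + x^3*ξ^6 + x^3*ξ^7 + x^3*ξ^8 + x^3*ξ^9 +
      x^3*ξ^10 - x^3*ξ^12 - x^3*ξ^13 - x^3*ξ^14 - x^3*ξ^15 - x^3*ξ^16 - x^4*ξ - x^4*ξ^2 -
      x^4*ξ^3 - x^4*ξ^4 + x^4*ξ^6 + x^4*ξ^7 + x^4*ξ^8 + x^4*ξ^9 + x^4*ξ^10) * hξ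

lemma third_section (x : k) :
    (ξ ^ 6 * x - ξ ^ 3 - ξ ^ 6) * (secLine ξ x
        * ((ratSectionOfRoot ξ hξ).c (ξ ^ 12 * x) - (ratSectionOfRoot ξ hξ).c x)
      - secSlope ξ x * ((ratSectionOfRoot ξ hξ).q (ξ ^ 12 * x) - (ratSectionOfRoot ξ hξ).q x))
    = (x - 1 - ξ ^ 3) * (((ratSectionOfRoot ξ hξ).q (ξ ^ 12 * x) - (ratSectionOfRoot ξ hξ).q x)
      * ((ratSectionOfRoot ξ hξ).q (ξ ^ 12 * x) - (ratSectionOfRoot ξ hξ).q (ξ ^ 6 * x))) := by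
  simp only [RatSection.c, RatSection.q, ratSectionOfRoot, secLine, secSlope]
  linear_combination (-x*ξ^6 - x*ξ^7 - x*ξ^9 - x*ξ^10 + x*ξ^18 + x*ξ^19 + x*ξ^21 + x*ξ^22 + x^2*ξ^5 +
      2*x^2*ξ^8 + x^2*ξ^9 + x^2*ξ^10 + x^2*ξ^11 - x^2*ξ^12 - x^2*ξ^13 - x^2*ξ^14 - x^2*ξ^15
      - x^2*ξ^16 - x^2*ξ^17 - x^2*ξ^21 - x^2*ξ^22 + x^2*ξ^24 + x^2*ξ^25 + x^2*ξ^26 +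
      x^2*ξ^27 + x^2*ξ^28 - 2*x^2*ξ^32 - x^2*ξ^35 - x^3*ξ^8 + x^3*ξ^9 + x^3*ξ^10 - x^3*ξ^14
      - x^3*ξ^15 - x^3*ξ^16 + x^3*ξ^20 - x^3*ξ^21 - x^3*ξ^22 - 2*x^3*ξ^23 - 2*x^3*ξ^24 -
      2*x^3*ξ^25 + 2*x^3*ξ^35 + 2*x^3*ξ^36 + 2*x^3*ξ^37 + x^3*ξ^38 + x^3*ξ^39 + x^3*ξ^40 +
      x^4*ξ^3 + x^4*ξ^4 + x^4*ξ^5 + x^4*ξ^6 + x^4*ξ^7 + x^4*ξ^12 + x^4*ξ^13 + x^4*ξ^14 -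
      x^4*ξ^17 - x^4*ξ^18 - x^4*ξ^19 + x^4*ξ^21 + x^4*ξ^22 + x^4*ξ^23 + x^4*ξ^24 + x^4*ξ^25
      - x^4*ξ^27 - x^4*ξ^28 - x^4*ξ^29 - x^4*ξ^30 - x^4*ξ^31 - x^4*ξ^33 - x^4*ξ^34 -
      x^4*ξ^35 - 2*x^4*ξ^36 - 2*x^4*ξ^37 - x^4*ξ^38 + x^4*ξ^41 + x^4*ξ^42 + x^4*ξ^43 -
      x^5*ξ^6 - x^5*ξ^7 - x^5*ξ^8 - x^5*ξ^9 - x^5*ξ^10 + x^5*ξ^15 + x^5*ξ^16 + x^5*ξ^17 +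
      x^5*ξ^18 + x^5*ξ^19 - x^5*ξ^21 - x^5*ξ^22 - x^5*ξ^23 + x^5*ξ^26 - x^5*ξ^29 + x^5*ξ^32
      + 2*x^5*ξ^33 + 2*x^5*ξ^34 + x^5*ξ^35 - x^5*ξ^38 - x^5*ξ^39 - x^5*ξ^40) * hξ

/-- The quadratic polynomial in `x` whose square root generates the function field of a fibre. -/
def fibreQuad (τ x : k) : k :=
  secDiff ξ x ^ 2 + τ ^ 4 * secLine ξ x ^ 2 - 4 * τ ^ 3 * secSlope ξ x
    + 6 * τ ^ 2 * (x ^ 2 + x + (ξ ^ 6 * x) ^ 2 + ξ ^ 6 * x + 2 * (ratSectionOfRoot ξ hξ).q₀)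
    - 4 * τ * secSum ξ x

lemma c_sq_sub_conj (x : k) {n : ℕ} :
    (ratSectionOfRoot ξ hξ).c ((ξ ^ 3) ^ n * x) ^ 2 - (ratSectionOfRoot ξ hξ).q ((ξ ^ 3) ^ n * x) ^ 3
      = (ratSectionOfRoot ξ hξ).A - (ratSectionOfRoot ξ hξ).B * x ^ 5 := by
  rw [RatSection.c_sq, pow_five_conj hξ]
  ring

lemma fibre_conic {x y z τ : k} (hz : z ^ 2 = y ^ 3 + (ratSectionOfRoot ξ hξ).A
      - (ratSectionOfRoot ξ hξ).B * x ^ 5)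
    (hq : (ratSectionOfRoot ξ hξ).q x - (ratSectionOfRoot ξ hξ).q (ξ ^ 6 * x) ≠ 0)
    (hy : (y - (ratSectionOfRoot ξ hξ).q x) * (y - (ratSectionOfRoot ξ hξ).q (ξ ^ 6 * x)) ≠ 0)
    (hτ : τ * (secLine ξ x * (z - (ratSectionOfRoot ξ hξ).c x)
      - secSlope ξ x * (y - (ratSectionOfRoot ξ hξ).q x))
      = (y - (ratSectionOfRoot ξ hξ).q x) * (y - (ratSectionOfRoot ξ hξ).q (ξ ^ 6 * x))) :
    (2 * y + 2 * τ * secSlope ξ x - (ratSectionOfRoot ξ hξ).q x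
        - (ratSectionOfRoot ξ hξ).q (ξ ^ 6 * x) - τ ^ 2 * secLine ξ x ^ 2) ^ 2
      = secLine ξ x ^ 2 * fibreQuad ξ hξ τ x := by
  have h0 := c_sq_sub_conj ξ hξ x (n := 0)
  have h2 := c_sq_sub_conj ξ hξ x (n := 2)
  simp only [pow_zero, one_mul, ← pow_mul] at h0 h2
  rw [conic_of_secant (h0.trans h2.symm) (by rw [h0]; linear_combination hz) (slope_mul ξ hξ x)
    (c_add_c ξ hξ x) (q_sub_q ξ hξ x) hq hy hτ]
  simp only [fibreQuad, RatSection.q]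
  ring

lemma fibreQuad_sub (τ x x₀ : k) : fibreQuad ξ hξ τ x - fibreQuad ξ hξ τ x₀
    = (x - x₀) * (((1 + ξ ^ 2 + ξ ^ 7) ^ 2 + τ ^ 4 + 4 * τ ^ 3 * ξ ^ 3 + 6 * τ ^ 2 * (1 + ξ ^ 12)
        - 4 * τ * (1 + ξ ^ 3)) * (x + x₀)
      + (-2 * τ ^ 4 * (ξ ^ 3 + ξ ^ 6) - 4 * τ ^ 3 * (1 + ξ - ξ ^ 2 + ξ ^ 3 - ξ ^ 4 + ξ ^ 6 - ξ ^ 7)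
        + 6 * τ ^ 2 * (1 + ξ ^ 6)
        - 4 * τ * (1 - ξ + ξ ^ 3 - 2 * ξ ^ 4 + ξ ^ 5 + ξ ^ 6 - ξ ^ 7))) := by
  simp only [fibreQuad, secDiff, secLine, secSlope, secSum]
  ring

end Fibration

lemma one_sub_root_ne_zero {k : Type*} [Field k] [CharZero k] {ξ : k}
    (hξ : ξ ^ 8 - ξ ^ 7 + ξ ^ 5 - ξ ^ 4 + ξ ^ 3 - ξ + 1 = 0) : 1 - ξ ^ 6 ≠ 0 := by
  refine left_ne_zero_of_mul_eq_one (b := (4/5) - (2/5)*ξ^2 + (1/5)*ξ^3 + (3/5)*ξ^6 - (2/5)*ξ^7) ?_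
  linear_combination (-(1/5) - (1/5)*ξ - (3/5)*ξ^2 - (1/5)*ξ^3 - (1/5)*ξ^4 + (2/5)*ξ^5) * hξ

lemma root_sub_one_ne_zero {k : Type*} [Field k] [CharZero k] {ξ : k}
    (hξ : ξ ^ 8 - ξ ^ 7 + ξ ^ 5 - ξ ^ 4 + ξ ^ 3 - ξ + 1 = 0) : ξ ^ 12 - 1 ≠ 0 := by
  refine left_ne_zero_of_mul_eq_one (b := -(2/5) + (1/5)*ξ^2 + (2/5)*ξ^3 + (1/5)*ξ^6 + (1/5)*ξ^7) ?_
  linear_combination (-(3/5) - (3/5)*ξ - (4/5)*ξ^2 - (3/5)*ξ^3 - (3/5)*ξ^4 + (1/5)*ξ^5 + (2/5)*ξ^6 +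
      (2/5)*ξ^7 + (1/5)*ξ^8 + (2/5)*ξ^9 + (2/5)*ξ^10 + (1/5)*ξ^11) * hξ

lemma root_sub_root_ne_zero {k : Type*} [Field k] [CharZero k] {ξ : k}
    (hξ : ξ ^ 8 - ξ ^ 7 + ξ ^ 5 - ξ ^ 4 + ξ ^ 3 - ξ + 1 = 0) : ξ ^ 12 - ξ ^ 6 ≠ 0 := by
  refine left_ne_zero_of_mul_eq_one (b := (1/5) - (3/5)*ξ^2 + (4/5)*ξ^3 + (2/5)*ξ^6 - (3/5)*ξ^7) ?_
  linear_combination (-1 - ξ - ξ^2 + ξ^5 + (4/5)*ξ^6 + (4/5)*ξ^7 + (2/5)*ξ^8 - (1/5)*ξ^9 - (1/5)*ξ^10 -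
      (3/5)*ξ^11) * hξ

lemma root_sub_root_ne_zero_of_three {k : Type*} [Field k] [CharZero k] {ξ : k}
    (hξ : ξ ^ 8 - ξ ^ 7 + ξ ^ 5 - ξ ^ 4 + ξ ^ 3 - ξ + 1 = 0) : ξ ^ 9 - ξ ^ 3 ≠ 0 := by
  refine left_ne_zero_of_mul_eq_one (b := (1/5) + (2/5)*ξ^2 - (1/5)*ξ^3 + (2/5)*ξ^6 + (2/5)*ξ^7) ?_
  linear_combination (-1 - ξ - ξ^2 - (1/5)*ξ^3 - (1/5)*ξ^4 + (2/5)*ξ^5 + (4/5)*ξ^6 + (4/5)*ξ^7 + (2/5)*ξ^8) * hξ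

section Rationality

variable {k M : Type*} [Field k] [Field M] [Algebra k M]

lemma Transcendental.coeff_eq_zero {N : Subalgebra k M} {y : M} (hy : Transcendental N y) {n : ℕ}
    {a : Fin n → M} (ha : ∀ i, a i ∈ N) (h : ∑ i, a i * y ^ (i : ℕ) = 0) (i : Fin n) : a i = 0 := by
  have hp := (transcendental_iff.1 hy) (∑ i : Fin n, Polynomial.monomial (i : ℕ) ⟨a i, ha i⟩) (by
    rw [map_sum, ← h]
    refine Finset.sum_congr rfl fun j _ => ?_
    rw [Polynomial.aeval_monomial]
    rfl)
  have hc := congrArg (fun p => (p.coeff i : M)) hp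
  simpa [Polynomial.coeff_monomial, Fin.val_inj] using hc

lemma mul_add_ne_zero {x : M} (hx : ∀ b, x ≠ algebraMap k M b) {a b : M}
    (ha : a ∈ (⊥ : Subalgebra k M)) (hb : b ∈ (⊥ : Subalgebra k M)) (h : a ≠ 0 ∨ b ≠ 0) :
    a * x + b ≠ 0 := by
  obtain ⟨a, rfl⟩ := ha
  obtain ⟨b, rfl⟩ := hb
  intro h0
  have ha : a ≠ 0 := by
    rintro rfl
    simp_all
  refine hx (-b / a) ?_
  have : algebraMap k M a ≠ 0 := by simpa using ha
  rw [map_div₀, map_neg, eq_div_iff this]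
  simp only [Algebra.ofId_apply, RingHom.coe_coe, AlgHom.toRingHom_eq_coe] at h0
  linear_combination h0

/-- Projection of a conic from one of its points. -/
lemma mem_of_conic {N : IntermediateField k M} {x W x₀ W₀ θ r₁ r₂ : M} (hx₀ : x₀ ∈ N) (hW₀ : W₀ ∈ N)
    (hθN : θ ∈ N) (hr₁ : r₁ ∈ N) (hr₂ : r₂ ∈ N) (hx : x - x₀ ≠ 0)
    (h : W ^ 2 - W₀ ^ 2 = (x - x₀) * (r₂ * (x + x₀) + r₁)) (hθ : θ * (x - x₀) = W - W₀)
    (hne : θ ^ 2 - r₂ ≠ 0) : x ∈ N ∧ W ∈ N := by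
  have hxe : x * (θ ^ 2 - r₂) = r₂ * x₀ + r₁ - 2 * W₀ * θ + θ ^ 2 * x₀ := by
    refine mul_left_cancel₀ hx ?_
    linear_combination (θ * (x - x₀) + W + W₀) * hθ + h
  have hxN : x ∈ N := by
    rw [eq_div_of_mul_eq hne hxe]
    exact div_mem (add_mem (sub_mem (add_mem (mul_mem hr₂ hx₀) hr₁)
      (mul_mem (mul_mem (ofNat_mem N 2) hW₀) hθN)) (mul_mem (pow_mem hθN 2) hx₀))
      (sub_mem (pow_mem hθN 2) hr₂)
  refine ⟨hxN, ?_⟩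
  rw [show W = W₀ + θ * (x - x₀) by linear_combination -hθ]
  exact add_mem hW₀ (mul_mem hθN (sub_mem hxN hx₀))

lemma secLine_mem {S : Type*} [SetLike S M] [SubringClass S M] {N : S} {e x : M} (he : e ∈ N)
    (hx : x ∈ N) : secLine e x ∈ N :=
  sub_mem (sub_mem hx (pow_mem he 3)) (pow_mem he 6)

lemma secSlope_mem {S : Type*} [SetLike S M] [SubringClass S M] {N : S} {e x : M} (he : e ∈ N)
    (hx : x ∈ N) : secSlope e x ∈ N := by
  unfold secSlope
  repeat' first | assumption | exact one_mem _ | apply add_mem | apply sub_mem | apply mul_mem |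
    apply neg_mem | apply pow_mem

lemma RatSection.q_mem {N : Subalgebra k M} (D : RatSection k) {x : M} (hx : x ∈ N) :
    (D.map (algebraMap k M)).q x ∈ N :=
  add_mem (add_mem (pow_mem hx 2) hx) (N.algebraMap_mem _)

lemma RatSection.c_mem {N : Subalgebra k M} (D : RatSection k) {x : M} (hx : x ∈ N) :
    (D.map (algebraMap k M)).c x ∈ N :=
  add_mem (add_mem (add_mem (pow_mem hx 3) (mul_mem (N.algebraMap_mem _) (pow_mem hx 2)))
    (mul_mem (N.algebraMap_mem _) hx)) (N.algebraMap_mem _)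

lemma RatSection.q_sub_q_eq (D : RatSection k) (a b x : k) :
    D.q (a * x) - D.q (b * x) = (a - b) * x * ((a + b) * x + 1) := by
  simp only [RatSection.q]; ring

lemma IsAlgClosed.exists_algebraMap_eq [IsAlgClosed k] {x : M} (hx : IsAlgebraic k x) :
    ∃ b, algebraMap k M b = x :=
  minpoly.mem_range_of_degree_eq_one k x
    (IsAlgClosed.degree_eq_one_of_irreducible k (minpoly.irreducible hx.isIntegral))

/-- The surface `z ^ 2 = y ^ 3 + A - B * x ^ 5` is rational. -/
theorem exists_adjoin_pair_eq [IsAlgClosed k] [CharZero k] {ξ : k}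
    (hξ : ξ ^ 8 - ξ ^ 7 + ξ ^ 5 - ξ ^ 4 + ξ ^ 3 - ξ + 1 = 0) {x y z : M}
    (hxy : AlgebraicIndependent k ![x, y])
    (hz : z ^ 2 = y ^ 3 + algebraMap k M (ratSectionOfRoot ξ hξ).A
      - algebraMap k M (ratSectionOfRoot ξ hξ).B * x ^ 5) :
    ∃ s t : M, IntermediateField.adjoin k {s, t} = IntermediateField.adjoin k {x, y, z} := by
  have : CharZero M := charZero_of_injective_algebraMap (algebraMap k M).injective
  obtain ⟨e, he⟩ : ∃ e, e = algebraMap k M ξ := ⟨_, rfl⟩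
  have heξ : e ^ 8 - e ^ 7 + e ^ 5 - e ^ 4 + e ^ 3 - e + 1 = 0 := by
    rw [he]; simpa using congrArg (algebraMap k M) hξ
  obtain ⟨D, hD⟩ : ∃ D, D = (ratSectionOfRoot ξ hξ).map (algebraMap k M) := ⟨_, rfl⟩
  have hDe : D = ratSectionOfRoot e heξ := by
    subst he
    rw [hD, map_ratSectionOfRoot]
  rw [← RatSection.map_A, ← RatSection.map_B, ← hD] at hz
  have heN : ∀ N : Subalgebra k M, e ∈ N := fun N => he ▸ N.algebraMap_mem _
  have hqN : ∀ (N : Subalgebra k M) {x : M}, x ∈ N → D.q x ∈ N := fun N x hx =>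
    hD ▸ RatSection.q_mem _ hx
  have hcN : ∀ (N : Subalgebra k M) {x : M}, x ∈ N → D.c x ∈ N := fun N x hx =>
    hD ▸ RatSection.c_mem _ hx
  have hxc : ∀ b, x ≠ algebraMap k M b := by
    rintro b rfl
    exact (hxy.transcendental 0) (isAlgebraic_algebraMap b)
  have hyx : Transcendental (Algebra.adjoin k {x}) y := by
    have h := hxy.transcendental_adjoin (s := {0}) (i := 1) (by simp)
    rw [Set.image_singleton] at h
    exact h
  have hl : ∀ {x : M}, (∀ b, x ≠ algebraMap k M b) → secLine e x ≠ 0 := fun {x} hx => by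
    have := mul_add_ne_zero hx (one_mem _) (b := -e ^ 3 - e ^ 6)
      (sub_mem (neg_mem (pow_mem (heN _) 3)) (pow_mem (heN _) 6)) (Or.inl one_ne_zero)
    rwa [show 1 * x + (-e ^ 3 - e ^ 6) = secLine e x by simp only [secLine]; ring] at this
  have hqq : ∀ {x : M}, (∀ b, x ≠ algebraMap k M b) → ∀ {a b : M}, a ∈ (⊥ : Subalgebra k M) →
      b ∈ (⊥ : Subalgebra k M) → a - b ≠ 0 → D.q (a * x) - D.q (b * x) ≠ 0 := by
    intro x hx a b ha hb hab
    rw [RatSection.q_sub_q_eq]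
    refine mul_ne_zero (mul_ne_zero hab ?_)
      (mul_add_ne_zero hx (add_mem ha hb) (one_mem _) (Or.inr one_ne_zero))
    simpa using hx 0
  have hq12 : ∀ {x : M}, (∀ b, x ≠ algebraMap k M b) → D.q x - D.q (e ^ 6 * x) ≠ 0 := fun {x} hx => by
    simpa using hqq hx (one_mem _) (pow_mem (heN _) 6) (one_sub_root_ne_zero heξ)
  have hxN : x ∈ Algebra.adjoin k {x} := Algebra.self_mem_adjoin_singleton k x
  obtain ⟨q₁, hq₁⟩ : ∃ q₁, q₁ = D.q x := ⟨_, rfl⟩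
  obtain ⟨q₂, hq₂⟩ : ∃ q₂, q₂ = D.q (e ^ 6 * x) := ⟨_, rfl⟩
  obtain ⟨c₁, hc₁⟩ : ∃ c₁, c₁ = D.c x := ⟨_, rfl⟩
  obtain ⟨l, hl'⟩ : ∃ l, l = secLine e x := ⟨_, rfl⟩
  obtain ⟨m, hm⟩ : ∃ m, m = secSlope e x := ⟨_, rfl⟩
  have hl0 : l ≠ 0 := hl' ▸ hl hxc
  have hq₁N : q₁ ∈ Algebra.adjoin k {x} := hq₁ ▸ hqN _ hxN
  have hq₂N : q₂ ∈ Algebra.adjoin k {x} := hq₂ ▸ hqN _ (mul_mem (pow_mem (heN _) 6) hxN)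
  have hc₁N : c₁ ∈ Algebra.adjoin k {x} := hc₁ ▸ hcN _ hxN
  have hlN : l ∈ Algebra.adjoin k {x} := hl' ▸ secLine_mem (heN _) hxN
  have hmN : m ∈ Algebra.adjoin k {x} := hm ▸ secSlope_mem (heN _) hxN
  obtain ⟨S, hS⟩ : ∃ S, S = D.A - D.B * x ^ 5 := ⟨_, rfl⟩
  have hSN : S ∈ Algebra.adjoin k {x} := by
    rw [hS, hD, RatSection.map_A, RatSection.map_B]
    exact sub_mem (Subalgebra.algebraMap_mem _ _) (mul_mem (Subalgebra.algebraMap_mem _ _)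
      (pow_mem hxN 5))
  have hz' : z ^ 2 = y ^ 3 + S := by rw [hz, hS]; ring
  have h2N : (2 : M) ∈ Algebra.adjoin k {x} := ofNat_mem _ 2
  have hP : (y - q₁) * (y - q₂) ≠ 0 := by
    intro h0
    refine one_ne_zero (hyx.coeff_eq_zero (n := 3) (a := ![q₁ * q₂, -(q₁ + q₂), 1]) ?_ ?_ 2)
    · intro i
      fin_cases i
      exacts [mul_mem hq₁N hq₂N, neg_mem (add_mem hq₁N hq₂N), one_mem _]
    · simp only [Fin.sum_univ_three, Fin.isValue, Matrix.cons_val]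
      norm_num
      linear_combination h0
  have hT : l * (z - c₁) - m * (y - q₁) ≠ 0 := by
    intro h0
    refine pow_ne_zero 2 hl0 (hyx.coeff_eq_zero (n := 4) (a := ![l ^ 2 * S - (l * c₁ - m * q₁) ^ 2,
      -(2 * m * (l * c₁ - m * q₁)), - m ^ 2, l ^ 2]) ?_ ?_ 3)
    · intro i
      fin_cases i
      exacts [sub_mem (mul_mem (pow_mem hlN 2) hSN) (pow_mem (sub_mem (mul_mem hlN hc₁N)
        (mul_mem hmN hq₁N)) 2), neg_mem (mul_mem (mul_mem h2N hmN) (sub_mem (mul_mem hlN hc₁N)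
        (mul_mem hmN hq₁N))), neg_mem (pow_mem hmN 2), pow_mem hlN 2]
    · simp only [Fin.sum_univ_four, Fin.isValue, Matrix.cons_val]
      norm_num
      linear_combination (l * z + (l * c₁ + m * (y - q₁))) * h0 - l ^ 2 * hz'
  obtain ⟨τ, hτdef⟩ : ∃ τ, τ = (y - q₁) * (y - q₂) / (l * (z - c₁) - m * (y - q₁)) := ⟨_, rfl⟩
  have hτ : τ * (l * (z - c₁) - m * (y - q₁)) = (y - q₁) * (y - q₂) := by
    rw [hτdef, div_mul_cancel₀ _ hT]
  have hτ0 : τ ≠ 0 := by rw [hτdef]; exact div_ne_zero hP hT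
  have hτc : ∀ b, τ ≠ algebraMap k M b := by
    intro b hb
    have hτN : τ ∈ Algebra.adjoin k {x} := hb ▸ Subalgebra.algebraMap_mem _ _
    obtain ⟨p, hp⟩ : ∃ p, p = -q₁ - q₂ + τ * m := ⟨_, rfl⟩
    obtain ⟨r, hr⟩ : ∃ r, r = q₁ * q₂ - τ * m * q₁ + τ * l * c₁ := ⟨_, rfl⟩
    have hpN : p ∈ Algebra.adjoin k {x} := hp ▸ add_mem (sub_mem (neg_mem hq₁N) hq₂N) (mul_mem hτN hmN)
    have hrN : r ∈ Algebra.adjoin k {x} := hr ▸ add_mem (sub_mem (mul_mem hq₁N hq₂N)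
      (mul_mem (mul_mem hτN hmN) hq₁N)) (mul_mem (mul_mem hτN hlN) hc₁N)
    have hrel : τ * l * z = y ^ 2 + p * y + r := by rw [hp, hr]; linear_combination hτ
    refine one_ne_zero (hyx.coeff_eq_zero (n := 5) (a := ![r ^ 2 - τ ^ 2 * l ^ 2 * S, 2 * p * r,
      p ^ 2 + 2 * r, 2 * p - τ ^ 2 * l ^ 2, 1]) ?_ ?_ 4)
    · intro i
      fin_cases i
      exacts [sub_mem (pow_mem hrN 2) (mul_mem (mul_mem (pow_mem hτN 2) (pow_mem hlN 2)) hSN),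
        mul_mem (mul_mem h2N hpN) hrN, add_mem (pow_mem hpN 2) (mul_mem h2N hrN),
        sub_mem (mul_mem h2N hpN) (mul_mem (pow_mem hτN 2) (pow_mem hlN 2)), one_mem _]
    · simp only [Fin.sum_univ_five, Fin.isValue, Matrix.cons_val]
      norm_num
      linear_combination (-(τ * l * z) - (y ^ 2 + p * y + r)) * hrel + τ ^ 2 * l ^ 2 * hz'
  have hd : τ - e ^ 6 ≠ 0 := by
    have := hτc (ξ ^ 6)
    rwa [map_pow, ← he, ← sub_ne_zero] at this
  obtain ⟨x₀, hx₀def⟩ : ∃ x₀, x₀ = (τ * (1 + e ^ 3) - e ^ 3 - e ^ 6) / (τ - e ^ 6) := ⟨_, rfl⟩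
  have hx₀ : x₀ * (τ - e ^ 6) = τ * (1 + e ^ 3) - e ^ 3 - e ^ 6 := by
    rw [hx₀def, div_mul_cancel₀ _ hd]
  have hmob : τ * (x₀ - 1 - e ^ 3) = e ^ 6 * x₀ - e ^ 3 - e ^ 6 := by linear_combination hx₀
  have hx₀d : x₀ - 1 - e ^ 3 ≠ 0 := by
    refine left_ne_zero_of_mul (b := τ - e ^ 6) ?_
    rw [show (x₀ - 1 - e ^ 3) * (τ - e ^ 6) = e ^ 9 - e ^ 3 by linear_combination hx₀]
    exact root_sub_root_ne_zero_of_three heξ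
  have hx₀c : ∀ b, x₀ ≠ algebraMap k M b := by
    intro b hb
    refine hτc ((ξ ^ 6 * b - ξ ^ 3 - ξ ^ 6) / (b - 1 - ξ ^ 3)) ?_
    rw [eq_div_of_mul_eq hx₀d hmob, hb, he]
    simp only [map_div₀, map_sub, map_mul, map_pow, map_one]
  have hA := c_sq_sub_conj e heξ x₀ (n := 4)
  simp only [← pow_mul, Nat.reduceMul, ← hDe] at hA
  have hP₀ : (D.q (e ^ 12 * x₀) - D.q x₀) * (D.q (e ^ 12 * x₀) - D.q (e ^ 6 * x₀)) ≠ 0 :=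
    mul_ne_zero (by simpa using hqq hx₀c (pow_mem (heN _) 12) (one_mem _) (root_sub_one_ne_zero heξ))
      (hqq hx₀c (pow_mem (heN _) 12) (pow_mem (heN _) 6) (root_sub_root_ne_zero heξ))
  have hcon₀ := fibre_conic e heξ (x := x₀) (y := D.q (e ^ 12 * x₀)) (z := D.c (e ^ 12 * x₀)) (τ := τ)
    (by rw [← hDe]; linear_combination hA) (by rw [← hDe]; exact hq12 hx₀c)
    (by rw [← hDe]; exact hP₀) (by
      have h3 := third_section e heξ x₀
      rw [← hDe] at h3 ⊢
      refine mul_left_cancel₀ hx₀d (Eq.trans ?_ h3)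
      rw [← hmob]
      ring)
  have hcon := fibre_conic e heξ (x := x) (y := y) (z := z) (τ := τ) (by rw [← hDe]; exact hz)
    (by rw [← hDe]; exact hq12 hxc) (by rw [← hDe, ← hq₁, ← hq₂]; exact hP)
    (by rw [← hDe, ← hq₁, ← hq₂, ← hc₁, ← hl', ← hm]; exact hτ)
  rw [← hDe] at hcon₀ hcon
  rw [← hq₁, ← hq₂, ← hl', ← hm] at hcon
  obtain ⟨V₀, hV₀⟩ : ∃ V₀, V₀ = 2 * D.q (e ^ 12 * x₀) + 2 * τ * secSlope e x₀ - D.q x₀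
    - D.q (e ^ 6 * x₀) - τ ^ 2 * secLine e x₀ ^ 2 := ⟨_, rfl⟩
  obtain ⟨V, hV⟩ : ∃ V, V = 2 * y + 2 * τ * m - q₁ - q₂ - τ ^ 2 * l ^ 2 := ⟨_, rfl⟩
  rw [← hV₀] at hcon₀
  rw [← hV] at hcon
  have hl₀ : secLine e x₀ ≠ 0 := hl hx₀c
  have hV₀0 : V₀ ≠ 0 := by
    intro h0
    obtain ⟨G, hG⟩ : ∃ G : Polynomial k, G = (.X - .C (1 + ξ ^ 3)) * (.C (2 * ξ ^ 24 - 1 - ξ ^ 12) * .X ^ 2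
      + .C (2 * ξ ^ 12 - 1 - ξ ^ 6) * .X) + 2 * (.C (ξ ^ 6) * .X - .C (ξ ^ 3 + ξ ^ 6))
      * (-.C (ξ ^ 3) * .X ^ 2 + .C (1 + ξ - ξ ^ 2 + ξ ^ 3 - ξ ^ 4 + ξ ^ 6 - ξ ^ 7) * .X
        - .C (ξ ^ 4 + ξ ^ 5)) := ⟨_, rfl⟩
    have hGe : Polynomial.aeval x₀ G = (x₀ - (1 + e ^ 3)) * ((2 * e ^ 24 - 1 - e ^ 12) * x₀ ^ 2
        + (2 * e ^ 12 - 1 - e ^ 6) * x₀) + 2 * (e ^ 6 * x₀ - (e ^ 3 + e ^ 6)) * secSlope e x₀ := by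
      rw [hG, he]
      simp only [secSlope, map_add, map_sub, map_mul, map_pow, map_neg, map_one, Polynomial.aeval_X,
        Polynomial.aeval_C, map_ofNat (Polynomial.aeval x₀), map_ofNat (algebraMap k M)]
      ring
    have halg : IsAlgebraic k x₀ := by
      refine ⟨(.X - .C (1 + ξ ^ 3)) * G - ((.C (ξ ^ 6) * .X - .C (ξ ^ 3 + ξ ^ 6))
        * (.X - .C (ξ ^ 3 + ξ ^ 6))) ^ 2, ?_, ?_⟩
      · intro hp
        have := congrArg (Polynomial.eval (1 + ξ ^ 3)) hp
        simp only [Polynomial.eval_sub, Polynomial.eval_mul, Polynomial.eval_X, Polynomial.eval_C,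
          Polynomial.eval_pow, sub_self, zero_mul, zero_sub, Polynomial.eval_zero, neg_eq_zero] at this
        refine pow_ne_zero 2 (mul_ne_zero (root_sub_root_ne_zero_of_three hξ)
          (one_sub_root_ne_zero hξ)) ?_
        rw [← this]
        ring
      · rw [map_sub, map_mul, hGe]
        have : (x₀ - 1 - e ^ 3) ^ 2 * V₀ = 0 := by rw [h0, mul_zero]
        simp only [map_sub, map_mul, map_pow, map_add, Polynomial.aeval_X, Polynomial.aeval_C,
          ← he, map_one]
        rw [← this, hV₀]
        simp only [secLine, RatSection.q]
        linear_combination (-2 * (x₀ - 1 - e ^ 3) * secSlope e x₀ + (τ * (x₀ - 1 - e ^ 3)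
          + (e ^ 6 * x₀ - e ^ 3 - e ^ 6)) * (x₀ - e ^ 3 - e ^ 6) ^ 2) * hmob
    obtain ⟨b, hb⟩ := IsAlgClosed.exists_algebraMap_eq halg
    exact hx₀c b hb.symm
  obtain ⟨W, hW⟩ : ∃ W, W = V / l := ⟨_, rfl⟩
  obtain ⟨W₀, hW₀⟩ : ∃ W₀, W₀ = V₀ / secLine e x₀ := ⟨_, rfl⟩
  have hWR : W ^ 2 = fibreQuad e heξ τ x := by
    rw [hW, div_pow, hcon, mul_div_cancel_left₀ _ (pow_ne_zero 2 hl0)]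
  have hWR₀ : W₀ ^ 2 = fibreQuad e heξ τ x₀ := by
    rw [hW₀, div_pow, hcon₀, mul_div_cancel_left₀ _ (pow_ne_zero 2 hl₀)]
  have hsub := fibreQuad_sub e heξ τ x x₀
  rw [← hWR, ← hWR₀] at hsub
  obtain ⟨r₂, hr₂⟩ : ∃ r, r = (1 + e ^ 2 + e ^ 7) ^ 2 + τ ^ 4 + 4 * τ ^ 3 * e ^ 3
    + 6 * τ ^ 2 * (1 + e ^ 12) - 4 * τ * (1 + e ^ 3) := ⟨_, rfl⟩
  obtain ⟨r₁, hr₁⟩ : ∃ r, r = -2 * τ ^ 4 * (e ^ 3 + e ^ 6)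
    - 4 * τ ^ 3 * (1 + e - e ^ 2 + e ^ 3 - e ^ 4 + e ^ 6 - e ^ 7) + 6 * τ ^ 2 * (1 + e ^ 6)
    - 4 * τ * (1 - e + e ^ 3 - 2 * e ^ 4 + e ^ 5 + e ^ 6 - e ^ 7) := ⟨_, rfl⟩
  rw [← hr₁, ← hr₂] at hsub
  have heI : ∀ N : IntermediateField k M, e ∈ N := fun N => he ▸ N.algebraMap_mem _
  have hr₂I : ∀ N : IntermediateField k M, τ ∈ N → r₂ ∈ N := fun N hN => by
    have := heI N
    rw [hr₂]
    repeat' first | assumption | exact one_mem _ | exact ofNat_mem _ _ | apply add_mem |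
      apply sub_mem | apply mul_mem | apply neg_mem | apply pow_mem
  have hr₁I : ∀ N : IntermediateField k M, τ ∈ N → r₁ ∈ N := fun N hN => by
    have := heI N
    rw [hr₁]
    repeat' first | assumption | exact one_mem _ | exact ofNat_mem _ _ | apply add_mem |
      apply sub_mem | apply mul_mem | apply neg_mem | apply pow_mem
  have hx₀I : ∀ N : IntermediateField k M, τ ∈ N → x₀ ∈ N := fun N hN => by
    have := heI N
    rw [hx₀def]
    repeat' first | assumption | exact one_mem _ | apply div_mem | apply add_mem |
      apply sub_mem | apply mul_mem | apply pow_mem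
  have hqI : ∀ (N : IntermediateField k M) {x : M}, x ∈ N → D.q x ∈ N := fun N x hx =>
    hqN N.toSubalgebra hx
  have hW₀I : ∀ N : IntermediateField k M, τ ∈ N → W₀ ∈ N := fun N hN => by
    have h1 := heI N
    have h2 := hx₀I N hN
    have h3 := secLine_mem h1 h2
    have h4 := secSlope_mem h1 h2
    have h5 := hqI N h2
    have h6 := hqI N (mul_mem (pow_mem h1 6) h2)
    have h7 := hqI N (mul_mem (pow_mem h1 12) h2)
    rw [hW₀, hV₀]
    repeat' first | assumption | exact ofNat_mem _ _ | apply div_mem | apply add_mem |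
      apply sub_mem | apply mul_mem | apply pow_mem
  have hF : ∀ N : IntermediateField k M, x ∈ N → τ ∈ N → W ∈ N →
      IntermediateField.adjoin k {x, y, z} ≤ N := by
    intro N hx hτN hWN
    have h1 := heI N
    have h2 : l ∈ N := hl' ▸ secLine_mem h1 hx
    have h3 : m ∈ N := hm ▸ secSlope_mem h1 hx
    have h4 : q₁ ∈ N := hq₁ ▸ hqI N hx
    have h5 : q₂ ∈ N := hq₂ ▸ hqI N (mul_mem (pow_mem h1 6) hx)
    have h6 : c₁ ∈ N := hc₁ ▸ hcN N.toSubalgebra hx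
    have hVW : V = W * l := by rw [hW, div_mul_cancel₀ _ hl0]
    have hy : y ∈ N := by
      rw [show y = (W * l - 2 * τ * m + q₁ + q₂ + τ ^ 2 * l ^ 2) / 2 by
        rw [← hVW, hV]; ring]
      repeat' first | assumption | exact ofNat_mem _ _ | apply div_mem | apply add_mem |
        apply sub_mem | apply mul_mem | apply pow_mem
    have hz : z ∈ N := by
      rw [show z = c₁ + ((y - q₁) * (y - q₂) / τ + m * (y - q₁)) / l by
        rw [← hτ]; field_simp; ring]
      repeat' first | assumption | apply div_mem | apply add_mem |
        apply sub_mem | apply mul_mem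
    rw [IntermediateField.adjoin_le_iff]
    rintro _ (rfl | rfl | rfl) <;> assumption
  have hxF : x ∈ IntermediateField.adjoin k {x, y, z} := IntermediateField.subset_adjoin _ _ (by simp)
  have hτF : τ ∈ IntermediateField.adjoin k {x, y, z} := by
    have hy : y ∈ IntermediateField.adjoin k {x, y, z} := IntermediateField.subset_adjoin _ _ (by simp)
    have hz : z ∈ IntermediateField.adjoin k {x, y, z} := IntermediateField.subset_adjoin _ _ (by simp)
    have h1 := heI (IntermediateField.adjoin k {x, y, z})
    rw [hτdef, hl', hm, hq₁, hq₂, hc₁]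
    have h2 := secLine_mem h1 hxF
    have h3 := secSlope_mem h1 hxF
    have h4 := hqI _ hxF
    have h5 := hqI _ (mul_mem (pow_mem h1 6) hxF)
    have h6 : D.c x ∈ IntermediateField.adjoin k {x, y, z} :=
      hcN (IntermediateField.adjoin k {x, y, z}).toSubalgebra hxF
    exact div_mem (mul_mem (sub_mem hy h4) (sub_mem hy h5)) (sub_mem (mul_mem h2 (sub_mem hz h6))
      (mul_mem h3 (sub_mem hy h4)))
  have hWF : W ∈ IntermediateField.adjoin k {x, y, z} := by
    have hy : y ∈ IntermediateField.adjoin k {x, y, z} := IntermediateField.subset_adjoin _ _ (by simp)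
    have h1 := heI (IntermediateField.adjoin k {x, y, z})
    rw [hW, hV, hl', hm, hq₁, hq₂]
    have h2 := secLine_mem h1 hxF
    have h3 := secSlope_mem h1 hxF
    have h4 := hqI _ hxF
    have h5 := hqI _ (mul_mem (pow_mem h1 6) hxF)
    repeat' first | assumption | exact ofNat_mem _ _ | apply div_mem | apply add_mem |
      apply sub_mem | apply mul_mem | apply pow_mem
  have hmain : ∀ θ ∈ IntermediateField.adjoin k {x, y, z},
      (∀ N : IntermediateField k M, τ ∈ N → θ ∈ N → x ∈ N ∧ W ∈ N) →
      ∃ s t : M, IntermediateField.adjoin k {s, t} = IntermediateField.adjoin k {x, y, z} := by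
    intro θ hθF hθ
    have hτN : τ ∈ IntermediateField.adjoin k {τ, θ} := IntermediateField.subset_adjoin _ _ (by simp)
    have hθN : θ ∈ IntermediateField.adjoin k {τ, θ} := IntermediateField.subset_adjoin _ _ (by simp)
    refine ⟨τ, θ, le_antisymm ?_ (hF _ (hθ _ hτN hθN).1 hτN (hθ _ hτN hθN).2)⟩
    rw [IntermediateField.adjoin_le_iff]
    rintro _ (rfl | rfl) <;> assumption
  have hW₀0 : W₀ ≠ 0 := by rw [hW₀]; exact div_ne_zero hV₀0 hl₀
  have hW₀F := hW₀I _ hτF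
  have hx₀F := hx₀I _ hτF
  by_cases hxx : x - x₀ = 0
  · refine hmain τ hτF fun N hN _ => ⟨sub_eq_zero.1 hxx ▸ hx₀I N hN, ?_⟩
    rw [hxx, zero_mul, sub_eq_zero, sq_eq_sq_iff_eq_or_eq_neg] at hsub
    rcases hsub with h | h
    · exact h ▸ hW₀I N hN
    · exact h ▸ neg_mem (hW₀I N hN)
  by_cases h1 : ((W - W₀) / (x - x₀)) ^ 2 - r₂ = 0
  · by_cases h2 : ((W - -W₀) / (x - x₀)) ^ 2 - r₂ = 0
    · have hW0 : W = 0 := by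
        have h : ((W - W₀) / (x - x₀)) ^ 2 = ((W - -W₀) / (x - x₀)) ^ 2 := by
          linear_combination h1 - h2
        rw [div_pow, div_pow, div_left_inj' (pow_ne_zero 2 hxx)] at h
        have : 4 * W₀ * W = 0 := by linear_combination -h
        simpa [hW₀0] using this
      exact hmain x hxF fun N _ hx => ⟨hx, hW0 ▸ zero_mem N⟩
    · refine hmain _ (div_mem (sub_mem hWF (neg_mem hW₀F)) (sub_mem hxF hx₀F)) fun N hN hθ =>
        mem_of_conic (hx₀I N hN) (neg_mem (hW₀I N hN)) hθ (hr₁I N hN) (hr₂I N hN) hxx ?_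
          (div_mul_cancel₀ _ hxx) h2
      rw [← hsub]; ring
  · exact hmain _ (div_mem (sub_mem hWF hW₀F) (sub_mem hxF hx₀F)) fun N hN hθ =>
      mem_of_conic (hx₀I N hN) (hW₀I N hN) hθ (hr₁I N hN) (hr₂I N hN) hxx hsub
        (div_mul_cancel₀ _ hxx) h1

end Rationality

section Generation

variable {k M : Type*} [Field k] [Field M] [Algebra k M]

lemma AlgebraicIndependent.two_le_trdeg {s t : M} (h : AlgebraicIndependent k ![s, t]) :
    2 ≤ Algebra.trdeg k M := by
  simpa using h.lift_cardinalMk_le_trdeg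

lemma algebraicIndependent_pair_of_trdeg (h2 : 2 ≤ Algebra.trdeg k M) {a b : M}
    (h : Algebra.IsAlgebraic (IntermediateField.adjoin k {a, b}) M) :
    AlgebraicIndependent k ![a, b] := by
  rw [IntermediateField.isAlgebraic_adjoin_iff_top] at h
  have hr : Set.range ![a, b] = {a, b} := by simp [Set.pair_comm]
  rw [← hr] at h
  exact (Algebra.IsAlgebraic.isTranscendenceBasis_of_lift_le_trdeg_of_finite k ![a, b]
    (by simpa using h2)).1

lemma algebraicIndependent_pair_of_top (h2 : 2 ≤ Algebra.trdeg k M) {a b : M}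
    (h : IntermediateField.adjoin k {a, b} = ⊤) : AlgebraicIndependent k ![a, b] := by
  refine algebraicIndependent_pair_of_trdeg h2 ⟨fun c => ?_⟩
  have hc : c ∈ IntermediateField.adjoin k {a, b} := h ▸ trivial
  exact isAlgebraic_algebraMap (⟨c, hc⟩ : IntermediateField.adjoin k {a, b})

lemma algebraicIndependent_pair_of_pow_mem (h2 : 2 ≤ Algebra.trdeg k M) {a b c : M}
    (h : IntermediateField.adjoin k {a, b, c} = ⊤) {n : ℕ} (hn : 0 < n)
    (hc : c ^ n ∈ IntermediateField.adjoin k {a, b}) : AlgebraicIndependent k ![a, b] := by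
  refine algebraicIndependent_pair_of_trdeg h2 ?_
  have hi : IsIntegral (IntermediateField.adjoin k {a, b}) c := by
    refine IsIntegral.of_pow hn ?_
    exact isIntegral_algebraMap (x := (⟨c ^ n, hc⟩ : IntermediateField.adjoin k {a, b}))
  have htop : IntermediateField.adjoin (IntermediateField.adjoin k {a, b}) {c} = ⊤ := by
    rw [← IntermediateField.restrictScalars_eq_top_iff (K := k),
      IntermediateField.adjoin_adjoin_left, ← h]
    congr 1
    ext
    simp only [Set.union_singleton, Set.mem_insert_iff, Set.mem_singleton_iff]
    tauto
  have := IntermediateField.isAlgebraic_adjoin (K := IntermediateField.adjoin k {a, b}) (S := {c})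
    (by rintro _ rfl; exact hi)
  rw [htop] at this
  refine ⟨fun m => ?_⟩
  exact IntermediateField.isAlgebraic_iff.1
    (this.isAlgebraic (⟨m, trivial⟩ : (⊤ : IntermediateField (IntermediateField.adjoin k {a, b}) M)))

/-- Evaluation of a polynomial in two variables. -/
def evalPair (t v : M) : Polynomial (Polynomial k) →+* M :=
  Polynomial.eval₂RingHom (Polynomial.aeval t).toRingHom v

@[simp] lemma evalPair_X (t v : M) : evalPair (k := k) t v Polynomial.X = v := by simp [evalPair]

@[simp] lemma evalPair_C (t v : M) (p : Polynomial k) :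
    evalPair t v (Polynomial.C p) = Polynomial.aeval t p := by simp [evalPair]

lemma evalPair_injective {t v : M} (h : AlgebraicIndependent k ![t, v]) :
    Function.Injective (evalPair (k := k) t v) := by
  have ht : Transcendental k t := h.transcendental 0
  have hv : Transcendental (Algebra.adjoin k {t}) v := by
    have h := h.transcendental_adjoin (s := {0}) (i := 1) (by simp)
    rw [Set.image_singleton] at h
    exact h
  rw [injective_iff_map_eq_zero]
  intro P hP
  let φ : Polynomial k →+* Algebra.adjoin k {t} :=
    ((Polynomial.aeval (⟨t, Algebra.self_mem_adjoin_singleton k t⟩ : Algebra.adjoin k {t})).toRingHom)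
  have hφ : ∀ p, (φ p : M) = Polynomial.aeval t p := fun p =>
    (Polynomial.aeval_algebraMap_apply M
      (⟨t, Algebra.self_mem_adjoin_singleton k t⟩ : Algebra.adjoin k {t}) p).symm
  have hinj : Function.Injective φ := by
    rw [injective_iff_map_eq_zero]
    intro p hp
    refine (transcendental_iff.1 ht) p ?_
    rw [← hφ, hp]; rfl
  have := (transcendental_iff.1 hv) (P.map φ) (by
    rw [Polynomial.aeval_def, Polynomial.eval₂_map, ← hP]
    simp only [evalPair, Polynomial.coe_eval₂RingHom]
    congr 1
    ext p <;> simp [hφ])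
  exact (Polynomial.map_eq_zero_iff hinj).1 this

lemma exists_eq_eval₂_div {t v w φ : M} (hφ : φ ∈ IntermediateField.adjoin k {t, v, w}) :
    ∃ P Q : Polynomial (Polynomial (Polynomial k)),
      φ = P.eval₂ (evalPair t v) w / Q.eval₂ (evalPair t v) w := by
  have key : ∀ r ∈ Algebra.adjoin k {t, v, w},
      ∃ P : Polynomial (Polynomial (Polynomial k)), r = P.eval₂ (evalPair t v) w := by
    intro r hr
    induction hr using Algebra.adjoin_induction with
    | mem r hr =>
      rcases hr with rfl | rfl | rfl
      · exact ⟨.C (.C .X), by simp⟩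
      · exact ⟨.C .X, by simp⟩
      · exact ⟨.X, by simp⟩
    | algebraMap c => exact ⟨.C (.C (.C c)), by simp⟩
    | add a b _ _ ha hb =>
      obtain ⟨P, rfl⟩ := ha
      obtain ⟨Q, rfl⟩ := hb
      exact ⟨P + Q, by rw [Polynomial.eval₂_add]⟩
    | mul a b _ _ ha hb =>
      obtain ⟨P, rfl⟩ := ha
      obtain ⟨Q, rfl⟩ := hb
      exact ⟨P * Q, by rw [Polynomial.eval₂_mul]⟩
  obtain ⟨r, hr, s, hs, rfl⟩ := IntermediateField.mem_adjoin_iff_div.1 hφ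
  obtain ⟨P, rfl⟩ := key r hr
  obtain ⟨Q, rfl⟩ := key s hs
  exact ⟨P, Q, rfl⟩

end Generation

section Core

variable {k E M : Type*} [Field k] [IsAlgClosed k] [Field E] [Field M] [Algebra k E] [Algebra E M]
  [Algebra k M] [IsScalarTower k E M]

lemma range_pair {α : Type*} (a b : α) : Set.range ![a, b] = {a, b} := by simp [Set.pair_comm]

open scoped WithZero in
/-- If `M = E(s, t)` with `s, t` invariant and `M = E(F)` for a rational `F / k`, then an
invariant element of `F` satisfying the value condition is a norm from `F` up to a constant. -/
theorem exists_eq_mul_cycNorm_of_mem {p : ℕ} (hp : p.Prime) (σ : M ≃+* M)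
    (hσ : ∀ a, σ^[p] a = a) (hE : ∀ e : E, ∃ e' : E, algebraMap E M e' = σ (algebraMap E M e))
    (hk : ∀ a : k, σ (algebraMap k M a) = algebraMap k M a)
    (h2 : 2 ≤ Algebra.trdeg E M) {s t : M} (hst : IntermediateField.adjoin E {s, t} = ⊤)
    (hs : σ s = s) (ht : σ t = t) {T : Set M} (hT : IntermediateField.adjoin E T = ⊤)
    {s' t' : M} (hst' : IntermediateField.adjoin k {s', t'} = IntermediateField.adjoin k T)
    (hσT : ∀ a ∈ T, σ a ∈ IntermediateField.adjoin k T)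
    {g : M} (hgT : g ∈ IntermediateField.adjoin k T) (hg0 : g ≠ 0) (hg : σ g = g)
    (hv : ∀ v : Valuation M ℤᵐ⁰, (∀ a, v (σ a) = v a) →
      (∀ e : E, e ≠ 0 → v (algebraMap E M e) = 1) → ∃ γ, v g = γ ^ p) :
    ∃ c : k, ∃ φ ∈ IntermediateField.adjoin k T, cycNorm p σ φ = algebraMap k M c * g ∧ c ≠ 0 := by
  obtain ⟨e, ψ, hgN⟩ := exists_eq_algebraMap_mul_cycNorm hp σ hσ hE
    (algebraicIndependent_pair_of_top h2 hst) (by rw [range_pair, hst])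
    (by intro j; fin_cases j <;> assumption) hg0 hg hv
  have htop : IntermediateField.adjoin E {s', t'} = ⊤ := by
    rw [eq_top_iff, ← hT, IntermediateField.adjoin_le_iff]
    intro a ha
    have h1 : a ∈ IntermediateField.adjoin k {s', t'} :=
      hst' ▸ IntermediateField.subset_adjoin _ _ ha
    have h2 : IntermediateField.adjoin k {s', t'}
        ≤ (IntermediateField.adjoin E {s', t'}).restrictScalars k := by
      rw [IntermediateField.adjoin_le_iff]
      exact IntermediateField.subset_adjoin _ _
    exact h2 h1
  have hF : ∀ a ∈ IntermediateField.adjoin k T, σ a ∈ IntermediateField.adjoin k T := by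
    let τ : M →ₐ[k] M := { σ.toRingHom with commutes' := hk }
    have : IntermediateField.adjoin k T ≤ (IntermediateField.adjoin k T).comap τ := by
      rw [IntermediateField.adjoin_le_iff]
      exact hσT
    exact this
  have hr : IntermediateField.adjoin k (Set.range ![s', t']) = IntermediateField.adjoin k T := by
    rw [range_pair, hst']
  obtain ⟨c, φ, hφ, hc⟩ := descend_cycNorm (k := k) hp σ hσ hE
    (algebraicIndependent_pair_of_top h2 htop) (by rw [range_pair, htop]) (by rw [hr]; exact hF)
    (by rw [hr]; exact hgT) hg0 hgN
  rw [hr] at hφ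
  have hc0 : c ≠ 0 := by
    rintro rfl
    simp [hg0] at hc
  refine ⟨c⁻¹, φ, hφ, ?_, inv_ne_zero hc0⟩
  rw [hc, ← mul_assoc, ← map_mul, inv_mul_cancel₀ hc0, map_one, one_mul]

end Core

namespace RatSection

section Polynomials

variable {k : Type*} [Field k] (D : RatSection k)

def qPoly : Polynomial k := .X ^ 2 + .X + .C D.q₀
def cPoly : Polynomial k := .X ^ 3 + .C D.c₂ * .X ^ 2 + .C D.c₁ * .X + .C D.c₀
def discrPoly : Polynomial k := .C D.A - .C D.B * .X ^ 5

lemma natDegree_discrPoly : D.discrPoly.natDegree = 5 := by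
  have hB : D.B ≠ 0 := D.B_ne_zero
  unfold discrPoly
  compute_degree!

lemma natDegree_qPoly : D.qPoly.natDegree = 2 := by
  unfold qPoly
  compute_degree!

lemma separable_discrPoly [CharZero k] : D.discrPoly.Separable := by
  have hA : D.A ≠ 0 := D.A_ne_zero
  refine ⟨.C D.A⁻¹, -.C (5⁻¹ * D.A⁻¹) * .X, ?_⟩
  have h1 : (Polynomial.C D.A⁻¹ * Polynomial.C D.A : Polynomial k) = 1 := by
    rw [← Polynomial.C_mul, inv_mul_cancel₀ hA, Polynomial.C_1]
  have h5 : (Polynomial.C (5⁻¹ : k) * 5 : Polynomial k) = 1 := by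
    rw [show (5 : Polynomial k) = Polynomial.C 5 from (map_ofNat Polynomial.C 5).symm,
      ← Polynomial.C_mul, inv_mul_cancel₀ (by norm_num), Polynomial.C_1]
  simp only [discrPoly, Polynomial.derivative_sub, Polynomial.derivative_C, Polynomial.derivative_mul,
    Polynomial.derivative_X_pow, Polynomial.C_mul]
  simp only [Nat.cast_ofNat, map_ofNat Polynomial.C, Nat.reduceSub, zero_mul, zero_sub, zero_add]
  linear_combination h1 + Polynomial.C D.A⁻¹ * Polynomial.C D.B * Polynomial.X ^ 5 * h5

lemma cPoly_sq : D.cPoly ^ 2 - D.discrPoly = D.qPoly ^ 3 := by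
  have h4 := congrArg (Polynomial.C : k → Polynomial k) D.coeff_four
  have h3 := congrArg (Polynomial.C : k → Polynomial k) D.coeff_three
  have h2 := congrArg (Polynomial.C : k → Polynomial k) D.coeff_two
  have h1 := congrArg (Polynomial.C : k → Polynomial k) D.coeff_one
  simp only [Polynomial.C_add, Polynomial.C_mul, Polynomial.C_pow, map_ofNat Polynomial.C,
    Polynomial.C_1] at h1 h2 h3 h4
  simp only [cPoly, discrPoly, qPoly, A, B, Polynomial.C_mul, Polynomial.C_sub,
    Polynomial.C_pow, map_ofNat Polynomial.C]
  linear_combination Polynomial.X ^ 4 * h4 + Polynomial.X ^ 3 * h3 + Polynomial.X ^ 2 * h2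
    + Polynomial.X * h1

/-- The branch polynomial of the projection forgetting `x`. -/
def branchPoly : Polynomial k := .X ^ 3 + .C D.A

def gZero : Polynomial k := .C D.γ * (.X - .C D.q₀) ^ 2 + .C D.δ * (.X - .C D.q₀) - .C (D.c₀ * D.β)
def gOne : Polynomial k := .X - .C D.q₀ + .C D.β

lemma natDegree_branchPoly : D.branchPoly.natDegree = 3 := by
  unfold branchPoly
  compute_degree!

lemma separable_branchPoly [CharZero k] : D.branchPoly.Separable := by
  have hA : D.A ≠ 0 := D.A_ne_zero
  refine ⟨.C D.A⁻¹, -.C (3⁻¹ * D.A⁻¹) * .X, ?_⟩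
  have h1 : (Polynomial.C D.A⁻¹ * Polynomial.C D.A : Polynomial k) = 1 := by
    rw [← Polynomial.C_mul, inv_mul_cancel₀ hA, Polynomial.C_1]
  have h3 : (Polynomial.C (3⁻¹ : k) * 3 : Polynomial k) = 1 := by
    rw [show (3 : Polynomial k) = Polynomial.C 3 from (map_ofNat Polynomial.C 3).symm,
      ← Polynomial.C_mul, inv_mul_cancel₀ (by norm_num), Polynomial.C_1]
  simp only [branchPoly, Polynomial.derivative_add, Polynomial.derivative_C,
    Polynomial.derivative_X_pow, Polynomial.C_mul]
  simp only [Nat.cast_ofNat, map_ofNat Polynomial.C, Nat.reduceSub, add_zero]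
  linear_combination h1 - Polynomial.C D.A⁻¹ * Polynomial.X ^ 3 * h3

lemma gOne_ne_zero : D.gOne ≠ 0 := by
  have : D.gOne.natDegree = 1 := by
    unfold gOne
    compute_degree!
  rintro h
  simp [h] at this

lemma gZero_sq : D.gZero ^ 2 - D.branchPoly * D.gOne ^ 2 = (-(.X - .C D.q₀)) ^ 5 := by
  have h4 := congrArg (Polynomial.C : k → Polynomial k) D.norm_four
  have h3 := congrArg (Polynomial.C : k → Polynomial k) D.norm_three
  have h2 := congrArg (Polynomial.C : k → Polynomial k) D.norm_two
  have h1 := congrArg (Polynomial.C : k → Polynomial k) D.norm_one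
  simp only [Polynomial.C_add, Polynomial.C_mul, Polynomial.C_pow, map_ofNat Polynomial.C,
    Polynomial.C_sub, Polynomial.C_0] at h1 h2 h3 h4
  obtain ⟨u, hu⟩ : ∃ u : Polynomial k, u = .X - .C D.q₀ := ⟨_, rfl⟩
  have hX : (.X : Polynomial k) = u + .C D.q₀ := by rw [hu]; ring
  simp only [gZero, gOne, branchPoly, A, Polynomial.C_mul, Polynomial.C_sub, Polynomial.C_pow, hX]
  linear_combination u ^ 4 * h4 + u ^ 3 * h3 + u ^ 2 * h2 - u * h1

end Polynomials

section Invariance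

variable {k M : Type*} [Field k] [Field M] [Algebra k M] (D : RatSection k) {σ : M ≃+* M}

lemma apply_q (hk : ∀ a : k, σ (algebraMap k M a) = algebraMap k M a) {x : M} : σ ((D.map (algebraMap k M)).q x) = (D.map (algebraMap k M)).q (σ x) := by
  simp [q, map, hk]

lemma apply_c (hk : ∀ a : k, σ (algebraMap k M a) = algebraMap k M a) {x : M} : σ ((D.map (algebraMap k M)).c x) = (D.map (algebraMap k M)).c (σ x) := by
  simp [c, map, hk]

lemma apply_g (hk : ∀ a : k, σ (algebraMap k M a) = algebraMap k M a) {x y z : M} : σ ((D.map (algebraMap k M)).g x y z)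
    = (D.map (algebraMap k M)).g (σ x) (σ y) (σ z) := by
  simp [g, map, hk]

lemma aeval_qPoly (x : M) : Polynomial.aeval x D.qPoly = (D.map (algebraMap k M)).q x := by
  simp [q, map, qPoly]

lemma aeval_cPoly (x : M) : Polynomial.aeval x D.cPoly = (D.map (algebraMap k M)).c x := by
  simp [c, map, cPoly]

lemma g_mem {N : Subalgebra k M} {x y z : M} (hx : x ∈ N) (hy : y ∈ N) (hz : z ∈ N) :
    (D.map (algebraMap k M)).g x y z ∈ N := by
  simp only [g, map]
  repeat' first | assumption | exact Subalgebra.algebraMap_mem _ _ | apply add_mem |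
    apply sub_mem | apply mul_mem | apply pow_mem

end Invariance

end RatSection

lemma evalPair_fixed {k M : Type*} [Field k] [Field M] [Algebra k M] {σ : M ≃+* M}
    (hk : ∀ a : k, σ (algebraMap k M a) = algebraMap k M a) {t v : M} (ht : σ t = t) (hv : σ v = v)
    (r : Polynomial (Polynomial k)) : σ (evalPair t v r) = evalPair t v r := by
  have h : (σ : M →+* M).comp (evalPair (k := k) t v) = evalPair t v := by
    ext <;> simp [hk, ht, hv]
  exact RingHom.congr_fun h r

lemma RatSection.separable_neg_discrPoly {k : Type*} [Field k] [CharZero k] (D : RatSection k) :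
    (-D.discrPoly).Separable := by
  have := IsCoprime.neg_neg D.separable_discrPoly
  rwa [← Polynomial.derivative_neg] at this

section Cases

variable {E M : Type*} [Field E] [Field M] [Algebra ℂ E] [Algebra E M]
  [Algebra ℂ M] [IsScalarTower ℂ E M]

lemma false_of_two (D : RatSection ℂ) (σ : M ≃+* M) (hσ : ∀ a, σ^[2] a = a)
    (hE : ∀ e : E, ∃ e' : E, algebraMap E M e' = σ (algebraMap E M e))
    (hk : ∀ a : ℂ, σ (algebraMap ℂ M a) = algebraMap ℂ M a)
    (h2 : 2 ≤ Algebra.trdeg E M) {s t : M} (hst : IntermediateField.adjoin E {s, t} = ⊤)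
    (hs : σ s = s) (ht : σ t = t) {x y z : M} (hT : IntermediateField.adjoin E {x, y, z} = ⊤)
    {s' t' : M} (hst' : IntermediateField.adjoin ℂ {s', t'} = IntermediateField.adjoin ℂ {x, y, z})
    (hD : z ^ 2 = y ^ 3 + (D.map (algebraMap ℂ M)).A - (D.map (algebraMap ℂ M)).B * x ^ 5)
    (hx : σ x = x) (hy : σ y = y) (hz : σ z = -z) : False := by
  have hind : AlgebraicIndependent ℂ ![x, y] := by
    refine (algebraicIndependent_pair_of_pow_mem h2 hT (n := 2) (by norm_num) ?_).restrictScalars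
      (algebraMap ℂ E).injective
    have hxm : x ∈ IntermediateField.adjoin E {x, y} := IntermediateField.subset_adjoin _ _ (by simp)
    have hym : y ∈ IntermediateField.adjoin E {x, y} := IntermediateField.subset_adjoin _ _ (by simp)
    have hcm : ∀ a : ℂ, algebraMap ℂ M a ∈ IntermediateField.adjoin E {x, y} := fun a => by
      rw [IsScalarTower.algebraMap_apply ℂ E M]
      exact IntermediateField.algebraMap_mem _ _
    rw [hD, RatSection.map_A, RatSection.map_B]
    exact sub_mem (add_mem (pow_mem hym 3) (hcm _)) (mul_mem (hcm _) (pow_mem hxm 5))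
  have hev := evalPair_injective hind
  have hxm : x ∈ IntermediateField.adjoin ℂ {x, y, z} := IntermediateField.subset_adjoin _ _ (by simp)
  have hym : y ∈ IntermediateField.adjoin ℂ {x, y, z} := IntermediateField.subset_adjoin _ _ (by simp)
  have hzm : z ∈ IntermediateField.adjoin ℂ {x, y, z} := IntermediateField.subset_adjoin _ _ (by simp)
  have hG : evalPair (k := ℂ) x y (.X - .C D.qPoly) = y - (D.map (algebraMap ℂ M)).q x := by
    rw [map_sub, evalPair_X, evalPair_C, D.aeval_qPoly]
  obtain ⟨c, φ, hφ, hc, hc0⟩ := exists_eq_mul_cycNorm_of_mem (k := ℂ) Nat.prime_two σ hσ hE hk h2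
    hst hs ht hT hst' (by
      rintro _ (rfl | rfl | rfl)
      · rwa [hx]
      · rwa [hy]
      · rw [hz]; exact neg_mem hzm)
    (g := y - (D.map (algebraMap ℂ M)).q x)
    (sub_mem hym (RatSection.q_mem (N := (IntermediateField.adjoin ℂ {x, y, z}).toSubalgebra) D hxm))
    (by
      rw [← hG, ne_eq, map_eq_zero_iff _ hev]
      exact Polynomial.X_sub_C_ne_zero _)
    (by rw [map_sub, D.apply_q hk, hx, hy]) (by
      intro v hvσ hvE
      refine (RatSection.trivial_map v D (algebraMap ℂ M) fun a ha => ?_).exists_sq_eq hD ?_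
      · rw [IsScalarTower.algebraMap_apply ℂ E M]
        exact hvE _ (by simpa using ha)
      · rw [← hvσ, map_add, hz, D.apply_c hk, hx, ← Valuation.map_neg, neg_add, neg_neg, sub_eq_add_neg])
  obtain ⟨a, d, hd, hdvd⟩ := exists_pow_modEq_of_cycNorm (evalPair (k := ℂ) x y) σ hev Nat.prime_two
    (ζ := -1) (w := z) (h := .X ^ 3 - .C (-D.discrPoly)) (IsPrimitiveRoot.neg_one 0 (by norm_num))
    (by
      rw [hD, map_sub, map_pow, evalPair_X, evalPair_C, map_neg, RatSection.map_A, RatSection.map_B]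
      simp only [RatSection.discrPoly, map_sub, map_mul, map_pow, Polynomial.aeval_C, Polynomial.aeval_X]
      ring)
    (prime_X_pow_sub_C Nat.prime_three (by
      rw [Polynomial.natDegree_neg, D.natDegree_discrPoly]; norm_num))
    (evalPair_fixed hk hx hy) (by simp [hz]) (exists_eq_eval₂_div hφ)
    (G := .C (.C c) * (.X - .C D.qPoly)) (by rw [hc, map_mul, hG, evalPair_C, Polynomial.aeval_C])
  exact not_dvd_mul_pow_two_sub (k := -D.discrPoly) D.separable_neg_discrPoly (by
      rw [Polynomial.natDegree_neg, D.natDegree_discrPoly]; norm_num) hc0 hd hdvd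

lemma false_of_three (D : RatSection ℂ) (σ : M ≃+* M) (hσ : ∀ a, σ^[3] a = a)
    (hE : ∀ e : E, ∃ e' : E, algebraMap E M e' = σ (algebraMap E M e))
    (hk : ∀ a : ℂ, σ (algebraMap ℂ M a) = algebraMap ℂ M a)
    (h2 : 2 ≤ Algebra.trdeg E M) {s t : M} (hst : IntermediateField.adjoin E {s, t} = ⊤)
    (hs : σ s = s) (ht : σ t = t) {x y z : M} (hT : IntermediateField.adjoin E {x, z, y} = ⊤)
    {s' t' : M} (hst' : IntermediateField.adjoin ℂ {s', t'} = IntermediateField.adjoin ℂ {x, z, y})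
    (hD : z ^ 2 = y ^ 3 + (D.map (algebraMap ℂ M)).A - (D.map (algebraMap ℂ M)).B * x ^ 5)
    {ω : ℂ} (hω : IsPrimitiveRoot ω 3)
    (hx : σ x = x) (hy : σ y = algebraMap ℂ M ω * y) (hz : σ z = z) : False := by
  have hD' : y ^ 3 = z ^ 2 - ((D.map (algebraMap ℂ M)).A - (D.map (algebraMap ℂ M)).B * x ^ 5) := by
    linear_combination -hD
  have hind : AlgebraicIndependent ℂ ![x, z] := by
    refine (algebraicIndependent_pair_of_pow_mem h2 hT (n := 3) (by norm_num) ?_).restrictScalars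
      (algebraMap ℂ E).injective
    have hxm : x ∈ IntermediateField.adjoin E {x, z} := IntermediateField.subset_adjoin _ _ (by simp)
    have hzm : z ∈ IntermediateField.adjoin E {x, z} := IntermediateField.subset_adjoin _ _ (by simp)
    have hcm : ∀ a : ℂ, algebraMap ℂ M a ∈ IntermediateField.adjoin E {x, z} := fun a => by
      rw [IsScalarTower.algebraMap_apply ℂ E M]
      exact IntermediateField.algebraMap_mem _ _
    rw [hD', RatSection.map_A, RatSection.map_B]
    exact sub_mem (pow_mem hzm 2) (sub_mem (hcm _) (mul_mem (hcm _) (pow_mem hxm 5)))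
  have hev := evalPair_injective hind
  have hxm : x ∈ IntermediateField.adjoin ℂ {x, z, y} := IntermediateField.subset_adjoin _ _ (by simp)
  have hym : y ∈ IntermediateField.adjoin ℂ {x, z, y} := IntermediateField.subset_adjoin _ _ (by simp)
  have hzm : z ∈ IntermediateField.adjoin ℂ {x, z, y} := IntermediateField.subset_adjoin _ _ (by simp)
  have hG : evalPair (k := ℂ) x z (.C (-D.cPoly) + .C 1 * .X) = z - (D.map (algebraMap ℂ M)).c x := by
    rw [map_add, map_mul, evalPair_X, evalPair_C, evalPair_C, map_neg, map_one, D.aeval_cPoly]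
    ring
  obtain ⟨c, φ, hφ, hc, hc0⟩ := exists_eq_mul_cycNorm_of_mem (k := ℂ) Nat.prime_three σ hσ hE hk h2
    hst hs ht hT hst' (by
      rintro _ (rfl | rfl | rfl)
      · rwa [hx]
      · rwa [hz]
      · rw [hy]; exact mul_mem (IntermediateField.algebraMap_mem _ _) hym)
    (g := z - (D.map (algebraMap ℂ M)).c x)
    (sub_mem hzm (RatSection.c_mem (N := (IntermediateField.adjoin ℂ {x, z, y}).toSubalgebra) D hxm))
    (by
      rw [← hG, ne_eq, map_eq_zero_iff _ hev]
      intro h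
      simpa using congrArg (fun p => p.coeff 1) h)
    (by rw [map_sub, D.apply_c hk, hx, hz]) (by
      intro v hvσ hvE
      have hv : ∀ a : ℂ, a ≠ 0 → v (algebraMap ℂ M a) = 1 := fun a ha => by
        rw [IsScalarTower.algebraMap_apply ℂ E M]
        exact hvE _ (by simpa using ha)
      have h3 : ω ^ 2 + ω + 1 = 0 := by
        have := hω.geom_sum_eq_zero (by norm_num)
        simp only [Finset.sum_range_succ, Finset.range_zero, Finset.sum_empty] at this
        linear_combination this
      have hy1 : v (algebraMap ℂ M ω * y - (D.map (algebraMap ℂ M)).q x)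
          = v (y - (D.map (algebraMap ℂ M)).q x) := by
        rw [← hvσ (y - _), map_sub σ, hy, D.apply_q hk, hx]
      refine (RatSection.trivial_map v D (algebraMap ℂ M) hv).exists_cube_eq (ω := algebraMap ℂ M ω)
        ?_ ?_ hD hy1 ?_
      · rw [← map_one (algebraMap ℂ M), ← map_sub]
        exact hv _ (sub_ne_zero.2 (hω.ne_one (by norm_num)).symm)
      · simpa using congrArg (algebraMap ℂ M) h3
      · rw [← hy1, ← hvσ (algebraMap ℂ M ω * y - _), map_sub σ, map_mul σ, hy, D.apply_q hk, hx, hk,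
          sq, mul_assoc])
  obtain ⟨a, d, hd, hdvd⟩ := exists_pow_modEq_of_cycNorm (evalPair (k := ℂ) x z) σ hev Nat.prime_three
    (ζ := .C (.C ω)) (w := y) (h := .X ^ 2 - .C D.discrPoly)
    ((hω.map_of_injective (f := Polynomial.C) Polynomial.C_injective).map_of_injective
      (f := Polynomial.C) Polynomial.C_injective)
    (by
      rw [hD', map_sub, map_pow, evalPair_X, evalPair_C, RatSection.map_A, RatSection.map_B]
      simp only [RatSection.discrPoly, map_sub, map_mul, map_pow, Polynomial.aeval_C, Polynomial.aeval_X])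
    (prime_X_pow_sub_C Nat.prime_two (by rw [D.natDegree_discrPoly]; norm_num))
    (evalPair_fixed hk hx hz) (by simp [hy]) (exists_eq_eval₂_div hφ)
    (G := .C (.C c) * (.C (-D.cPoly) + .C 1 * .X))
    (by rw [hc, map_mul, hG, evalPair_C, Polynomial.aeval_C])
  exact not_dvd_mul_pow_three_sub (q := D.qPoly) D.separable_discrPoly.squarefree
    (by rw [D.natDegree_discrPoly]; decide)
    (by rw [D.natDegree_discrPoly, D.natDegree_qPoly]; norm_num) one_ne_zero
    (by rw [← D.cPoly_sq]; ring) hc0 hd hdvd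

end Cases

lemma dvd_mul_pow_sub_of_dvd {R : Type*} [CommRing R] {h c g b d a : R} {n : ℕ}
    (H : h ∣ c * (g + b * h) * d ^ n - a ^ n) : h ∣ c * g * d ^ n - a ^ n := by
  have h' : h ∣ h * (c * b * d ^ n) := dvd_mul_right _ _
  have := dvd_sub H h'
  rwa [show c * (g + b * h) * d ^ n - a ^ n - h * (c * b * d ^ n) = c * g * d ^ n - a ^ n by ring] at this

section Cases

variable {E M : Type*} [Field E] [Field M] [Algebra ℂ E] [Algebra E M]
  [Algebra ℂ M] [IsScalarTower ℂ E M]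

lemma false_of_five (D : RatSection ℂ) (σ : M ≃+* M) (hσ : ∀ a, σ^[5] a = a)
    (hE : ∀ e : E, ∃ e' : E, algebraMap E M e' = σ (algebraMap E M e))
    (hk : ∀ a : ℂ, σ (algebraMap ℂ M a) = algebraMap ℂ M a)
    (h2 : 2 ≤ Algebra.trdeg E M) {s t : M} (hst : IntermediateField.adjoin E {s, t} = ⊤)
    (hs : σ s = s) (ht : σ t = t) {x y z : M} (hT : IntermediateField.adjoin E {y, z, x} = ⊤)
    {s' t' : M} (hst' : IntermediateField.adjoin ℂ {s', t'} = IntermediateField.adjoin ℂ {y, z, x})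
    (hD : z ^ 2 = y ^ 3 + (D.map (algebraMap ℂ M)).A - (D.map (algebraMap ℂ M)).B * x ^ 5)
    {ζ : ℂ} (hζ : IsPrimitiveRoot ζ 5)
    (hx : σ x = algebraMap ℂ M ζ * x) (hy : σ y = y) (hz : σ z = z) : False := by
  have hB : D.B ≠ 0 := D.B_ne_zero
  obtain ⟨b, hb⟩ : ∃ b : ℂ, b ^ 5 = -D.B := IsAlgClosed.exists_pow_nat_eq _ (by norm_num)
  have hbx : (algebraMap ℂ M b * x) ^ 5 = z ^ 2 - (y ^ 3 + algebraMap ℂ M D.A) := by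
    rw [hD, mul_pow, ← map_pow, hb, RatSection.map_A, RatSection.map_B, map_neg]
    ring
  have hx5 : x ^ 5 = algebraMap ℂ M (-D.B⁻¹) * (z ^ 2 - (y ^ 3 + algebraMap ℂ M D.A)) := by
    rw [← hbx, mul_pow, ← map_pow, hb, ← mul_assoc, ← map_mul, neg_mul_neg, inv_mul_cancel₀ hB,
      map_one, one_mul]
  have hind : AlgebraicIndependent ℂ ![y, z] := by
    refine (algebraicIndependent_pair_of_pow_mem h2 hT (n := 5) (by norm_num) ?_).restrictScalars
      (algebraMap ℂ E).injective
    have hym : y ∈ IntermediateField.adjoin E {y, z} := IntermediateField.subset_adjoin _ _ (by simp)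
    have hzm : z ∈ IntermediateField.adjoin E {y, z} := IntermediateField.subset_adjoin _ _ (by simp)
    have hcm : ∀ a : ℂ, algebraMap ℂ M a ∈ IntermediateField.adjoin E {y, z} := fun a => by
      rw [IsScalarTower.algebraMap_apply ℂ E M]
      exact IntermediateField.algebraMap_mem _ _
    rw [hx5]
    exact mul_mem (hcm _) (sub_mem (pow_mem hzm 2) (add_mem (pow_mem hym 3) (hcm _)))
  have hev := evalPair_injective hind
  have hxm : x ∈ IntermediateField.adjoin ℂ {y, z, x} := IntermediateField.subset_adjoin _ _ (by simp)
  have hym : y ∈ IntermediateField.adjoin ℂ {y, z, x} := IntermediateField.subset_adjoin _ _ (by simp)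
  have hzm : z ∈ IntermediateField.adjoin ℂ {y, z, x} := IntermediateField.subset_adjoin _ _ (by simp)
  have hh : evalPair (k := ℂ) y z (.X ^ 2 - .C D.branchPoly) = z ^ 2 - (y ^ 3 + algebraMap ℂ M D.A) := by
    rw [map_sub, map_pow, evalPair_X, evalPair_C]
    simp [RatSection.branchPoly]
  have hG : evalPair (k := ℂ) y z (.C D.gZero + .C D.gOne * .X
      + .C (.C D.B⁻¹) * (.X ^ 2 - .C D.branchPoly)) = (D.map (algebraMap ℂ M)).g x y z := by
    rw [map_add, map_add, map_mul, map_mul, hh, evalPair_X, evalPair_C, evalPair_C, evalPair_C,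
      RatSection.g, hx5]
    simp only [RatSection.gZero, RatSection.gOne, RatSection.map, map_add, map_sub, map_mul, map_pow,
      Polynomial.aeval_C, Polynomial.aeval_X, map_neg]
    ring
  have hprime : Prime (.X ^ 2 - .C D.branchPoly : Polynomial (Polynomial ℂ)) :=
    prime_X_pow_sub_C Nat.prime_two (by rw [D.natDegree_branchPoly]; norm_num)
  obtain ⟨c, φ, hφ, hc, hc0⟩ := exists_eq_mul_cycNorm_of_mem (k := ℂ) Nat.prime_five σ hσ hE hk h2
    hst hs ht hT hst' (by
      rintro _ (rfl | rfl | rfl)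
      · rwa [hy]
      · rwa [hz]
      · rw [hx]; exact mul_mem (IntermediateField.algebraMap_mem _ _) hxm)
    (g := (D.map (algebraMap ℂ M)).g x y z)
    (RatSection.g_mem (N := (IntermediateField.adjoin ℂ {y, z, x}).toSubalgebra) D hxm hym hzm)
    (by
      rw [← hG, ne_eq, map_eq_zero_iff _ hev]
      intro h
      refine D.gOne_ne_zero ?_
      simpa [Polynomial.coeff_X, Polynomial.coeff_C] using congrArg (fun p => p.coeff 1) h)
    (by
      rw [D.apply_g hk, hx, hy, hz]
      simp only [RatSection.g]
      rw [mul_pow, ← map_pow, hζ.pow_eq_one, map_one, one_mul]) (by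
      intro v hvσ hvE
      have hv : ∀ a : ℂ, a ≠ 0 → v (algebraMap ℂ M a) = 1 := fun a ha => by
        rw [IsScalarTower.algebraMap_apply ℂ E M]
        exact hvE _ (by simpa using ha)
      have h5 : ζ ^ 4 + ζ ^ 3 + ζ ^ 2 + ζ + 1 = 0 := by
        have := hζ.geom_sum_eq_zero (by norm_num)
        simp only [Finset.sum_range_succ, Finset.range_zero, Finset.sum_empty] at this
        linear_combination this
      have hstep : ∀ w : M, v (y - (D.map (algebraMap ℂ M)).q (σ w))
          = v (y - (D.map (algebraMap ℂ M)).q w) := fun w => by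
        rw [← hvσ (y - (D.map (algebraMap ℂ M)).q w), map_sub σ, hy, D.apply_q hk]
      have hi : ∀ n : ℕ, v (y - (D.map (algebraMap ℂ M)).q (algebraMap ℂ M ζ ^ n * x))
          = v (y - (D.map (algebraMap ℂ M)).q x) := fun n => by
        induction n with
        | zero => rw [pow_zero, one_mul]
        | succ n ih =>
          rw [← ih, ← hstep (_ ^ n * x), map_mul, map_pow, hk, hx, pow_succ, mul_assoc]
      refine (RatSection.trivial_map v D (algebraMap ℂ M) hv).exists_fifth_eq (ζ := algebraMap ℂ M ζ)
        ?_ ?_ hD (by simpa using hi 1) (hi 2) (hi 3) (hi 4)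
      · rw [← map_one (algebraMap ℂ M), ← map_sub]
        exact hv _ (sub_ne_zero.2 (hζ.ne_one (by norm_num)).symm)
      · simpa using congrArg (algebraMap ℂ M) h5)
  obtain ⟨a, d, hd, hdvd⟩ := exists_pow_modEq_of_cycNorm (evalPair (k := ℂ) y z) σ hev Nat.prime_five
    (ζ := .C (.C ζ)) (w := algebraMap ℂ M b * x) (h := .X ^ 2 - .C D.branchPoly)
    ((hζ.map_of_injective (f := Polynomial.C) Polynomial.C_injective).map_of_injective
      (f := Polynomial.C) Polynomial.C_injective)
    (by rw [hbx, hh]) hprime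
    (evalPair_fixed hk hy hz) (by
      rw [map_mul, hk, hx, evalPair_C, Polynomial.aeval_C]; ring) (exists_eq_eval₂_div (by
        have : algebraMap ℂ M b * x ∈ IntermediateField.adjoin ℂ {y, z, algebraMap ℂ M b * x} :=
          IntermediateField.subset_adjoin _ _ (by simp)
        have hb0 : b ≠ 0 := by
          rintro rfl
          exact hB (by simpa using hb)
        have hle : IntermediateField.adjoin ℂ {y, z, x}
            ≤ IntermediateField.adjoin ℂ {y, z, algebraMap ℂ M b * x} := by
          rw [IntermediateField.adjoin_le_iff]
          rintro _ (rfl | rfl | rfl)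
          · exact IntermediateField.subset_adjoin _ _ (by simp)
          · exact IntermediateField.subset_adjoin _ _ (by simp)
          · have h := mul_mem (IntermediateField.algebraMap_mem _ b⁻¹) this
            rwa [← mul_assoc, ← map_mul, inv_mul_cancel₀ hb0, map_one, one_mul] at h
        exact hle hφ))
    (G := .C (.C c) * (.C D.gZero + .C D.gOne * .X
      + .C (.C D.B⁻¹) * (.X ^ 2 - .C D.branchPoly)))
    (by rw [hc, map_mul, hG, evalPair_C, Polynomial.aeval_C])
  have hq : (-(.X - .C D.q₀) : Polynomial ℂ).natDegree < D.branchPoly.natDegree := by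
    rw [D.natDegree_branchPoly, Polynomial.natDegree_neg, Polynomial.natDegree_X_sub_C]
    norm_num
  have hodd : Odd D.branchPoly.natDegree := by
    rw [D.natDegree_branchPoly]; exact ⟨1, rfl⟩
  exact not_dvd_mul_pow_five_sub D.separable_branchPoly.squarefree hodd hq D.gOne_ne_zero D.gZero_sq
    hc0 hd (dvd_mul_pow_sub_of_dvd hdvd)

end Cases

lemma MvPolynomial.exists_pow_eq_of_fractionRing {ι K : Type*} [Field K] {n : ℕ} (hn : 0 < n) {f : K}
    (hf : f ≠ 0) {a : FractionRing (MvPolynomial ι K)} (ha : a ^ n = algebraMap K _ f) :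
    ∃ c : K, algebraMap K _ c = a := by
  have hi : IsIntegral (MvPolynomial ι K) (a ^ n) := by
    rw [ha, IsScalarTower.algebraMap_apply K (MvPolynomial ι K)]
    exact isIntegral_algebraMap
  obtain ⟨p, rfl⟩ := IsIntegrallyClosed.isIntegral_iff.1 (hi.of_pow hn)
  have hp : p ^ n = C f := by
    refine IsFractionRing.injective (MvPolynomial ι K) (FractionRing (MvPolynomial ι K)) ?_
    rw [map_pow, ha, IsScalarTower.algebraMap_apply K (MvPolynomial ι K), MvPolynomial.algebraMap_eq]
  have hu : IsUnit p := by
    rw [← isUnit_pow_iff hn.ne', hp]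
    exact hf.isUnit.map C
  obtain ⟨c, -, rfl⟩ := MvPolynomial.isUnit_iff_eq_C_of_isReduced.1 hu
  exact ⟨c, by rw [IsScalarTower.algebraMap_apply K (MvPolynomial ι K), MvPolynomial.algebraMap_eq]⟩

lemma exists_pow_eq_of_adjoin_pair {K L : Type*} [Field K] [Field L] [Algebra K L] {s t : L}
    (hind : AlgebraicIndependent K ![s, t]) (hst : IntermediateField.adjoin K {s, t} = ⊤) {n : ℕ}
    (hn : 0 < n) {f : K} (hf : f ≠ 0) {a : L} (ha : a ^ n = algebraMap K L f) :
    ∃ c : K, c ^ n = f := by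
  have hm : a ∈ IntermediateField.adjoin K (Set.range ![s, t]) := by
    rw [show Set.range ![s, t] = {s, t} by simp [Set.pair_comm], hst]
    trivial
  obtain ⟨c, hc⟩ := MvPolynomial.exists_pow_eq_of_fractionRing hn hf
    (a := hind.reprField ⟨a, hm⟩) (by
      rw [← map_pow, ← AlgHom.commutes hind.reprField]
      exact congrArg _ (Subtype.ext ha))
  refine ⟨c, (algebraMap K (FractionRing (MvPolynomial (Fin 2) K))).injective ?_⟩
  rw [map_pow, hc, ← map_pow, ← AlgHom.commutes hind.reprField]
  exact congrArg _ (Subtype.ext ha)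

lemma exists_root_cyclotomic_fifteen :
    ∃ ξ : ℂ, ξ ^ 8 - ξ ^ 7 + ξ ^ 5 - ξ ^ 4 + ξ ^ 3 - ξ + 1 = 0 := by
  have hξ := Complex.isPrimitiveRoot_exp 15 (by norm_num)
  set ξ := Complex.exp (2 * Real.pi * Complex.I / (15 : ℕ))
  have h3 : ξ ^ 2 + ξ + 1 ≠ 0 := fun h =>
    hξ.pow_ne_one_of_pos_of_lt (l := 3) (by norm_num) (by norm_num) (by linear_combination (ξ - 1) * h)
  have h5 : ξ ^ 5 - 1 ≠ 0 := fun h =>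
    hξ.pow_ne_one_of_pos_of_lt (l := 5) (by norm_num) (by norm_num) (by linear_combination h)
  refine ⟨ξ, mul_left_cancel₀ (mul_ne_zero h3 h5) ?_⟩
  linear_combination hξ.pow_eq_one

lemma exists_scale_eq_ratSection {M : Type*} [Field M] [Algebra ℂ M] (D : RatSection ℂ) {x y z ρ : M}
    (hρ : ρ ≠ 0) (h : x ^ 5 + y ^ 3 + z ^ 2 = ρ ^ 30) :
    ∃ α β γ : ℂ, α ≠ 0 ∧ β ≠ 0 ∧ γ ≠ 0 ∧ (algebraMap ℂ M γ * (z / ρ ^ 15)) ^ 2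
      = (algebraMap ℂ M β * (y / ρ ^ 10)) ^ 3 + algebraMap ℂ M D.A
        - algebraMap ℂ M D.B * (algebraMap ℂ M α * (x / ρ ^ 6)) ^ 5 := by
  have hA : D.A ≠ 0 := D.A_ne_zero
  have hB : D.B ≠ 0 := D.B_ne_zero
  obtain ⟨α, hα⟩ := IsAlgClosed.exists_pow_nat_eq (D.A / D.B) (n := 5) (by norm_num)
  obtain ⟨β, hβ⟩ := IsAlgClosed.exists_pow_nat_eq (-D.A) (n := 3) (by norm_num)
  obtain ⟨γ, hγ⟩ := IsAlgClosed.exists_pow_nat_eq D.A (n := 2) (by norm_num)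
  refine ⟨α, β, γ, ?_, ?_, ?_, ?_⟩
  · rintro rfl
    exact div_ne_zero hA hB (by rw [← hα]; norm_num)
  · rintro rfl
    exact neg_ne_zero.2 hA (by rw [← hβ]; norm_num)
  · rintro rfl
    exact hA (by rw [← hγ]; norm_num)
  · have hαB : algebraMap ℂ M D.B * algebraMap ℂ M α ^ 5 = algebraMap ℂ M D.A := by
      rw [← map_pow, hα, ← map_mul, mul_div_cancel₀ _ hB]
    have hβ' : algebraMap ℂ M β ^ 3 = -algebraMap ℂ M D.A := by rw [← map_pow, hβ, map_neg]
    have hγ' : algebraMap ℂ M γ ^ 2 = algebraMap ℂ M D.A := by rw [← map_pow, hγ]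
    have h1 : (x / ρ ^ 6) ^ 5 + (y / ρ ^ 10) ^ 3 + (z / ρ ^ 15) ^ 2 = 1 := by
      simp only [div_pow, ← pow_mul]
      norm_num
      rw [← add_div, ← add_div, h, div_self (pow_ne_zero _ hρ)]
    linear_combination (z / ρ ^ 15) ^ 2 * hγ' - (y / ρ ^ 10) ^ 3 * hβ' + (x / ρ ^ 6) ^ 5 * hαB
      + algebraMap ℂ M D.A * h1

lemma adjoin_eq_top_of_mul {E M : Type*} [Field E] [Field M] [Algebra E M] {x y z X Y Z : M}
    (h : IntermediateField.adjoin E {x, y, z} = ⊤) {a b c : E} (hx : x = algebraMap E M a * X)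
    (hy : y = algebraMap E M b * Y) (hz : z = algebraMap E M c * Z) :
    IntermediateField.adjoin E {X, Y, Z} = ⊤ := by
  rw [← top_le_iff, ← h, IntermediateField.adjoin_le_iff]
  rintro _ (rfl | rfl | rfl)
  · rw [hx]
    exact mul_mem (IntermediateField.algebraMap_mem _ _) (IntermediateField.subset_adjoin _ _ (by simp))
  · rw [hy]
    exact mul_mem (IntermediateField.algebraMap_mem _ _) (IntermediateField.subset_adjoin _ _ (by simp))
  · rw [hz]
    exact mul_mem (IntermediateField.algebraMap_mem _ _) (IntermediateField.subset_adjoin _ _ (by simp))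

lemma algebraicIndependent_of_ratSection {E M : Type*} [Field E] [Field M] [Algebra ℂ E] [Algebra E M]
    [Algebra ℂ M] [IsScalarTower ℂ E M] (h2 : 2 ≤ Algebra.trdeg E M) {x y z : M} {a b : ℂ}
    (hT : IntermediateField.adjoin E {x, y, z} = ⊤)
    (hD : z ^ 2 = y ^ 3 + algebraMap ℂ M a - algebraMap ℂ M b * x ^ 5) :
    AlgebraicIndependent ℂ ![x, y] := by
  refine (algebraicIndependent_pair_of_pow_mem h2 hT (n := 2) (by norm_num) ?_).restrictScalars
    (algebraMap ℂ E).injective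
  have hxm : x ∈ IntermediateField.adjoin E {x, y} := IntermediateField.subset_adjoin _ _ (by simp)
  have hym : y ∈ IntermediateField.adjoin E {x, y} := IntermediateField.subset_adjoin _ _ (by simp)
  have hcm : ∀ a : ℂ, algebraMap ℂ M a ∈ IntermediateField.adjoin E {x, y} := fun a => by
    rw [IsScalarTower.algebraMap_apply ℂ E M]
    exact IntermediateField.algebraMap_mem _ _
  rw [hD]
  exact sub_mem (add_mem (pow_mem hym 3) (hcm _)) (mul_mem (hcm _) (pow_mem hxm 5))

section Model

variable {E M : Type*} [Field E] [Field M] [Algebra ℂ E] [Algebra E M]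
  [Algebra ℂ M] [IsScalarTower ℂ E M]

lemma exists_rational_model (h2 : 2 ≤ Algebra.trdeg E M) {x y z : M} {e : E} (he : e ≠ 0)
    (h : x ^ 5 + y ^ 3 + z ^ 2 = algebraMap E M e ^ 30)
    (hT : IntermediateField.adjoin E {x, y, z} = ⊤) :
    ∃ (D : RatSection ℂ) (α β γ : ℂ) (X Y Z s t : M),
      X = algebraMap ℂ M α * (x / algebraMap E M e ^ 6) ∧
      Y = algebraMap ℂ M β * (y / algebraMap E M e ^ 10) ∧
      Z = algebraMap ℂ M γ * (z / algebraMap E M e ^ 15) ∧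
      IntermediateField.adjoin E {X, Y, Z} = ⊤ ∧
      IntermediateField.adjoin ℂ {s, t} = IntermediateField.adjoin ℂ {X, Y, Z} ∧
      Z ^ 2 = Y ^ 3 + (D.map (algebraMap ℂ M)).A - (D.map (algebraMap ℂ M)).B * X ^ 5 := by
  have hρ : algebraMap E M e ≠ 0 := by simpa using he
  obtain ⟨ξ, hξ⟩ := exists_root_cyclotomic_fifteen
  obtain ⟨α, β, γ, hα, hβ, hγ, hD⟩ := exists_scale_eq_ratSection (ratSectionOfRoot ξ hξ) hρ h
  have hmul : ∀ (w : M) (δ : ℂ) (n : ℕ), δ ≠ 0 →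
      w = algebraMap E M (e ^ n / algebraMap ℂ E δ) * (algebraMap ℂ M δ * (w / algebraMap E M e ^ n)) := by
    intro w δ n hδ
    have hδ' : algebraMap ℂ M δ ≠ 0 := by simpa using hδ
    rw [map_div₀, map_pow, ← IsScalarTower.algebraMap_apply ℂ E M]
    field_simp
  have hT' := adjoin_eq_top_of_mul hT (hmul x α 6 hα) (hmul y β 10 hβ) (hmul z γ 15 hγ)
  obtain ⟨s, t, hst⟩ := exists_adjoin_pair_eq hξ (algebraicIndependent_of_ratSection h2 hT' hD) hD
  exact ⟨ratSectionOfRoot ξ hξ, α, β, γ, _, _, _, s, t, rfl, rfl, rfl, hT', hst, by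
    rw [hD, RatSection.map_A, RatSection.map_B]⟩

lemma exists_adjoin_pair_eq_top (h2 : 2 ≤ Algebra.trdeg E M) {x y z : M} {e : E} (he : e ≠ 0)
    (h : x ^ 5 + y ^ 3 + z ^ 2 = algebraMap E M e ^ 30)
    (hT : IntermediateField.adjoin E {x, y, z} = ⊤) :
    ∃ s t : M, IntermediateField.adjoin E {s, t} = ⊤ := by
  obtain ⟨-, -, -, -, X, Y, Z, s, t, -, -, -, hT', hst, -⟩ := exists_rational_model h2 he h hT
  refine ⟨s, t, ?_⟩
  rw [← top_le_iff, ← hT', IntermediateField.adjoin_le_iff]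
  have hle : IntermediateField.adjoin ℂ {s, t}
      ≤ (IntermediateField.adjoin E {s, t}).restrictScalars ℂ := by
    rw [IntermediateField.adjoin_le_iff]
    exact IntermediateField.subset_adjoin E {s, t}
  rw [hst] at hle
  exact fun a ha => hle (IntermediateField.subset_adjoin ℂ _ ha)

lemma false_of_primitiveRoot (σ : M ≃+* M) {p : ℕ} (hp : p = 2 ∨ p = 3 ∨ p = 5)
    (hσ : ∀ a, σ^[p] a = a) (hE : ∀ e : E, ∃ e' : E, algebraMap E M e' = σ (algebraMap E M e))
    (hk : ∀ a : ℂ, σ (algebraMap ℂ M a) = algebraMap ℂ M a)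
    (h2 : 2 ≤ Algebra.trdeg E M) {s t : M} (hst : IntermediateField.adjoin E {s, t} = ⊤)
    (hs : σ s = s) (ht : σ t = t) {x y z : M} {e : E} (he : e ≠ 0)
    (h : x ^ 5 + y ^ 3 + z ^ 2 = algebraMap E M e ^ 30)
    (hT : IntermediateField.adjoin E {x, y, z} = ⊤)
    (hx : σ x = x) (hy : σ y = y) (hz : σ z = z) {ζ : ℂ} (hζ : IsPrimitiveRoot ζ p)
    (hρ : σ (algebraMap E M e) = algebraMap ℂ M ζ * algebraMap E M e) : False := by
  obtain ⟨D, α, β, γ, X, Y, Z, s', t', rfl, rfl, rfl, hT', hst', hD⟩ := exists_rational_model h2 he h hT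
  have hmul : ∀ (w : M) (δ : ℂ) (n : ℕ), σ w = w →
      σ (algebraMap ℂ M δ * (w / algebraMap E M e ^ n))
        = algebraMap ℂ M ((ζ ^ n)⁻¹) * (algebraMap ℂ M δ * (w / algebraMap E M e ^ n)) := by
    intro w δ n hw
    rw [map_mul, map_div₀, map_pow, hρ, hk, hw, map_inv₀, map_pow, mul_pow]
    field_simp
  have hfix : ∀ (w : M) (δ : ℂ) (n : ℕ), σ w = w → p ∣ n →
      σ (algebraMap ℂ M δ * (w / algebraMap E M e ^ n))
        = algebraMap ℂ M δ * (w / algebraMap E M e ^ n) := by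
    intro w δ n hw hn
    rw [hmul w δ n hw, (hζ.pow_eq_one_iff_dvd n).2 hn, inv_one, map_one, one_mul]
  have hprim : ∀ n : ℕ, n.Coprime p → IsPrimitiveRoot ((ζ ^ n)⁻¹) p := fun n hn =>
    (hζ.pow_of_coprime n hn).inv
  obtain rfl | rfl | rfl := hp
  · refine false_of_two D σ hσ hE hk h2 hst hs ht hT' hst' hD (hfix _ _ _ hx (by norm_num))
      (hfix _ _ _ hy (by norm_num)) ?_
    rw [hmul _ _ _ hz, (hprim 15 (by norm_num)).eq_neg_one_of_two_right, map_neg, map_one, neg_one_mul]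
  · rw [show ∀ a b c : M, ({a, b, c} : Set M) = {a, c, b} from fun a b c => by
      rw [Set.pair_comm]] at hT' hst'
    exact false_of_three D σ hσ hE hk h2 hst hs ht hT' hst' hD (hprim 10 (by norm_num))
      (hfix _ _ _ hx (by norm_num)) (hmul _ _ _ hy) (hfix _ _ _ hz (by norm_num))
  · rw [show ∀ a b c : M, ({a, b, c} : Set M) = {b, c, a} from fun a b c => by
      rw [Set.insert_comm, Set.pair_comm a c]] at hT' hst'
    exact false_of_five D σ hσ hE hk h2 hst hs ht hT' hst' hD (hprim 6 (by norm_num))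
      (hmul _ _ _ hx) (hfix _ _ _ hy (by norm_num)) (hfix _ _ _ hz (by norm_num))

end Model

section Tower

variable {K L M : Type*} [Field K] [Field L] [Field M] [Algebra K L] [Algebra L M] [Algebra K M]
  [IsScalarTower K L M]

lemma adjoin_image_eq_top {S : Set L} (hS : IntermediateField.adjoin K S = ⊤) {ρ : M}
    (hρ : IntermediateField.adjoin L {ρ} = ⊤) (E : IntermediateField K M) (hE : ρ ∈ E) :
    IntermediateField.adjoin E (algebraMap L M '' S) = ⊤ := by
  have hL : ∀ l : L, algebraMap L M l ∈ IntermediateField.adjoin E (algebraMap L M '' S) := by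
    have hle : IntermediateField.adjoin K S ≤ ((IntermediateField.adjoin E
        (algebraMap L M '' S)).restrictScalars K).comap (IsScalarTower.toAlgHom K L M) := by
      rw [IntermediateField.adjoin_le_iff]
      exact fun a ha => IntermediateField.subset_adjoin E _ (Set.mem_image_of_mem _ ha)
    exact fun l => hle (hS ▸ trivial)
  let N : IntermediateField L M :=
    (IntermediateField.adjoin E (algebraMap L M '' S)).toSubfield.toIntermediateField hL
  have hN : N = ⊤ := by
    rw [← top_le_iff, ← hρ, IntermediateField.adjoin_le_iff, Set.singleton_subset_iff]
    exact (IntermediateField.adjoin E (algebraMap L M '' S)).algebraMap_mem ⟨ρ, hE⟩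
  rw [← top_le_iff]
  exact fun m _ => (hN ▸ trivial : m ∈ N)

variable [Algebra ℂ K] [Algebra ℂ L] [Algebra ℂ M] [IsScalarTower ℂ K M]
  [IsScalarTower ℂ L M]

lemma false_of_algEquiv (σ : M ≃ₐ[L] M) {p : ℕ} (hp : p = 2 ∨ p = 3 ∨ p = 5) {f : K} (hf : f ≠ 0)
    {x y z s t : L} (h : x ^ 5 + y ^ 3 + z ^ 2 = algebraMap K L f) (h2 : 2 ≤ Algebra.trdeg K L)
    (hT : IntermediateField.adjoin K {x, y, z} = ⊤) (hst : IntermediateField.adjoin K {s, t} = ⊤)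
    {ρ : M} (hρ : ρ ^ 30 = algebraMap K M f) (hρM : IntermediateField.adjoin L {ρ} = ⊤) {ζ : ℂ}
    (hζ : IsPrimitiveRoot ζ p) (hσρ : σ ρ = algebraMap ℂ M ζ * ρ) : False := by
  have hk : ∀ a : ℂ, σ (algebraMap ℂ M a) = algebraMap ℂ M a := fun a => by
    rw [IsScalarTower.algebraMap_apply ℂ L M, σ.commutes]
  have hpow : ∀ n : ℕ, σ^[n] ρ = algebraMap ℂ M ζ ^ n * ρ := fun n => by
    induction n with
    | zero => simp
    | succ n ih => rw [Function.iterate_succ_apply', ih, map_mul, map_pow, hk, hσρ, pow_succ, mul_assoc]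
  have hσ : ∀ a, σ^[p] a = a := fun a => by
    rw [← AlgEquiv.coe_pow]
    have ha : a ∈ IntermediateField.adjoin L {ρ} := hρM ▸ trivial
    induction ha using IntermediateField.adjoin_induction with
    | mem b hb =>
      obtain rfl := hb
      rw [AlgEquiv.coe_pow, hpow, ← map_pow, hζ.pow_eq_one, map_one, one_mul]
    | algebraMap b => exact AlgEquiv.commutes _ _
    | add b c _ _ hb hc => rw [map_add, hb, hc]
    | inv b _ hb => rw [map_inv₀, hb]
    | mul b c _ _ hb hc => rw [map_mul, hb, hc]
  have hρE : ρ ∈ IntermediateField.adjoin K {ρ} := IntermediateField.mem_adjoin_simple_self K ρ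
  have hρi : IsIntegral K ρ := .of_pow (n := 30) (by norm_num) (hρ ▸ isIntegral_algebraMap)
  have : Algebra.IsAlgebraic K (IntermediateField.adjoin K {ρ}) :=
    IntermediateField.isAlgebraic_adjoin_simple hρi
  have hind : AlgebraicIndependent (IntermediateField.adjoin K {ρ})
      ![algebraMap L M s, algebraMap L M t] := by
    have := (algebraicIndependent_pair_of_top h2 hst).map' (f := IsScalarTower.toAlgHom K L M)
      (algebraMap L M).injective
    have heq : ![algebraMap L M s, algebraMap L M t] = IsScalarTower.toAlgHom K L M ∘ ![s, t] := by
      ext i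
      fin_cases i <;> rfl
    rw [heq]
    exact this.extendScalars _
  have hE : ∀ e : IntermediateField.adjoin K {ρ}, ∃ e' : IntermediateField.adjoin K {ρ},
      (e' : M) = σ e := by
    have hle : IntermediateField.adjoin K {ρ} ≤ (IntermediateField.adjoin K {ρ}).comap
        ((σ : M →ₐ[L] M).restrictScalars K) := by
      rw [IntermediateField.adjoin_le_iff, Set.singleton_subset_iff]
      change σ ρ ∈ IntermediateField.adjoin K {ρ}
      rw [hσρ, IsScalarTower.algebraMap_apply ℂ K M]
      exact mul_mem (IntermediateField.algebraMap_mem _ _) hρE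
    exact fun e => ⟨⟨σ e, hle e.2⟩, rfl⟩
  have : IsScalarTower ℂ (IntermediateField.adjoin K {ρ}) M :=
    .of_algebraMap_eq fun _ => rfl
  have hρ0 : ρ ≠ 0 := by
    rintro rfl
    exact hf (by simpa using hρ.symm)
  refine false_of_primitiveRoot (E := IntermediateField.adjoin K {ρ}) (σ : M ≃+* M) hp hσ hE hk
    hind.two_le_trdeg (s := algebraMap L M s) (t := algebraMap L M t) ?_ (σ.commutes s) (σ.commutes t)
    (x := algebraMap L M x) (y := algebraMap L M y) (z := algebraMap L M z) (e := ⟨ρ, hρE⟩)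
    (fun h => hρ0 (congrArg Subtype.val h)) ?_ ?_ (σ.commutes x) (σ.commutes y) (σ.commutes z) hζ hσρ
  · simpa only [Set.image_pair] using adjoin_image_eq_top hst hρM _ hρE
  · change _ = ρ ^ 30
    rw [hρ, IsScalarTower.algebraMap_apply K L M, ← h]
    simp
  · simpa only [Set.image_insert_eq, Set.image_singleton] using adjoin_image_eq_top hT hρM _ hρE

end Tower

lemma adjoin_algebraMap_mul {L Ω : Type*} [Field L] [Field Ω] [Algebra L Ω] {a : L} (ha : a ≠ 0)
    (ρ : Ω) : IntermediateField.adjoin L {algebraMap L Ω a * ρ} = IntermediateField.adjoin L {ρ} := by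
  apply le_antisymm <;> rw [IntermediateField.adjoin_le_iff, Set.singleton_subset_iff]
  · exact mul_mem (IntermediateField.algebraMap_mem _ _) (IntermediateField.mem_adjoin_simple_self L ρ)
  · have h := mul_mem (IntermediateField.algebraMap_mem _ a⁻¹)
      (IntermediateField.mem_adjoin_simple_self L (algebraMap L Ω a * ρ))
    rwa [← mul_assoc, ← map_mul, inv_mul_cancel₀ ha, map_one, one_mul] at h

theorem exists_root_of_adjoin_pair {K L : Type*} [Field K] [Field L] [Algebra K L] [Algebra ℂ K]
    [Algebra ℂ L] [IsScalarTower ℂ K L] {f : K} (hf : f ≠ 0)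
    {x y z s t : L} (h : x ^ 5 + y ^ 3 + z ^ 2 = algebraMap K L f) (h2 : 2 ≤ Algebra.trdeg K L)
    (hT : IntermediateField.adjoin K {x, y, z} = ⊤) (hst : IntermediateField.adjoin K {s, t} = ⊤) :
    ∃ ρ : K, ρ ^ 30 = f := by
  by_contra hne
  have : CharZero L := charZero_of_injective_algebraMap (algebraMap ℂ L).injective
  let Ω := AlgebraicClosure L
  obtain ⟨ρ, hρ⟩ := IsAlgClosed.exists_pow_nat_eq (algebraMap K Ω f) (n := 30) (by norm_num)
  have hρ0 : ρ ≠ 0 := by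
    rintro rfl
    exact hf (by simpa using hρ.symm)
  have hbot : ρ ∉ (⊥ : IntermediateField L Ω) := by
    rintro ⟨a, rfl⟩
    refine hne (exists_pow_eq_of_adjoin_pair (algebraicIndependent_pair_of_top h2 hst) hst
      (n := 30) (by norm_num) hf (a := a) ?_)
    apply (algebraMap L Ω).injective
    rw [← IsScalarTower.algebraMap_apply K L Ω, ← hρ]
    simp
  rw [InfiniteGalois.mem_bot_iff_fixed] at hbot
  push Not at hbot
  obtain ⟨σ, hσ⟩ := hbot
  have hk : ∀ (τ : Ω ≃ₐ[L] Ω) (a : ℂ), τ (algebraMap ℂ Ω a) = algebraMap ℂ Ω a := fun τ a => by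
    rw [IsScalarTower.algebraMap_apply ℂ L Ω, τ.commutes]
  obtain ⟨η, hη30, hη⟩ : ∃ η : ℂ, η ^ 30 = 1 ∧ σ ρ = algebraMap ℂ Ω η * ρ := by
    obtain ⟨w, hw⟩ : ∃ w : ℂ, IsPrimitiveRoot w 30 :=
      ⟨_, Complex.isPrimitiveRoot_exp 30 (by norm_num)⟩
    have h30 := hw.map_of_injective (algebraMap ℂ Ω).injective
    have hq : (σ ρ / ρ) ^ 30 = 1 := by
      rw [div_pow, ← map_pow, hρ, IsScalarTower.algebraMap_apply K L Ω, σ.commutes, div_self]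
      rw [← IsScalarTower.algebraMap_apply K L Ω]
      simpa using hf
    obtain ⟨i, -, hi⟩ := h30.eq_pow_of_pow_eq_one hq
    refine ⟨w ^ i, ?_, ?_⟩
    · rw [← pow_mul, mul_comm, pow_mul, hw.pow_eq_one, one_pow]
    · rw [map_pow, hi, div_mul_cancel₀ _ hρ0]
  have hn : orderOf η ∣ 30 := orderOf_dvd_of_pow_eq_one hη30
  have hn1 : orderOf η ≠ 1 := fun h1 => hσ (by rw [hη, orderOf_eq_one_iff.1 h1, map_one, one_mul])
  obtain ⟨p, hp, hpn⟩ := Nat.exists_prime_and_dvd hn1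
  have hp' : p = 2 ∨ p = 3 ∨ p = 5 := by
    have := hpn.trans hn
    rw [show 30 = 2 * (3 * 5) by norm_num, hp.dvd_mul, hp.dvd_mul,
      Nat.prime_dvd_prime_iff_eq hp Nat.prime_two, Nat.prime_dvd_prime_iff_eq hp Nat.prime_three,
      Nat.prime_dvd_prime_iff_eq hp Nat.prime_five] at this
    exact this
  obtain ⟨m, hm⟩ := hpn
  have hζ : IsPrimitiveRoot (η ^ m) p :=
    (IsPrimitiveRoot.orderOf η).pow (Nat.pos_of_dvd_of_pos hn (by norm_num)) (by rw [hm, mul_comm])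
  have hpow : ∀ n : ℕ, (σ ^ n) ρ = algebraMap ℂ Ω (η ^ n) * ρ := fun n => by
    induction n with
    | zero => simp
    | succ n ih =>
      rw [pow_succ', AlgEquiv.mul_apply, ih, map_mul, hk, hη, pow_succ, map_mul, mul_assoc]
  have hmap : (IntermediateField.adjoin L {ρ}).map ((σ ^ m : Ω ≃ₐ[L] Ω) : Ω →ₐ[L] Ω)
      = IntermediateField.adjoin L {ρ} := by
    have hη0 : algebraMap ℂ L (η ^ m) ≠ 0 := by
      have : η ≠ 0 := by
        rintro rfl
        norm_num at hη30
      simpa using pow_ne_zero m this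
    rw [IntermediateField.adjoin_map, Set.image_singleton]
    change IntermediateField.adjoin L {(σ ^ m) ρ} = _
    rw [hpow, IsScalarTower.algebraMap_apply ℂ L Ω, adjoin_algebraMap_mul hη0]
  let τ := (IntermediateField.intermediateFieldMap (σ ^ m) (IntermediateField.adjoin L {ρ})).trans
    (IntermediateField.equivOfEq hmap)
  have : IsScalarTower K L (IntermediateField.adjoin L {ρ}) :=
    .of_algebraMap_eq fun a => Subtype.ext (IsScalarTower.algebraMap_apply K L Ω a)
  have : IsScalarTower ℂ K (IntermediateField.adjoin L {ρ}) :=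
    .of_algebraMap_eq fun a => Subtype.ext (IsScalarTower.algebraMap_apply ℂ K Ω a)
  have : IsScalarTower ℂ L (IntermediateField.adjoin L {ρ}) :=
    .of_algebraMap_eq fun a => Subtype.ext (IsScalarTower.algebraMap_apply ℂ L Ω a)
  refine false_of_algEquiv τ hp' hf h h2 hT hst (ρ := IntermediateField.AdjoinSimple.gen L ρ)
    (Subtype.ext hρ) ?_ hζ (Subtype.ext (hpow m))
  apply IntermediateField.lift_injective
  rw [IntermediateField.lift_top, IntermediateField.lift_adjoin, Set.image_singleton]
  rfl

lemma fE8_ne_zero : fE8 ≠ 0 := by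
  have h : fE8 = algebraMap (MvPolynomial (Fin 3) ℂ) Fxyz (X 0 ^ 5 + X 1 ^ 3 + X 2 ^ 2) := by
    simp [fE8, Vx, Vy, Vz]
  rw [h, ne_eq, map_eq_zero_iff _ (IsFractionRing.injective _ _)]
  intro h0
  simpa using congrArg (MvPolynomial.eval ![1, 0, 0]) h0

lemma trdeg_adjoin_simple_le {F E : Type*} [Field F] [Field E] [Algebra F E] (a : E) :
    Algebra.trdeg F (IntermediateField.adjoin F {a}) ≤ 1 := by
  have htop : IntermediateField.adjoin F {IntermediateField.AdjoinSimple.gen F a} = ⊤ := by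
    apply IntermediateField.lift_injective
    rw [IntermediateField.lift_top, IntermediateField.lift_adjoin, Set.image_singleton]
    rfl
  have : Algebra.IsAlgebraic (Algebra.adjoin F {IntermediateField.AdjoinSimple.gen F a})
      (IntermediateField.adjoin F {a}) := by
    rw [← IntermediateField.isAlgebraic_adjoin_iff_top]
    refine ⟨fun c => ?_⟩
    exact isAlgebraic_algebraMap (⟨c, htop ▸ trivial⟩ :
      IntermediateField.adjoin F {IntermediateField.AdjoinSimple.gen F a})
  simpa using Algebra.IsAlgebraic.trdeg_le_cardinalMk F {IntermediateField.AdjoinSimple.gen F a}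

section Compositum

variable {K L : Type} [Field K] [Field L] [Algebra Cf K] [Algebra K L]
  [Algebra ℂ K] [IsScalarTower ℂ Cf K] {ι : Fxyz →+* L}

lemma two_le_trdeg_of_ringHom [Algebra ℂ L] [IsScalarTower ℂ K L] [FiniteDimensional Cf K]
    (hι : ∀ c : Cf, ι c = algebraMap K L (algebraMap Cf K c)) : 2 ≤ Algebra.trdeg K L := by
  have hC : ∀ a : ℂ, ι (algebraMap ℂ Fxyz a) = algebraMap ℂ L a := fun a => by
    have := hι (algebraMap ℂ Cf a)
    rwa [← IsScalarTower.algebraMap_apply ℂ Cf K, ← IsScalarTower.algebraMap_apply ℂ K L] at this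
  let φ : Fxyz →ₐ[ℂ] L := { ι with commutes' := hC }
  have h3 : 3 ≤ Algebra.trdeg ℂ L := by
    have h := (algebraicIndependent_X (Fin 3) ℂ).map'
      (f := φ.comp (IsScalarTower.toAlgHom ℂ (MvPolynomial (Fin 3) ℂ) Fxyz))
      (φ.toRingHom.injective.comp (IsFractionRing.injective _ _))
    simpa using h.lift_cardinalMk_le_trdeg
  have h1 : Algebra.trdeg ℂ K ≤ 1 := by
    rw [← trdeg_add_eq ℂ Cf (A := K), trdeg_eq_zero (R := Cf), add_zero]
    exact trdeg_adjoin_simple_le fE8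
  rw [← trdeg_add_eq ℂ K (A := L)] at h3
  by_contra hlt
  rw [Cardinal.two_le_iff_one_lt, not_lt] at hlt
  have := h3.trans (add_le_add h1 hlt)
  norm_num at this

lemma adjoin_eq_top_of_ringHom (hι : ∀ c : Cf, ι c = algebraMap K L (algebraMap Cf K c))
    (hgen : ∀ S : Subring L, (∀ k, algebraMap K L k ∈ S) → (∀ a, ι a ∈ S) → S = ⊤) :
    IntermediateField.adjoin K {ι Vx, ι Vy, ι Vz} = ⊤ := by
  have hC : ∀ a : ℂ, ι (algebraMap ℂ Fxyz a) = algebraMap K L (algebraMap ℂ K a) := fun a => by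
    have := hι (algebraMap ℂ Cf a)
    rwa [← IsScalarTower.algebraMap_apply ℂ Cf K] at this
  have hpoly : ∀ p : MvPolynomial (Fin 3) ℂ,
      ι (algebraMap _ Fxyz p) ∈ IntermediateField.adjoin K {ι Vx, ι Vy, ι Vz} := fun p => by
    induction p using MvPolynomial.induction_on with
    | C a =>
      rw [← MvPolynomial.algebraMap_eq, ← IsScalarTower.algebraMap_apply ℂ _ Fxyz, hC]
      exact IntermediateField.algebraMap_mem _ _
    | add p q hp hq => rw [map_add, map_add]; exact add_mem hp hq
    | mul_X p i hp =>
      rw [map_mul, map_mul]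
      refine mul_mem hp (IntermediateField.subset_adjoin _ _ ?_)
      fin_cases i <;> simp [Vx, Vy, Vz]
  have htop := hgen (IntermediateField.adjoin K {ι Vx, ι Vy, ι Vz}).toSubfield.toSubring
    (fun k => IntermediateField.algebraMap_mem _ k) (fun a => by
      obtain ⟨p, q, -, rfl⟩ := IsFractionRing.div_surjective (A := MvPolynomial (Fin 3) ℂ) a
      rw [map_div₀]
      exact (IntermediateField.adjoin K {ι Vx, ι Vy, ι Vz}).div_mem (hpoly p) (hpoly q))
  rw [← top_le_iff]
  intro a _
  have : a ∈ (IntermediateField.adjoin K {ι Vx, ι Vy, ι Vz}).toSubfield.toSubring := htop ▸ trivial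
  exact this

lemma closure_eq_top_iff {K L : Type*} [Field K] [Field L] [Algebra K L] (g h : L) :
    Subfield.closure (Set.range (algebraMap K L) ∪ {g, h}) = ⊤ ↔
      IntermediateField.adjoin K {g, h} = ⊤ := by
  rw [← IntermediateField.adjoin_toSubfield, ← IntermediateField.top_toSubfield (F := K),
    IntermediateField.toSubfield_injective.eq_iff]

end Compositum

theorem exists_closure_eq_top_iff_exists_root {K L : Type} [Field K] [Field L] [Algebra Cf K]
    [FiniteDimensional Cf K] [Algebra K L] (ι : Fxyz →+* L)
    (hι : ∀ c : Cf, ι c = algebraMap K L (algebraMap Cf K c))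
    (hgen : ∀ S : Subring L, (∀ k, algebraMap K L k ∈ S) → (∀ a, ι a ∈ S) → S = ⊤) :
    (∃ g h : L, Subfield.closure (Set.range (algebraMap K L) ∪ {g, h}) = ⊤) ↔
      ∃ ρ : K, ρ ^ 30 = algebraMap Cf K ⟨fE8, IntermediateField.subset_adjoin ℂ {fE8} rfl⟩ := by
  let _ : Algebra ℂ K := ((algebraMap Cf K).comp (algebraMap ℂ Cf)).toAlgebra
  let _ : Algebra ℂ L := ((algebraMap K L).comp (algebraMap ℂ K)).toAlgebra
  have : IsScalarTower ℂ Cf K := .of_algebraMap_eq fun _ => rfl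
  have : IsScalarTower ℂ K L := .of_algebraMap_eq fun _ => rfl
  have h2 := two_le_trdeg_of_ringHom hι
  have hT := adjoin_eq_top_of_ringHom hι hgen
  set f : Cf := ⟨fE8, IntermediateField.subset_adjoin ℂ {fE8} rfl⟩
  have hf : algebraMap Cf K f ≠ 0 := by
    rw [ne_eq, map_eq_zero]
    exact fun h => fE8_ne_zero (congrArg Subtype.val h)
  have hsum : ι Vx ^ 5 + ι Vy ^ 3 + ι Vz ^ 2 = algebraMap K L (algebraMap Cf K f) := by
    rw [← hι, ← map_pow, ← map_pow, ← map_pow, ← map_add, ← map_add]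
    rfl
  simp only [closure_eq_top_iff]
  constructor
  · rintro ⟨g, h, hgh⟩
    exact exists_root_of_adjoin_pair hf hsum h2 hT hgh
  · rintro ⟨ρ, hρ⟩
    refine exists_adjoin_pair_eq_top h2 (e := ρ) ?_ ?_ hT
    · rintro rfl
      exact hf (by rw [← hρ, zero_pow (by norm_num)])
    · rw [hsum, ← hρ, map_pow]

theorem e8_rational_iff_root (K : Type) [Field K] [Algebra Cf K]
    [FiniteDimensional Cf K] (hL : IsField (K ⊗[Cf] Fxyz)) :
    letI : Field (K ⊗[Cf] Fxyz) := hL.toField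
    ((∃ g h : K ⊗[Cf] Fxyz,
        Subfield.closure
          (Set.range (algebraMap K (K ⊗[Cf] Fxyz)) ∪ {g, h}) = ⊤) ↔
      ∃ ρ : K, ρ ^ 30 = algebraMap Cf K ⟨fE8, IntermediateField.subset_adjoin ℂ {fE8} rfl⟩) := by
  let _ : Field (K ⊗[Cf] Fxyz) := hL.toField
  let ι : Fxyz →+* K ⊗[Cf] Fxyz :=
    (Algebra.TensorProduct.includeRight : Fxyz →ₐ[Cf] K ⊗[Cf] Fxyz).toRingHom
  refine exists_closure_eq_top_iff_exists_root ι ?_ ?_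
  · intro c
    change (1 : K) ⊗ₜ[Cf] (algebraMap Cf Fxyz c) = (algebraMap Cf K c) ⊗ₜ[Cf] (1 : Fxyz)
    rw [Algebra.algebraMap_eq_smul_one, Algebra.algebraMap_eq_smul_one, TensorProduct.smul_tmul]
  · intro S hK hι
    rw [eq_top_iff]
    intro a _
    induction a using TensorProduct.induction_on with
    | zero => exact S.zero_mem
    | tmul k b =>
      have := S.mul_mem (hK k) (hι b)
      have heq : algebraMap K (K ⊗[Cf] Fxyz) k * ι b = k ⊗ₜ b := by
        change (k ⊗ₜ[Cf] (1 : Fxyz)) * ((1 : K) ⊗ₜ[Cf] b) = k ⊗ₜ b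
        rw [Algebra.TensorProduct.tmul_mul_tmul, mul_one, one_mul]
      rwa [heq] at this
    | add b c hb hc => exact S.add_mem (hb trivial) (hc trivial)

end
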